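/- arXiv:1809.04875 — 2 statements merged into one kernel-verified Lean document; each statement's English description precedes it below -/
import Mathlib

section
/- Let N ≥ 3 and let B be the open unit ball in ℝ^N. Suppose k : ℝ^N → ℝ satisfies: (k1) k is nonnegative, not identically zero, radial, and α-Hölder continuous on the closed unit ball for some α ∈ (0,1]; (k2) there exist β > 0 and constants C₀, δ₀ > 0 with k(x) ≤ C₀|x|^β for all |x| ≤ δ₀; (k4) there exists a point x₀ in the closed unit ball with k(x₀) > 0. Suppose f : ℝ → ℝ satisfies: (f1) f is Hölder continuous on every compact interval, f(t) ≥ 0 for t > 0 and f(t) = 0 for t ≤ 0; (f2) f(t)/t → 0 as t → 0⁺ and f(t)/t^q → 0 as t → ∞, where q = (N+2+2β)/(N−2); (f3) there exists θ > 2 with t·f(t) ≥ θ·F(t) for all t ≥ 0, where F(t) = ∫₀ᵗ f(s) ds; (f5) there exists c > 0 with f(t) > 0 for all t ∈ (0,c). Then there exists λ* > 0 such that for every λ > λ* there exists a radial function u, continuous on the closed unit ball and twice continuously differentiable on B, with u > 0 in B, u = 0 on the unit sphere, satisfying −Δu(x) = u(x)^((N+2)/(N−2)) + λ·k(x)·f(u(x))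 for all x ∈ B. -/
open scoped NNReal
open MeasureTheory Filter Set Metric

noncomputable def laplacian {N : ℕ} (u : EuclideanSpace ℝ (Fin N) → ℝ)
    (x : EuclideanSpace ℝ (Fin N)) : ℝ :=
  ∑ i, fderiv ℝ (fun y => fderiv ℝ u y (EuclideanSpace.single i (1:ℝ))) x
      (EuclideanSpace.single i (1:ℝ))

lemma mp_step {E : Type*} [NormedAddCommGroup E] [InnerProductSpace ℝ E]
    (J : E → ℝ) (D : E → E) (hD : ∀ y, HasFDerivAt J (innerSL ℝ (D y)) y)
    (δ : ℝ) (u d : E) (t : ℝ) (ht : 0 ≤ t)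
    (hd : ‖d‖ ≤ 1) (hdd : δ ≤ inner ℝ (D u) d)
    (hu : ∀ v, dist v u ≤ t → ‖D v - D u‖ ≤ δ / 2) :
    J (u - t • d) ≤ J u - t * (δ / 2) := by
  have hδ : 0 ≤ δ / 2 := le_trans (norm_nonneg _) (hu u (by simpa using ht))
  have h := (convex_closedBall u t).norm_image_sub_le_of_norm_hasFDerivWithin_le'
    (f := J) (f' := fun y => innerSL ℝ (D y)) (φ := innerSL ℝ (D u)) (C := δ / 2)
    (x := u) (y := u - t • d)
    (fun x _ => (hD x).hasFDerivWithinAt)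
    (fun x hx => by
      rw [← map_sub]
      rw [innerSL_apply_norm]
      exact hu x hx)
    (mem_closedBall_self ht)
    (by
      rw [mem_closedBall, dist_eq_norm]
      simp only [sub_sub_cancel_left, norm_neg, norm_smul, Real.norm_eq_abs, abs_of_nonneg ht]
      nlinarith)
  have e1 : u - t • d - u = -(t • d) := by abel
  rw [e1, norm_neg, norm_smul, Real.norm_eq_abs, Real.norm_eq_abs, abs_of_nonneg ht] at h
  simp only [innerSL_apply_apply, inner_neg_right, inner_smul_right] at h
  have h2 := (abs_le.1 h).2
  have h3 : t * ‖d‖ ≤ t := by nlinarith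
  nlinarith [mul_le_mul_of_nonneg_left hdd ht, mul_le_mul_of_nonneg_left h3 hδ]

lemma mp_lemma {E : Type*} [NormedAddCommGroup E] [InnerProductSpace ℝ E]
    [FiniteDimensional ℝ E]
    (J : E → ℝ) (D : E → E) (hD : ∀ y, HasFDerivAt J (innerSL ℝ (D y)) y)
    (hDc : Continuous D) (J0 : J 0 = 0) (ρ α c R1 : ℝ) (hρ : 0 < ρ) (hα : 0 < α)
    (hJρ : ∀ y, ‖y‖ = ρ → α ≤ J y) (e : E) (he : J e ≤ 0) (heρ : ρ < ‖e‖)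
    (hpath : ∀ s ∈ Icc (0:ℝ) 1, J (s • e) ≤ c)
    (hR1 : ∀ y, J y ≤ c → R1 ≤ ‖y‖ → 1 ≤ ‖D y‖) :
    ∃ y, D y = 0 ∧ 0 < J y ∧ J y ≤ c := by
  classical
  have : ProperSpace E := FiniteDimensional.proper ℝ E
  by_contra hcon
  push Not at hcon
  have hJc : Continuous J := continuous_iff_continuousAt.2 fun y => (hD y).continuousAt
  -- lower bound of the gradient
  obtain ⟨δ, hδ, hδD⟩ : ∃ δ > 0, ∀ y, α / 2 ≤ J y → J y ≤ c → δ ≤ ‖D y‖ := by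
    let S : Set E := closedBall 0 R1 ∩ {y | α / 2 ≤ J y ∧ J y ≤ c}
    have hS : IsCompact S := (isCompact_closedBall 0 R1).inter_right
      ((isClosed_le continuous_const hJc).inter (isClosed_le hJc continuous_const))
    rcases S.eq_empty_or_nonempty with h0 | hne
    · refine ⟨1, one_pos, fun y h1 h2 => hR1 y h2 ?_⟩
      by_contra h3
      have : y ∈ S := ⟨by simpa using (not_le.1 h3).le, h1, h2⟩
      rw [h0] at this; exact this
    · obtain ⟨z, hz, hzm⟩ := hS.exists_isMinOn hne hDc.norm.continuousOn
      have hz0 : 0 < ‖D z‖ := by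
        rw [norm_pos_iff]
        intro h
        exact absurd (hcon z h (by linarith [hz.2.1])) (not_lt.2 hz.2.2)
      refine ⟨min 1 ‖D z‖, lt_min one_pos hz0, fun y h1 h2 => ?_⟩
      by_cases h3 : R1 ≤ ‖y‖
      · exact (min_le_left _ _).trans (hR1 y h2 h3)
      · exact (min_le_right _ _).trans (hzm ⟨by simpa using (not_le.1 h3).le, h1, h2⟩)
  have hc : 0 ≤ c := by simpa [J0] using hpath 0 (by simp)
  set R : ℝ := ‖e‖ + 2 * c / δ + 4 with hR
  have huc : UniformContinuousOn D (closedBall 0 R) :=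
    (isCompact_closedBall 0 R).uniformContinuousOn_of_continuous hDc.continuousOn
  obtain ⟨τ0, hτ0, hτD⟩ := Metric.uniformContinuousOn_iff.1 huc (δ / 2) (by positivity)
  set τ : ℝ := min 1 (τ0 / 2) with hτ
  have hτp : 0 < τ := lt_min one_pos (by positivity)
  have hτ1 : τ ≤ 1 := min_le_left _ _
  have hτ2 : τ < τ0 := by have := min_le_right 1 (τ0 / 2); linarith
  set χ : E → ℝ := fun u => max 0 (min 1 ((J u - α / 2) / (α / 2))) with hχ
  set T : E → E := fun u => u - (τ * χ u) • ((max ‖D u‖ δ)⁻¹ • D u) with hT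
  have hχ0 : ∀ u, 0 ≤ χ u := fun u => le_max_left _ _
  have hχ1 : ∀ u, χ u ≤ 1 := fun u => max_le zero_le_one (min_le_left _ _)
  have hχz : ∀ u, J u ≤ α / 2 → χ u = 0 := fun u hu => by
    apply max_eq_left
    apply (min_le_right _ _).trans
    exact div_nonpos_of_nonpos_of_nonneg (by linarith) (by positivity)
  have hχo : ∀ u, α ≤ J u → χ u = 1 := fun u hu => by
    have : 1 ≤ (J u - α / 2) / (α / 2) := by rw [le_div_iff₀ (by positivity)]; linarith
    simp [hχ, min_eq_left this]
  have hmx : ∀ u, 0 < max ‖D u‖ δ := fun u => lt_max_of_lt_right hδ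
  have hTc : Continuous T := by
    have : Continuous χ := by fun_prop
    have h2 : Continuous fun u => (max ‖D u‖ δ)⁻¹ :=
      (hDc.norm.max continuous_const).inv₀ fun u => (hmx u).ne'
    fun_prop
  have hdn : ∀ u, ‖(max ‖D u‖ δ)⁻¹ • D u‖ ≤ 1 := fun u => by
    rw [norm_smul, norm_inv, Real.norm_of_nonneg (hmx u).le, inv_mul_le_iff₀ (hmx u), mul_one]
    exact le_max_left _ _
  have hTn : ∀ u, ‖T u‖ ≤ ‖u‖ + τ := fun u => by
    refine (norm_sub_le _ _).trans ?_
    rw [norm_smul, Real.norm_of_nonneg (mul_nonneg hτp.le (hχ0 u))]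
    have h1 := hdn u
    have h2 : τ * χ u ≤ τ := by nlinarith [hχ1 u]
    have h3 := mul_le_mul h2 h1 (norm_nonneg _) hτp.le
    linarith
  have hTJ : ∀ u, ‖u‖ ≤ R - 1 → J u ≤ c → J (T u) ≤ J u - (τ * χ u) * (δ / 2) := by
    intro u huR huc
    by_cases hJ : J u ≤ α / 2
    · simp [hT, hχz u hJ]
    push Not at hJ
    have hDu := hδD u hJ.le huc
    apply mp_step J D hD δ u _ _ (mul_nonneg hτp.le (hχ0 u)) (hdn u)
    · rw [inner_smul_right, real_inner_self_eq_norm_sq, max_eq_left hDu]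
      have : 0 < ‖D u‖ := by linarith
      field_simp
      exact hDu
    · intro v hv
      have h2 : τ * χ u ≤ τ := by nlinarith [hχ1 u]
      have hvd : dist v u < τ0 := by linarith
      have hv1 : dist v u ≤ 1 := by linarith
      rw [← dist_eq_norm]
      refine (hτD v ?_ u ?_ hvd).le
      · rw [mem_closedBall, dist_zero_right]
        rw [dist_eq_norm] at hv1
        have := norm_le_norm_add_norm_sub' v u
        linarith
      · rw [mem_closedBall, dist_zero_right]; linarith
  obtain ⟨n, hn⟩ : ∃ n : ℕ, n = ⌈2 * c / (τ * δ)⌉₊ + 1 := ⟨_, rfl⟩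
  have hn1 : c < n * τ * (δ / 2) := by
    have := Nat.le_ceil (2 * c / (τ * δ))
    rw [div_le_iff₀ (by positivity)] at this
    rw [hn]; push_cast
    have : 0 < τ * δ := by positivity
    nlinarith
  have hn2 : n * τ ≤ 2 * c / δ + 2 := by
    have := Nat.ceil_lt_add_one (a := 2 * c / (τ * δ)) (by positivity)
    have h3 : (n : ℝ) ≤ 2 * c / (τ * δ) + 2 := by rw [hn]; push_cast; linarith
    calc n * τ ≤ (2 * c / (τ * δ) + 2) * τ := by gcongr
      _ = 2 * c / δ + 2 * τ := by field_simp
      _ ≤ _ := by linarith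
  have hcont : Continuous fun s : ℝ => ‖T^[n] (s • e)‖ :=
    ((hTc.iterate n).comp (by fun_prop)).norm
  have hT0 : T^[n] 0 = 0 := by
    apply Function.iterate_fixed
    simp [hT, hχz 0 (by rw [J0]; positivity)]
  have hTe : T^[n] e = e := by
    apply Function.iterate_fixed
    simp [hT, hχz e (by linarith)]
  obtain ⟨s, hs, hsρ⟩ : ∃ s ∈ Icc (0:ℝ) 1, ‖T^[n] (s • e)‖ = ρ := by
    have := intermediate_value_Icc (zero_le_one (α := ℝ)) hcont.continuousOn
    apply this
    simp only [zero_smul, one_smul, hT0, hTe, norm_zero]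
    exact ⟨hρ.le, heρ.le⟩
  have hbd : ∀ j ≤ n, ‖T^[j] (s • e)‖ ≤ ‖e‖ + j * τ := by
    intro j
    induction j with
    | zero =>
      intro _
      simp only [Function.iterate_zero, id, norm_smul, Real.norm_of_nonneg hs.1]
      have := mul_le_mul_of_nonneg_right hs.2 (norm_nonneg e)
      push_cast; linarith
    | succ j ih =>
      intro hj
      rw [Function.iterate_succ_apply']
      have := ih (by omega)
      have := hTn (T^[j] (s • e))
      push_cast; linarith
  have hbR : ∀ j ≤ n, ‖T^[j] (s • e)‖ ≤ R - 1 := by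
    intro j hj
    have h1 := hbd j hj
    have : (j : ℝ) * τ ≤ n * τ := by gcongr
    linarith
  have hJc' : ∀ j ≤ n, J (T^[j] (s • e)) ≤ c := by
    intro j
    induction j with
    | zero => intro _; exact hpath s hs
    | succ j ih =>
      intro hj
      rw [Function.iterate_succ_apply']
      have h1 := hTJ _ (hbR j (by omega)) (ih (by omega))
      have h2 : 0 ≤ τ * χ (T^[j] (s • e)) * (δ / 2) :=
        mul_nonneg (mul_nonneg hτp.le (hχ0 _)) (by positivity)
      linarith [ih (by omega)]
  have hstep : ∀ j < n, J (T^[j+1] (s • e)) ≤ J (T^[j] (s • e)) - τ * χ (T^[j] (s • e)) * (δ / 2) := by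
    intro j hj
    rw [Function.iterate_succ_apply']
    exact hTJ _ (hbR j hj.le) (hJc' j hj.le)
  have hge : ∀ i, i ≤ n → α ≤ J (T^[n - i] (s • e)) := by
    intro i
    induction i with
    | zero => intro _; exact hJρ _ hsρ
    | succ i ih =>
      intro hi
      have h1 := ih (by omega)
      have h2 := hstep (n - (i + 1)) (by omega)
      rw [show n - (i + 1) + 1 = n - i by omega] at h2
      have h3 : 0 ≤ τ * χ (T^[n - (i + 1)] (s • e)) * (δ / 2) :=
        mul_nonneg (mul_nonneg hτp.le (hχ0 _)) (by positivity)
      linarith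
  have hdec : ∀ j ≤ n, J (T^[j] (s • e)) ≤ c - j * τ * (δ / 2) := by
    intro j
    induction j with
    | zero => intro _; simpa using hpath s hs
    | succ j ih =>
      intro hj
      have h1 := hstep j (by omega)
      have h2 := hge (n - j) (by omega)
      rw [show n - (n - j) = j by omega] at h2
      rw [hχo _ h2] at h1
      have := ih (by omega)
      push_cast; linarith
  have h1 := hdec n le_rfl
  have h2 := hJρ _ hsρ
  linarith

lemma prim_bounds (φ : ℝ → ℝ) (hc : Continuous φ) (h0 : ∀ t ≤ 0, φ t = 0)
    (hnn : ∀ t, 0 ≤ φ t) (t : ℝ) :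
    0 ≤ (∫ s in (0:ℝ)..t, φ s) ∧ (t ≤ 0 → (∫ s in (0:ℝ)..t, φ s) = 0) := by
  have h2 : t ≤ 0 → (∫ s in (0:ℝ)..t, φ s) = 0 := by
    intro ht
    rw [intervalIntegral.integral_congr (g := fun _ => (0:ℝ))]
    · simp
    · intro s hs
      rw [uIcc_of_ge ht] at hs
      exact h0 s hs.2
  refine ⟨?_, h2⟩
  rcases le_total 0 t with ht | ht
  · exact intervalIntegral.integral_nonneg ht fun s _ => hnn s
  · exact (h2 ht).ge

lemma prim_small (φ : ℝ → ℝ) (h0 : ∀ t ≤ 0, φ t = 0)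
    (hnn : ∀ t, 0 ≤ φ t) (ho : ∀ ε > 0, ∀ᶠ t in nhds (0:ℝ), φ t ≤ ε * |t|) (ε : ℝ)
    (hε : 0 < ε) : ∀ᶠ t in nhds (0:ℝ), (∫ s in (0:ℝ)..t, φ s) ≤ ε * t ^ 2 := by
  obtain ⟨r, hr, hh⟩ := Metric.eventually_nhds_iff.1 (ho ε hε)
  refine Metric.eventually_nhds_iff.2 ⟨r, hr, fun t ht => ?_⟩
  have := intervalIntegral.norm_integral_le_of_norm_le_const (a := 0) (b := t) (f := φ)
    (C := ε * |t|) (fun s hs => by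
      have hs' : |s| ≤ |t| := by
        have := abs_sub_left_of_mem_uIcc (uIoc_subset_uIcc hs)
        simpa using this
      rw [Real.norm_of_nonneg (hnn s)]
      refine (hh (y := s) ?_).trans (by gcongr)
      rw [dist_zero_right, Real.norm_eq_abs] at ht ⊢
      linarith)
  rw [sub_zero, mul_assoc, ← sq, sq_abs] at this
  exact (le_abs_self _).trans this

lemma disc_abs {E : Type*} [NormedAddCommGroup E] [InnerProductSpace ℝ E]
    [FiniteDimensional ℝ E] {ι : Type*} [Fintype ι] (a : ι → E) (φ : ι → ℝ → ℝ)
    (hc : ∀ i, Continuous (φ i)) (h0 : ∀ i, ∀ t ≤ 0, φ i t = 0) (hnn : ∀ i t, 0 ≤ φ i t)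
    (ho : ∀ i, ∀ ε > 0, ∀ᶠ t in nhds (0:ℝ), φ i t ≤ ε * |t|)
    (θ : ℝ) (hθ : 2 < θ) (hAR : ∀ i, ∀ t, 0 ≤ t → θ * (∫ s in (0:ℝ)..t, φ i s) ≤ t * φ i t)
    (c : ℝ) (e : E) (he0 : e ≠ 0) (hec : ‖e‖ ^ 2 / 2 ≤ c)
    (he : ‖e‖ ^ 2 / 2 ≤ ∑ i, ∫ s in (0:ℝ)..(inner ℝ (a i) e), φ i s) :
    ∃ y : E, y ≠ 0 ∧ y = ∑ i, φ i (inner ℝ (a i) y) • a i ∧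
      (1 / 2 - 1 / θ) * ‖y‖ ^ 2 ≤ c := by
  set Φ : ι → ℝ → ℝ := fun i t => ∫ s in (0:ℝ)..t, φ i s with hΦ
  set J : E → ℝ := fun y => ‖y‖ ^ 2 / 2 - ∑ i, Φ i (inner ℝ (a i) y) with hJ
  set D : E → E := fun y => y - ∑ i, φ i (inner ℝ (a i) y) • a i with hD
  have hΦd : ∀ i t, HasDerivAt (Φ i) (φ i t) t := fun i t =>
    intervalIntegral.integral_hasDerivAt_right ((hc i).intervalIntegrable _ _)
      ((hc i).stronglyMeasurableAtFilter _ _) (hc i).continuousAt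
  have hΦ0 : ∀ i t, 0 ≤ Φ i t := fun i t => (prim_bounds _ (hc i) (h0 i) (hnn i) t).1
  have hJD : ∀ y, HasFDerivAt J (innerSL ℝ (D y)) y := by
    intro y
    have h1 : HasFDerivAt (fun y : E => ‖y‖ ^ 2) (2 • innerSL ℝ y) y :=
      (hasStrictFDerivAt_norm_sq y).hasFDerivAt
    have h2 : ∀ i, HasFDerivAt (fun y : E => Φ i (inner ℝ (a i) y))
        (φ i (inner ℝ (a i) y) • innerSL ℝ (a i)) y := fun i =>
      (hΦd i (inner ℝ (a i) y)).comp_hasFDerivAt (h₂ := Φ i) (f := fun y => inner ℝ (a i) y) y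
        (innerSL ℝ (a i)).hasFDerivAt
    have h3 := (h1.const_mul (1/2 : ℝ)).sub (HasFDerivAt.fun_sum (u := Finset.univ) fun i _ => h2 i)
    have e1 : J = (fun y => 1 / 2 * ‖y‖ ^ 2) - fun y => ∑ i, Φ i (inner ℝ (a i) y) := by
      ext y; simp only [hJ, Pi.sub_apply]; ring
    have e2 : innerSL ℝ (D y) = (1 / 2 : ℝ) • 2 • innerSL ℝ y
        - ∑ i, φ i (inner ℝ (a i) y) • innerSL ℝ (a i) := by
      ext z
      simp [hD, sum_inner, inner_smul_left, inner_sub_left]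
    rw [e1, e2]
    exact h3
  have hDc : Continuous D := by
    have : ∀ i, Continuous fun y => φ i (inner ℝ (a i) y) := fun i =>
      (hc i).comp (by fun_prop)
    fun_prop
  have hJ0 : J 0 = 0 := by simp [hJ, hΦ]
  have hAR' : ∀ y, (1 / 2 - 1 / θ) * ‖y‖ ^ 2 ≤ J y - (1 / θ) * inner ℝ (D y) y := by
    intro y
    have h1 : ∀ i, Φ i (inner ℝ (a i) y) ≤
        (1 / θ) * (φ i (inner ℝ (a i) y) * inner ℝ (a i) y) := by
      intro i
      rcases le_total 0 (inner ℝ (a i) y) with h | h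
      · have := hAR i _ h
        rw [one_div, le_inv_mul_iff₀ (by linarith)]
        linarith
      · rw [h0 i _ h]
        simp only [zero_mul, mul_zero]
        exact ((prim_bounds _ (hc i) (h0 i) (hnn i) _).2 h).le
    have h2 := Finset.sum_le_sum fun i (_ : i ∈ Finset.univ) => h1 i
    rw [← Finset.mul_sum] at h2
    have h3 : inner ℝ (D y) y = ‖y‖ ^ 2 - ∑ i, φ i (inner ℝ (a i) y) * inner ℝ (a i) y := by
      simp [hD, inner_sub_left, sum_inner, inner_smul_left]
    rw [h3]; simp only [hJ]; linarith
  have hκ : 0 < 1 / 2 - 1 / θ := by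
    have : 1 / θ < 1 / 2 := one_div_lt_one_div_of_lt (by norm_num) hθ
    linarith
  have hc0 : 0 ≤ c := le_trans (by positivity) hec
  -- small ball
  obtain ⟨ρ1, hρ1, hball⟩ : ∃ ρ1 > 0, ∀ y : E, ‖y‖ < ρ1 → ‖y‖ ^ 2 / 4 ≤ J y := by
    set A := ∑ i, ‖a i‖ ^ 2 with hA
    have hA0 : 0 ≤ A := Finset.sum_nonneg fun i _ => by positivity
    have h1 : ∀ᶠ y : E in nhds 0, ∀ i, Φ i (inner ℝ (a i) y) ≤
        (1 / (4 * (1 + A))) * (inner ℝ (a i) y : ℝ) ^ 2 := by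
      rw [eventually_all]
      intro i
      have ht : Tendsto (fun y : E => (inner ℝ (a i) y : ℝ)) (nhds 0) (nhds 0) := by
        have : Continuous fun y : E => (inner ℝ (a i) y : ℝ) := by fun_prop
        simpa using this.tendsto 0
      exact ht.eventually (prim_small _ (h0 i) (hnn i) (ho i) _ (by positivity))
    obtain ⟨r, hr, hh⟩ := Metric.eventually_nhds_iff.1 h1
    refine ⟨r, hr, fun y hy => ?_⟩
    have h2 := hh (y := y) (by simpa using hy)
    have h3 : ∑ i, Φ i (inner ℝ (a i) y) ≤ ∑ i, (1 / (4 * (1 + A))) * (‖a i‖ ^ 2 * ‖y‖ ^ 2) := by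
      refine Finset.sum_le_sum fun i _ => (h2 i).trans ?_
      gcongr
      rw [← mul_pow, ← sq_abs]
      gcongr
      exact abs_real_inner_le_norm _ _
    rw [← Finset.mul_sum, ← Finset.sum_mul, ← hA] at h3
    have h4 : 1 / (4 * (1 + A)) * (A * ‖y‖ ^ 2) ≤ ‖y‖ ^ 2 / 4 := by
      rw [div_mul_eq_mul_div, div_le_iff₀ (by positivity)]
      nlinarith [sq_nonneg ‖y‖]
    simp only [hJ]; linarith
  have hen : 0 < ‖e‖ := norm_pos_iff.2 he0
  set ρ := min (ρ1 / 2) (‖e‖ / 2) with hρ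
  have hρp : 0 < ρ := lt_min (by positivity) (by positivity)
  obtain ⟨y, hy0, hyJ, hyc⟩ := mp_lemma J D hJD hDc hJ0 ρ (ρ ^ 2 / 4) c
    (max 1 ((1 + c) / (1 / 2 - 1 / θ))) hρp (by positivity)
    (fun y hy => by
      have := hball y (by have := min_le_left (ρ1 / 2) (‖e‖ / 2); rw [hy]; linarith)
      rwa [hy] at this) e (by simp only [hJ]; linarith)
    (by have := min_le_right (ρ1 / 2) (‖e‖ / 2); linarith)
    (fun s hs => by
      have : 0 ≤ ∑ i, Φ i (inner ℝ (a i) (s • e)) := Finset.sum_nonneg fun i _ => hΦ0 i _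
      simp only [hJ]
      rw [norm_smul, Real.norm_of_nonneg hs.1]
      have : (s * ‖e‖) ^ 2 ≤ ‖e‖ ^ 2 := by
        have := mul_nonneg hs.1 hen.le
        exact pow_le_pow_left₀ this (by nlinarith [hs.2]) 2
      linarith)
    (fun y hyc hyR => by
      have h1 := hAR' y
      have hy1 : 1 ≤ ‖y‖ := (le_max_left _ _).trans hyR
      have hy2 : 1 + c ≤ (1 / 2 - 1 / θ) * ‖y‖ := by
        have := (le_max_right _ _).trans hyR
        rw [div_le_iff₀ hκ] at this; linarith
      have h2 : -(1 / θ) * inner ℝ (D y) y ≤ ‖D y‖ * ‖y‖ := by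
        have h4 := abs_real_inner_le_norm (D y) y
        have h5 : 1 / θ ≤ 1 := by linarith
        have h6 : 0 < 1 / θ := by positivity
        have h7 := neg_abs_le (inner ℝ (D y) y : ℝ)
        have h8 := abs_nonneg (inner ℝ (D y) y : ℝ)
        nlinarith
      by_contra h3
      push Not at h3
      have h4 : (1 / 2 - 1 / θ) * ‖y‖ ^ 2 ≤ c + ‖D y‖ * ‖y‖ := by linarith
      have h5 : (1 + c) * ‖y‖ ≤ (1 / 2 - 1 / θ) * ‖y‖ ^ 2 := by
        rw [sq, ← mul_assoc]; gcongr
      nlinarith)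
  refine ⟨y, ?_, ?_, ?_⟩
  · rintro rfl; rw [hJ0] at hyJ; exact lt_irrefl _ hyJ
  · exact sub_eq_zero.1 hy0
  · have := hAR' y
    rw [hy0] at this; simp at this; simpa using this.trans hyc

lemma gram {ι : Type} (H : ι → ℝ) (hH : ∀ i, 0 ≤ H i) :
    ∃ a : ι → Lp ℝ 2 (volume : Measure ℝ), ∀ i j, inner ℝ (a i) (a j) = min (H i) (H j) := by
  refine ⟨fun i => indicatorConstLp 2 (s := Ioc 0 (H i)) measurableSet_Ioc (by simp) (1:ℝ), ?_⟩
  intro i j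
  rw [L2.inner_indicatorConstLp_eq_inner_setIntegral]
  rw [integral_congr_ae (ae_restrict_of_ae indicatorConstLp_coeFn)]
  rw [setIntegral_indicator measurableSet_Ioc, Ioc_inter_Ioc]
  simp [hH]

lemma disc_sol_aux {E : Type*} [NormedAddCommGroup E] [InnerProductSpace ℝ E]
    [FiniteDimensional ℝ E] {ι : Type} [Fintype ι] (H : ι → ℝ) (a : ι → E)
    (ha : ∀ i j, inner ℝ (a i) (a j) = min (H i) (H j)) (hH : ∀ i, 0 ≤ H i) (φ : ι → ℝ → ℝ)
    (hc : ∀ i, Continuous (φ i)) (h0 : ∀ i, ∀ t ≤ 0, φ i t = 0) (hnn : ∀ i t, 0 ≤ φ i t)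
    (ho : ∀ i, ∀ ε > 0, ∀ᶠ t in nhds (0:ℝ), φ i t ≤ ε * |t|)
    (θ : ℝ) (hθ : 2 < θ) (hAR : ∀ i, ∀ t, 0 ≤ t → θ * (∫ s in (0:ℝ)..t, φ i s) ≤ t * φ i t)
    (c : ℝ) (b : ι) (hb : 0 < H b) (t : ℝ) (ht : 0 < t) (hec : t ^ 2 / (2 * H b) ≤ c)
    (he : t ^ 2 / (2 * H b) ≤ ∑ i, ∫ s in (0:ℝ)..(t / H b * min (H i) (H b)), φ i s) :
    ∃ x : ι → ℝ, (∃ k, x k ≠ 0) ∧ (∀ k, x k = ∑ i, φ i (x i) * min (H k) (H i)) ∧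
      ∀ k, (1 / 2 - 1 / θ) * x k ^ 2 ≤ c * H k := by
  have hna : ∀ i, ‖a i‖ ^ 2 = H i := fun i => by
    rw [← real_inner_self_eq_norm_sq, ha, min_self]
  have hne : ‖(t / H b) • a b‖ ^ 2 / 2 = t ^ 2 / (2 * H b) := by
    rw [norm_smul, mul_pow, hna, Real.norm_eq_abs, sq_abs]
    field_simp
  obtain ⟨y, hy0, hy, hyc⟩ := disc_abs a φ hc h0 hnn ho θ hθ hAR c ((t / H b) • a b)
    (by
      intro h
      rw [h] at hne
      have : 0 < t ^ 2 / (2 * H b) := by positivity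
      rw [← hne] at this; simp at this)
    (hne.trans_le hec) (by
      rw [hne]
      have hin : ∀ i, inner ℝ (a i) ((t / H b) • a b) = t / H b * min (H i) (H b) := fun i => by
        rw [real_inner_smul_right, ha]
      simp only [hin]
      exact he)
  refine ⟨fun k => inner ℝ (a k) y, ?_, ?_, ?_⟩
  · by_contra hcon
    push Not at hcon
    apply hy0
    rw [hy]
    refine Finset.sum_eq_zero fun i _ => ?_
    rw [hcon i, h0 i 0 le_rfl, zero_smul]
  · intro k
    show inner ℝ (a k) y = _
    conv_lhs => rw [hy]
    rw [inner_sum]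
    refine Finset.sum_congr rfl fun i _ => ?_
    rw [real_inner_smul_right, ha]
  · intro k
    have h1 : (inner ℝ (a k) y : ℝ) ^ 2 ≤ H k * ‖y‖ ^ 2 := by
      rw [← hna, ← mul_pow, ← sq_abs]
      gcongr
      exact abs_real_inner_le_norm _ _
    have hκ : 0 < 1 / 2 - 1 / θ := by
      have : 1 / θ < 1 / 2 := one_div_lt_one_div_of_lt (by norm_num) hθ
      linarith
    nlinarith [hH k]

lemma disc_sol {ι : Type} [Fintype ι] (H : ι → ℝ) (hH : ∀ i, 0 ≤ H i) (φ : ι → ℝ → ℝ)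
    (hc : ∀ i, Continuous (φ i)) (h0 : ∀ i, ∀ t ≤ 0, φ i t = 0) (hnn : ∀ i t, 0 ≤ φ i t)
    (ho : ∀ i, ∀ ε > 0, ∀ᶠ t in nhds (0:ℝ), φ i t ≤ ε * |t|)
    (θ : ℝ) (hθ : 2 < θ) (hAR : ∀ i, ∀ t, 0 ≤ t → θ * (∫ s in (0:ℝ)..t, φ i s) ≤ t * φ i t)
    (c : ℝ) (b : ι) (hb : 0 < H b) (t : ℝ) (ht : 0 < t) (hec : t ^ 2 / (2 * H b) ≤ c)
    (he : t ^ 2 / (2 * H b) ≤ ∑ i, ∫ s in (0:ℝ)..(t / H b * min (H i) (H b)), φ i s) :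
    ∃ x : ι → ℝ, (∃ k, x k ≠ 0) ∧ (∀ k, x k = ∑ i, φ i (x i) * min (H k) (H i)) ∧
      ∀ k, (1 / 2 - 1 / θ) * x k ^ 2 ≤ c * H k := by
  obtain ⟨a', ha'⟩ := gram H hH
  set E := Submodule.span ℝ (range a') with hE
  have : FiniteDimensional ℝ E := FiniteDimensional.span_of_finite ℝ (finite_range a')
  set a : ι → E := fun i => ⟨a' i, Submodule.subset_span (mem_range_self i)⟩ with hadef
  have ha : ∀ i j, inner ℝ (a i) (a j) = min (H i) (H j) := ha'
  exact disc_sol_aux H a ha hH φ hc h0 hnn ho θ hθ hAR c b hb t ht hec he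

noncomputable def hh (m : ℕ) (r : ℝ) : ℝ := ((r ^ m)⁻¹ - 1) / m

lemma hh_anti {m : ℕ} {r s : ℝ} (hr : 0 < r) (hrs : r ≤ s) : hh m s ≤ hh m r := by
  unfold hh
  gcongr

lemma hh_one (m : ℕ) : hh m 1 = 0 := by simp [hh]

lemma hh_nonneg {m : ℕ} {r : ℝ} (hr : 0 < r) (hr1 : r ≤ 1) : 0 ≤ hh m r := by
  rw [← hh_one m]; exact hh_anti hr hr1

lemma hh_pos {m : ℕ} (hm : 1 ≤ m) {r : ℝ} (hr : 0 < r) (hr1 : r < 1) : 0 < hh m r := by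
  unfold hh
  have : 1 < (r ^ m)⁻¹ := (one_lt_inv₀ (by positivity)).2 (pow_lt_one₀ hr.le hr1 (by omega))
  have : (0:ℝ) < m := by exact_mod_cast hm
  apply div_pos <;> linarith

lemma hh_le {m : ℕ} (hm : 1 ≤ m) {r : ℝ} (hr : 0 < r) : hh m r ≤ (r ^ m)⁻¹ := by
  unfold hh
  have h1 : (1:ℝ) ≤ m := by exact_mod_cast hm
  have : 0 < (r ^ m)⁻¹ := by positivity
  rw [div_le_iff₀ (by linarith)]
  nlinarith

lemma hh_hasDerivAt {m : ℕ} (hm : 1 ≤ m) {r : ℝ} (hr : 0 < r) :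
    HasDerivAt (hh m) (-(r ^ (m + 1))⁻¹) r := by
  have h1 : (m:ℝ) ≠ 0 := by positivity
  have := (((hasDerivAt_pow m r).inv (by positivity)).sub_const 1).div_const (m:ℝ)
  refine HasDerivAt.congr_deriv this ?_
  obtain ⟨j, rfl⟩ : ∃ j, m = j + 1 := ⟨m - 1, by omega⟩
  rw [Nat.add_sub_cancel]
  field_simp
  ring

lemma hh_continuousAt {m : ℕ} (hm : 1 ≤ m) {r : ℝ} (hr : 0 < r) : ContinuousAt (hh m) r :=
  (hh_hasDerivAt hm hr).continuousAt

lemma hh_lip {m : ℕ} (hm : 1 ≤ m) {s a b : ℝ} (hs : 0 < s) (ha : s ≤ a) (hb : s ≤ b) :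
    |hh m a - hh m b| ≤ (s ^ (m + 1))⁻¹ * |a - b| := by
  have := (convex_Ici s).norm_image_sub_le_of_norm_hasDerivWithin_le (f := hh m)
    (f' := fun r => -(r ^ (m + 1))⁻¹) (C := (s ^ (m + 1))⁻¹) (x := b) (y := a)
    (fun x hx => (hh_hasDerivAt hm (hs.trans_le hx)).hasDerivWithinAt)
    (fun x hx => by
      have hx' : s ≤ x := hx
      have : 0 < x := hs.trans_le hx
      rw [norm_neg, Real.norm_of_nonneg (by positivity)]
      gcongr) hb ha
  simpa [Real.norm_eq_abs] using this

lemma hh_max {m : ℕ} {r s : ℝ} (hr : 0 < r) (hs : 0 < s) :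
    hh m (max r s) = min (hh m r) (hh m s) := by
  rcases le_total r s with h | h
  · rw [max_eq_right h, min_eq_right (hh_anti hr h)]
  · rw [max_eq_left h, min_eq_left (hh_anti hs h)]

noncomputable def sg (n : ℕ) (s : ℝ) : ℝ := (⌈(n:ℝ) * s⌉₊ : ℝ) / n

lemma sg_cell {n : ℕ} (hn : 1 ≤ n) (i : ℕ) {s : ℝ} (hs : s ∈ Ioc ((i:ℝ) / n) (((i+1 : ℕ):ℝ) / n)) :
    sg n s = ((i:ℝ) + 1) / n := by
  have hn' : (0:ℝ) < n := by exact_mod_cast hn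
  have h1 := (div_lt_iff₀ hn').1 hs.1
  have h2 := (le_div_iff₀ hn').1 hs.2
  have : ⌈(n:ℝ) * s⌉₊ = i + 1 := by
    rw [Nat.ceil_eq_iff (by omega)]
    constructor
    · simp only [Nat.add_sub_cancel]; linarith
    · linarith
  unfold sg
  rw [this]; push_cast; rfl

lemma sg_ge {n : ℕ} (hn : 1 ≤ n) (s : ℝ) : s ≤ sg n s := by
  have hn' : (0:ℝ) < n := by exact_mod_cast hn
  unfold sg
  rw [le_div_iff₀ hn', mul_comm]
  exact Nat.le_ceil _

lemma sg_le_one {n : ℕ} (hn : 1 ≤ n) {s : ℝ} (hs : s ≤ 1) : sg n s ≤ 1 := by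
  have hn' : (0:ℝ) < n := by exact_mod_cast hn
  unfold sg
  rw [div_le_one hn']
  have : ⌈(n:ℝ) * s⌉₊ ≤ n := by rw [Nat.ceil_le]; nlinarith
  exact_mod_cast this

lemma sg_lt {n : ℕ} (hn : 1 ≤ n) {s : ℝ} (hs : 0 ≤ s) : sg n s < s + 1 / n := by
  have hn' : (0:ℝ) < n := by exact_mod_cast hn
  unfold sg
  rw [div_lt_iff₀ hn', add_mul, one_div, inv_mul_cancel₀ hn'.ne', mul_comm s]
  exact Nat.ceil_lt_add_one (by positivity)

lemma sg_tendsto {s : ℝ} (hs : 0 ≤ s) : Tendsto (fun n => sg n s) atTop (nhds s) := by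
  have h2 : Tendsto (fun n : ℕ => s + 1 / (n:ℝ)) atTop (nhds s) := by
    simpa using tendsto_const_nhds.add (tendsto_one_div_atTop_nhds_zero_nat (𝕜 := ℝ))
  refine tendsto_of_tendsto_of_tendsto_of_le_of_le' tendsto_const_nhds h2 ?_ ?_
  · filter_upwards [eventually_ge_atTop 1] with n hn using sg_ge hn s
  · filter_upwards [eventually_ge_atTop 1] with n hn using (sg_lt hn hs).le

lemma riemann_cell {n : ℕ} (hn : 1 ≤ n) (H : ℝ → ℝ) (i : ℕ) :
    IntervalIntegrable (fun s => H (sg n s)) volume ((i:ℝ) / n) (((i+1 : ℕ):ℝ) / n) ∧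
    ∫ s in ((i:ℝ) / n)..(((i+1 : ℕ):ℝ) / n), H (sg n s) = H (((i:ℝ) + 1) / n) / n := by
  have hn' : (0:ℝ) < n := by exact_mod_cast hn
  have hle : (i:ℝ) / n ≤ ((i+1 : ℕ):ℝ) / n := by push_cast; gcongr; linarith
  have hEq : EqOn (fun _ => H (((i:ℝ) + 1) / n)) (fun s => H (sg n s))
      (Ioc ((i:ℝ) / n) (((i+1 : ℕ):ℝ) / n)) := fun s hs => by
    simp only [sg_cell hn i hs]
  constructor
  · rw [intervalIntegrable_iff_integrableOn_Ioc_of_le hle]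
    exact (integrableOn_const (by simp)).congr_fun hEq measurableSet_Ioc
  · rw [intervalIntegral.integral_of_le hle, ← setIntegral_congr_fun measurableSet_Ioc hEq,
      ← intervalIntegral.integral_of_le hle, intervalIntegral.integral_const, smul_eq_mul]
    push_cast
    field_simp
    ring

lemma riemann {n : ℕ} (hn : 1 ≤ n) (H : ℝ → ℝ) :
    IntervalIntegrable (fun s => H (sg n s)) volume 0 1 ∧
    ∫ s in (0:ℝ)..1, H (sg n s) = ∑ i : Fin n, H (((i:ℕ):ℝ) / n + 1 / n) / n := by
  have hn' : (0:ℝ) < n := by exact_mod_cast hn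
  have h0 : ((0:ℕ):ℝ) / n = 0 := by simp
  have h1 : ((n:ℕ):ℝ) / n = 1 := by field_simp
  constructor
  · have := IntervalIntegrable.trans_iterate (a := fun k : ℕ => (k:ℝ) / n) (n := n)
      (fun k _ => (riemann_cell hn H k).1)
    simpa [h1] using this
  · have := intervalIntegral.sum_integral_adjacent_intervals (a := fun k : ℕ => (k:ℝ) / n) (n := n)
      (fun k _ => (riemann_cell hn H k).1)
    simp only [h0, h1] at this
    rw [← this, Finset.sum_range]
    refine Finset.sum_congr rfl fun i _ => ?_
    rw [(riemann_cell hn H i).2, add_div]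

lemma riemann_le {n : ℕ} (hn : 1 ≤ n) (H : ℝ → ℝ) (hH : AntitoneOn H (Ioc 0 1))
    (hi : IntervalIntegrable H volume 0 1) :
    ∑ i : Fin n, H (((i:ℕ):ℝ) / n + 1 / n) / n ≤ ∫ s in (0:ℝ)..1, H s := by
  rw [← (riemann hn H).2]
  refine intervalIntegral.integral_mono_on_of_le_Ioo zero_le_one (riemann hn H).1 hi ?_
  intro s hs
  have h1 := sg_ge hn s
  exact hH ⟨hs.1, hs.2.le⟩ ⟨hs.1.trans_le h1, sg_le_one hn hs.2.le⟩ h1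

lemma S1_int (γ : ℝ) (hγ0 : 0 < γ) (hγ1 : γ < 1) (r : ℝ) (hr : 0 < r) (hr1 : r ≤ 1) :
    IntervalIntegrable (fun s => (max r s)⁻¹ * s ^ (-γ)) volume 0 1 ∧
    ∫ s in (0:ℝ)..1, (max r s)⁻¹ * s ^ (-γ) ≤ (1 / (1 - γ) + 1 / γ) * r ^ (-γ) := by
  have hA : EqOn (fun s => r⁻¹ * s ^ (-γ)) (fun s => (max r s)⁻¹ * s ^ (-γ)) (uIcc 0 r) := by
    intro s hs
    rw [uIcc_of_le hr.le] at hs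
    simp only [max_eq_left hs.2]
  have hB : EqOn (fun s : ℝ => s ^ (-1 - γ)) (fun s => (max r s)⁻¹ * s ^ (-γ)) (uIcc r 1) := by
    intro s hs
    rw [uIcc_of_le hr1] at hs
    have : 0 < s := hr.trans_le hs.1
    simp only [max_eq_right hs.1]
    rw [sub_eq_add_neg, Real.rpow_add this, Real.rpow_neg_one]
  have iA : IntervalIntegrable (fun s : ℝ => r⁻¹ * s ^ (-γ)) volume 0 r :=
    (intervalIntegral.intervalIntegrable_rpow' (by linarith)).const_mul _
  have hni : (0:ℝ) ∉ uIcc r 1 := by rw [uIcc_of_le hr1]; simp [hr]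
  have iB : IntervalIntegrable (fun s : ℝ => s ^ (-1 - γ)) volume r 1 :=
    intervalIntegral.intervalIntegrable_rpow (Or.inr hni)
  have iA' := iA.congr (hA.mono uIoc_subset_uIcc)
  have iB' := iB.congr (hB.mono uIoc_subset_uIcc)
  refine ⟨iA'.trans iB', ?_⟩
  rw [← intervalIntegral.integral_add_adjacent_intervals iA' iB',
    ← intervalIntegral.integral_congr hA, ← intervalIntegral.integral_congr hB,
    intervalIntegral.integral_const_mul, integral_rpow (Or.inl (by linarith)),
    integral_rpow (Or.inr ⟨by linarith, hni⟩)]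
  have e1 : (-1 - γ + 1) = -γ := by ring
  have e2 : r ^ (-γ + 1) = r ^ (-γ) * r := by rw [Real.rpow_add_one hr.ne']
  rw [e1, e2, Real.one_rpow, Real.zero_rpow (by linarith)]
  have hp : 0 < r ^ (-γ) := Real.rpow_pos_of_pos hr _
  have e3 : r⁻¹ * ((r ^ (-γ) * r - 0) / (-γ + 1)) = 1 / (1 - γ) * r ^ (-γ) := by
    have : (1:ℝ) - γ ≠ 0 := by linarith
    rw [show -γ + 1 = 1 - γ by ring]
    field_simp
    ring
  have e4 : (1 - r ^ (-γ)) / -γ = 1 / γ * r ^ (-γ) - 1 / γ := by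
    field_simp; ring
  rw [e3, e4]
  have : 0 < 1 / γ := by positivity
  linarith

/-- the key sum estimate -/
lemma S1 {m n : ℕ} (hm : 1 ≤ m) (hn : 1 ≤ n) (γ : ℝ) (hγ0 : 0 < γ) (hγ1 : γ < 1)
    (r : ℝ) (hr : 0 < r) (hr1 : r ≤ 1) :
    ∑ i : Fin n, (fun s : ℝ => hh m (max r s) * s ^ (m + 1) * (s ^ (-2 - γ))) (((i:ℕ):ℝ) / n + 1 / n) / n
      ≤ (1 / (1 - γ) + 1 / γ) * r ^ (-γ) := by
  have hn' : (0:ℝ) < n := by exact_mod_cast hn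
  obtain ⟨h1, h2⟩ := S1_int γ hγ0 hγ1 r hr hr1
  refine le_trans ?_ ((riemann_le hn (fun s => (max r s)⁻¹ * s ^ (-γ)) ?_ h1).trans h2)
  · refine Finset.sum_le_sum fun i _ => ?_
    have hs : 0 < ((i:ℕ):ℝ) / n + 1 / n := by positivity
    generalize ((i:ℕ):ℝ) / n + 1 / n = s at hs
    gcongr
    show hh m (max r s) * s ^ (m + 1) * (s ^ (-2 - γ)) ≤ (max r s)⁻¹ * s ^ (-γ)
    have hM : 0 < max r s := lt_max_of_lt_left hr
    have e1 : s ^ (-2 - γ) = (s ^ 2)⁻¹ * s ^ (-γ) := by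
      rw [sub_eq_add_neg, Real.rpow_add hs, Real.rpow_neg hs.le]; norm_num
    rw [e1, ← mul_assoc]
    gcongr
    obtain ⟨j, rfl⟩ : ∃ j, m = j + 1 := ⟨m - 1, by omega⟩
    calc hh (j+1) (max r s) * s ^ (j + 1 + 1) * (s ^ 2)⁻¹ = hh (j+1) (max r s) * s ^ j := by
          field_simp
          ring
      _ ≤ ((max r s) ^ (j+1))⁻¹ * (max r s) ^ j := by
          gcongr
          · exact hh_le (by omega) hM
          · exact le_max_right _ _
      _ = (max r s)⁻¹ := by field_simp; ring
  · intro a ha b hb hab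
    have : 0 < max r a := lt_max_of_lt_left hr
    have h0 : 0 < a := ha.1
    have h4 : b ^ (-γ) ≤ a ^ (-γ) := Real.rpow_le_rpow_of_nonpos h0 hab (by linarith)
    have h5 : 0 ≤ b ^ (-γ) := Real.rpow_nonneg hb.1.le _
    show (max r b)⁻¹ * b ^ (-γ) ≤ (max r a)⁻¹ * a ^ (-γ)
    gcongr

noncomputable def pt (n : ℕ) (i : Fin n) : ℝ := ((i:ℕ):ℝ) / n + 1 / n

lemma pt_pos {n : ℕ} (i : Fin n) : 0 < pt n i := by
  have : (0:ℝ) < n := by exact_mod_cast (Nat.zero_lt_of_lt i.2)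
  unfold pt; positivity

lemma pt_le {n : ℕ} (i : Fin n) : pt n i ≤ 1 := by
  have h : (0:ℝ) < n := by exact_mod_cast (Nat.zero_lt_of_lt i.2)
  unfold pt; rw [← add_div, div_le_one h]; exact_mod_cast i.2

lemma ker_nonneg {m : ℕ} {r s : ℝ} (hr1 : r ≤ 1) (hs : 0 < s) (hs1 : s ≤ 1) :
    0 ≤ hh m (max r s) * s ^ (m + 1) :=
  mul_nonneg (hh_nonneg (lt_max_of_lt_right hs) (max_le hr1 hs1)) (by positivity)

lemma ker_le {m : ℕ} (hm : 1 ≤ m) {r s : ℝ} (hs : 0 < s) :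
    hh m (max r s) * s ^ (m + 1) ≤ s := by
  calc hh m (max r s) * s ^ (m + 1) ≤ (s ^ m)⁻¹ * s ^ (m + 1) := by
        gcongr
        exact (hh_anti hs (le_max_right _ _)).trans (hh_le hm hs)
    _ = s := by field_simp; ring

lemma sum_ker_le {m n : ℕ} (hm : 1 ≤ m) (hn : 1 ≤ n) (G : Fin n → ℝ) (C r : ℝ) (hr1 : r ≤ 1)
    (hG : ∀ i, G i ≤ C / pt n i) (hC : 0 ≤ C) :
    ∑ i, hh m (max r (pt n i)) * pt n i ^ (m + 1) * G i / n ≤ C := by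
  have hn' : (0:ℝ) < n := by exact_mod_cast hn
  have : ∑ i : Fin n, hh m (max r (pt n i)) * pt n i ^ (m + 1) * G i / n ≤ ∑ i : Fin n, C / n := by
    refine Finset.sum_le_sum fun i _ => ?_
    have h0 := pt_pos i
    gcongr
    calc _ ≤ hh m (max r (pt n i)) * pt n i ^ (m + 1) * (C / pt n i) := by
          gcongr
          · exact ker_nonneg hr1 h0 (pt_le i)
          · exact hG i
      _ ≤ pt n i * (C / pt n i) := by
          gcongr
          exact ker_le hm h0
      _ = C := by field_simp
  refine this.trans ?_
  rw [Finset.sum_const, Finset.card_univ, Fintype.card_fin, nsmul_eq_mul]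
  field_simp
  exact le_rfl

lemma apriori {m n : ℕ} (hm : 1 ≤ m) (hn : 1 ≤ n) (γ : ℝ) (hγ0 : 0 < γ) (hγ1 : γ < 1)
    (ε C : ℝ) (hε : 0 ≤ ε) (hεγ : ε * (1 / (1 - γ) + 1 / γ) ≤ 1 / 2) (hC : 0 ≤ C)
    (x G : Fin n → ℝ)
    (hx : ∀ k, x k = ∑ i, hh m (max (pt n k) (pt n i)) * pt n i ^ (m + 1) * G i / n)
    (hx0 : ∀ k, 0 ≤ x k)
    (hG : ∀ i, G i ≤ ε * (pt n i ^ 2)⁻¹ * x i + C) :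
    ∀ k, x k ≤ 2 * C * (pt n k) ^ (-γ) := by
  have hn' : (0:ℝ) < n := by exact_mod_cast hn
  have : Nonempty (Fin n) := ⟨⟨0, hn⟩⟩
  obtain ⟨k0, hk0⟩ := Finite.exists_max fun k => x k * (pt n k) ^ γ
  set A := x k0 * (pt n k0) ^ γ with hA
  have hA0 : 0 ≤ A := mul_nonneg (hx0 _) (Real.rpow_nonneg (pt_pos _).le _)
  have hxA : ∀ k, x k ≤ A * (pt n k) ^ (-γ) := by
    intro k
    rw [Real.rpow_neg (pt_pos k).le, ← div_eq_mul_inv,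
      le_div_iff₀ (Real.rpow_pos_of_pos (pt_pos k) _)]
    exact hk0 k
  have key : ∀ k, x k ≤ (A / 2 + C) * (pt n k) ^ (-γ) := by
    intro k
    rw [hx k]
    have h1 : ∀ i, hh m (max (pt n k) (pt n i)) * pt n i ^ (m + 1) * G i / n ≤
        (ε * A) * (hh m (max (pt n k) (pt n i)) * pt n i ^ (m + 1) * pt n i ^ (-2 - γ) / n)
          + hh m (max (pt n k) (pt n i)) * pt n i ^ (m + 1) * C / n := by
      intro i
      have h0 := pt_pos i
      have hG' : G i ≤ ε * A * pt n i ^ (-2 - γ) + C := by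
        refine (hG i).trans ?_
        have e1 : pt n i ^ (-2 - γ) = (pt n i ^ 2)⁻¹ * pt n i ^ (-γ) := by
          rw [sub_eq_add_neg, Real.rpow_add h0, Real.rpow_neg h0.le]; norm_num
        rw [e1]
        have := mul_le_mul_of_nonneg_left (hxA i) (a := ε * (pt n i ^ 2)⁻¹) (by positivity)
        linarith
      have := mul_le_mul_of_nonneg_left hG' (ker_nonneg (m := m) (pt_le k) h0 (pt_le i))
      have := div_le_div_of_nonneg_right this hn'.le
      refine this.trans (le_of_eq ?_)
      ring
    refine (Finset.sum_le_sum fun i _ => h1 i).trans ?_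
    rw [Finset.sum_add_distrib, ← Finset.mul_sum]
    have h2 := S1 hm hn γ hγ0 hγ1 (pt n k) (pt_pos k) (pt_le k)
    have h3 := sum_ker_le hm hn (fun _ => C) C (pt n k) (pt_le k)
      (fun i => by rw [le_div_iff₀ (pt_pos i)]; nlinarith [pt_le i, pt_pos i]) hC
    have h4 : 1 ≤ (pt n k) ^ (-γ) :=
      Real.one_le_rpow_of_pos_of_le_one_of_nonpos (pt_pos k) (pt_le k) (by linarith)
    have h5 := mul_le_mul_of_nonneg_left h2 (mul_nonneg hε hA0)
    have h6 : ε * A * ((1 / (1 - γ) + 1 / γ) * pt n k ^ (-γ)) ≤ A / 2 * pt n k ^ (-γ) := by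
      have : 0 ≤ A * pt n k ^ (-γ) := by positivity
      nlinarith
    have h7 : C ≤ C * pt n k ^ (-γ) := by nlinarith
    have h8 := h5.trans h6
    rw [add_mul]
    exact add_le_add h8 (h3.trans h7)
  have hAle : A ≤ A / 2 + C := by
    have := key k0
    rw [Real.rpow_neg (pt_pos k0).le, ← div_eq_mul_inv,
      le_div_iff₀ (Real.rpow_pos_of_pos (pt_pos k0) _)] at this
    exact this
  intro k
  refine (hxA k).trans ?_
  have := Real.rpow_nonneg (pt_pos k).le (-γ)
  gcongr
  linarith

noncomputable def ud (m n : ℕ) (G : Fin n → ℝ) (r : ℝ) : ℝ :=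
  ∑ i, hh m (max r (pt n i)) * pt n i ^ (m + 1) * G i / n

lemma ud_nonneg {m n : ℕ} (G : Fin n → ℝ) (hG : ∀ i, 0 ≤ G i) {r : ℝ} (hr : r ≤ 1) :
    0 ≤ ud m n G r := by
  refine Finset.sum_nonneg fun i _ => ?_
  have := ker_nonneg (m := m) hr (pt_pos i) (pt_le i)
  have := hG i
  positivity

lemma ud_le {m n : ℕ} (hm : 1 ≤ m) (hn : 1 ≤ n) (G : Fin n → ℝ) {M : ℝ} (hM : 0 ≤ M)
    (hG : ∀ i, G i ≤ M) {r : ℝ} (hr : r ≤ 1) : ud m n G r ≤ M := by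
  refine sum_ker_le hm hn G M r hr (fun i => (hG i).trans ?_) hM
  rw [le_div_iff₀ (pt_pos i)]
  nlinarith [pt_le i, pt_pos i]

lemma ud_lip {m n : ℕ} (hm : 1 ≤ m) (hn : 1 ≤ n) (G : Fin n → ℝ) {M : ℝ} (hM : 0 ≤ M)
    (hG0 : ∀ i, 0 ≤ G i) (hG : ∀ i, G i ≤ M) (a b : ℝ) :
    |ud m n G a - ud m n G b| ≤ M * |a - b| := by
  have hn' : (0:ℝ) < n := by exact_mod_cast hn
  unfold ud
  rw [← Finset.sum_sub_distrib]
  refine (Finset.abs_sum_le_sum_abs _ _).trans ?_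
  calc _ ≤ ∑ i : Fin n, M * |a - b| / n := by
        refine Finset.sum_le_sum fun i _ => ?_
        have h0 := pt_pos i
        have h1 := hh_lip (m := m) hm h0 (le_max_right a (pt n i)) (le_max_right b (pt n i))
        have h2 : |max a (pt n i) - max b (pt n i)| ≤ |a - b| := abs_max_sub_max_le_abs _ _ _
        rw [show hh m (max a (pt n i)) * pt n i ^ (m + 1) * G i / n -
          hh m (max b (pt n i)) * pt n i ^ (m + 1) * G i / n =
          (hh m (max a (pt n i)) - hh m (max b (pt n i))) * (pt n i ^ (m + 1) * G i / n) by ring,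
          abs_mul, abs_of_nonneg (a := pt n i ^ (m + 1) * G i / n)
            (by have := hG0 i; positivity)]
        calc _ ≤ ((pt n i ^ (m+1))⁻¹ * |a - b|) * (pt n i ^ (m + 1) * M / n) := by
              have := hG0 i
              have := hG i
              have := h1.trans (mul_le_mul_of_nonneg_left h2 (by positivity))
              gcongr
          _ = _ := by field_simp
    _ = M * |a - b| := by
        rw [Finset.sum_const, Finset.card_univ, Fintype.card_fin, nsmul_eq_mul]
        field_simp

lemma limit_lemma {m : ℕ} (hm : 1 ≤ m) (g : ℝ → ℝ → ℝ) (hg : Continuous (Function.uncurry g))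
    (hg0 : ∀ s ∈ Icc (0:ℝ) 1, ∀ t, 0 ≤ g s t) (M m0 : ℝ) (hM : 0 ≤ M) (n0 : ℕ)
    (hx : ∀ n, n0 ≤ n → ∃ x : Fin n → ℝ,
      (∀ k, x k = ∑ i, hh m (max (pt n k) (pt n i)) * pt n i ^ (m + 1) * g (pt n i) (x i) / n) ∧
      (∀ i, g (pt n i) (x i) ≤ M) ∧ ∃ k, m0 ≤ x k) :
    ∃ u : ℝ → ℝ, Continuous u ∧ (∀ r ∈ Icc (0:ℝ) 1, 0 ≤ u r) ∧ (∃ r ∈ Icc (0:ℝ) 1, m0 ≤ u r) ∧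
      ∀ r ∈ Icc (0:ℝ) 1, u r = ∫ s in (0:ℝ)..1, hh m (max r s) * s ^ (m + 1) * g s (u s) := by
  choose! x hx1 hx2 hx3 using hx
  set N : ℕ → ℕ := fun j => n0 + 1 + j with hN
  have hNn : ∀ j, n0 ≤ N j := fun j => by simp only [hN]; omega
  have hN1 : ∀ j, 1 ≤ N j := fun j => by simp only [hN]; omega
  set G : ∀ j, Fin (N j) → ℝ := fun j i => g (pt (N j) i) (x (N j) i) with hGdef
  have hG0 : ∀ j i, 0 ≤ G j i := fun j i => hg0 _ ⟨(pt_pos i).le, pt_le i⟩ _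
  have hGM : ∀ j i, G j i ≤ M := fun j i => hx2 _ (hNn j) i
  set U : ℕ → ℝ → ℝ := fun j => ud m (N j) (G j) with hU
  have hUpt : ∀ j i, U j (pt (N j) i) = x (N j) i := fun j i => (hx1 (N j) (hNn j) i).symm
  have hUlip : ∀ j a b, |U j a - U j b| ≤ M * |a - b| := fun j a b =>
    ud_lip hm (hN1 j) _ hM (hG0 j) (hGM j) a b
  have hUc : ∀ j, LipschitzWith ⟨M, hM⟩ (U j) := fun j =>
    LipschitzWith.of_dist_le_mul fun a b => by
      rw [Real.dist_eq, Real.dist_eq]; exact hUlip j a b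
  let v : ℕ → BoundedContinuousFunction (Icc (0:ℝ) 1) ℝ := fun j =>
    BoundedContinuousFunction.mkOfCompact ⟨fun r => U j r, (hUc j).continuous.comp continuous_subtype_val⟩
  let A : Set (BoundedContinuousFunction (Icc (0:ℝ) 1) ℝ) :=
    {w | (∀ r, w r ∈ Icc (0:ℝ) M) ∧ LipschitzWith ⟨M, hM⟩ w}
  have hvA : ∀ j, v j ∈ A := fun j => by
    refine ⟨fun r => ⟨ud_nonneg _ (hG0 j) r.2.2, ud_le hm (hN1 j) _ hM (hGM j) r.2.2⟩, ?_⟩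
    refine LipschitzWith.of_dist_le_mul fun a b => ?_
    exact (hUc j).dist_le_mul a b
  have hAc : IsCompact (closure A) := by
    refine BoundedContinuousFunction.arzela_ascoli (Icc 0 M) isCompact_Icc A
      (fun w r hw => hw.1 r) ?_
    refine UniformEquicontinuous.equicontinuous ?_
    exact LipschitzWith.uniformEquicontinuous _ ⟨M, hM⟩ fun w => w.2.2
  obtain ⟨w, -, ψ, hψ, hlim⟩ := hAc.tendsto_subseq (fun j => subset_closure (hvA j))
  have hpt : ∀ r (hr : r ∈ Icc (0:ℝ) 1), Tendsto (fun j => U (ψ j) r) atTop (nhds (w ⟨r, hr⟩)) :=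
    fun r hr => by
      have := (BoundedContinuousFunction.tendsto_iff_tendstoUniformly.1 hlim).tendsto_at ⟨r, hr⟩
      exact this
  have hunif := Metric.tendstoUniformly_iff.1
    (BoundedContinuousFunction.tendsto_iff_tendstoUniformly.1 hlim)
  let u : ℝ → ℝ := fun r => w (projIcc 0 1 zero_le_one r)
  have huc : Continuous u := w.continuous.comp continuous_projIcc
  have hu : ∀ r (hr : r ∈ Icc (0:ℝ) 1), u r = w ⟨r, hr⟩ := fun r hr => by
    simp only [u, projIcc_of_mem zero_le_one hr]
  have hNlim : Tendsto (fun j => N (ψ j)) atTop atTop :=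
    (tendsto_atTop_mono (fun j => by simp only [hN]; omega : ∀ j, j ≤ N j) tendsto_id).comp
      hψ.tendsto_atTop
  refine ⟨u, huc, fun r hr => ?_, ?_, fun r hr => ?_⟩
  · rw [hu r hr]
    exact ge_of_tendsto' (hpt r hr) fun j => ud_nonneg _ (hG0 _) hr.2
  · -- lower bound
    obtain ⟨r, hr, hmax⟩ := isCompact_Icc.exists_isMaxOn (s := Icc (0:ℝ) 1) ⟨0, by simp⟩ huc.continuousOn
    refine ⟨r, hr, ?_⟩
    refine le_of_forall_pos_le_add fun ε hε => ?_
    obtain ⟨j, hj⟩ := (hunif ε hε).exists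
    obtain ⟨k, hk⟩ := hx3 (N (ψ j)) (hNn _)
    have hkm : pt (N (ψ j)) k ∈ Icc (0:ℝ) 1 := ⟨(pt_pos k).le, pt_le k⟩
    have h1 := hj ⟨_, hkm⟩
    have h2 : (v (ψ j)) ⟨_, hkm⟩ = x (N (ψ j)) k := hUpt _ k
    have h3 := hmax hkm
    simp only [mem_setOf_eq] at h3
    rw [hu _ hkm] at h3
    simp only [Function.comp] at h1
    rw [h2, Real.dist_eq] at h1
    have := (abs_lt.1 h1).1
    linarith
  · rw [hu r hr]
    refine tendsto_nhds_unique (hpt r hr) ?_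
    have hrep : ∀ j, U j r = ∫ s in (0:ℝ)..1, hh m (max r (sg (N j) s)) * (sg (N j) s) ^ (m+1)
        * g (sg (N j) s) (U j (sg (N j) s)) := fun j => by
      have := (riemann (hN1 j) (fun s => hh m (max r s) * s ^ (m+1) * g s (U j s))).2
      rw [this]
      simp only [hU, ud]
      refine Finset.sum_congr rfl fun i _ => ?_
      have := hUpt j i
      simp only [hU, ud] at this
      simp only [hGdef]
      simp only [hGdef, pt] at this ⊢
      rw [this]
    simp_rw [hrep]
    refine intervalIntegral.tendsto_integral_filter_of_dominated_convergence (fun _ => M) ?_ ?_ ?_ ?_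
    · refine Eventually.of_forall fun j => ?_
      have := (riemann (hN1 (ψ j)) (fun s => hh m (max r s) * s ^ (m+1) * g s (U (ψ j) s))).1
      exact this.aestronglyMeasurable_restrict_uIoc
    · refine Eventually.of_forall fun j => Eventually.of_forall fun s hs => ?_
      rw [uIoc_of_le zero_le_one] at hs
      have hs0 : 0 < sg (N (ψ j)) s := hs.1.trans_le (sg_ge (hN1 _) s)
      have hs1 := sg_le_one (hN1 (ψ j)) hs.2
      have hk0 := ker_nonneg (m := m) hr.2 hs0 hs1
      have hk1 := (ker_le (r := r) hm hs0).trans hs1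
      have hg1 := hg0 _ ⟨hs0.le, hs1⟩ (U (ψ j) (sg (N (ψ j)) s))
      rw [Real.norm_of_nonneg (mul_nonneg hk0 hg1)]
      have : g (sg (N (ψ j)) s) (U (ψ j) (sg (N (ψ j)) s)) ≤ M := by
        obtain ⟨i, hi⟩ : ∃ i, sg (N (ψ j)) s = pt (N (ψ j)) i := by
          have hn' : (0:ℝ) < (N (ψ j) : ℝ) := by exact_mod_cast hN1 (ψ j)
          have hc1 : 1 ≤ ⌈(N (ψ j) : ℝ) * s⌉₊ := Nat.one_le_iff_ne_zero.2 (by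
            have := Nat.ceil_pos.2 (mul_pos hn' hs.1); omega)
          have hc2 : ⌈(N (ψ j) : ℝ) * s⌉₊ ≤ N (ψ j) := by
            rw [Nat.ceil_le]; nlinarith [hs.2]
          refine ⟨⟨⌈(N (ψ j) : ℝ) * s⌉₊ - 1, by omega⟩, ?_⟩
          simp only [sg, pt, Nat.cast_sub hc1]
          push_cast; ring
        rw [hi, hUpt]
        exact hGM (ψ j) i
      nlinarith
    · exact intervalIntegrable_const
    · refine Eventually.of_forall fun s hs => ?_
      rw [uIoc_of_le zero_le_one] at hs
      have hsI : s ∈ Icc (0:ℝ) 1 := ⟨hs.1.le, hs.2⟩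
      have hsg : Tendsto (fun j => sg (N (ψ j)) s) atTop (nhds s) := (sg_tendsto hs.1.le).comp hNlim
      have hUs : Tendsto (fun j => U (ψ j) (sg (N (ψ j)) s)) atTop (nhds (u s)) := by
        have h1 : Tendsto (fun j => M * |sg (N (ψ j)) s - s|) atTop (nhds 0) := by
          have := ((hsg.sub_const s).abs).const_mul M
          simpa using this
        have h2 : Tendsto (fun j => U (ψ j) (sg (N (ψ j)) s) - U (ψ j) s) atTop (nhds 0) :=
          squeeze_zero_norm (fun j => hUlip _ _ _) h1
        have := h2.add (hpt s hsI)
        rw [hu s hsI]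
        simpa using this
      have hmx : Tendsto (fun j => hh m (max r (sg (N (ψ j)) s))) atTop (nhds (hh m (max r s))) := by
        refine (hh_continuousAt hm (lt_max_of_lt_right hs.1)).tendsto.comp ?_
        exact tendsto_const_nhds.max hsg
      refine (hmx.mul (hsg.pow _)).mul ?_
      have := (hg.tendsto (s, u s)).comp (hsg.prodMk_nhds hUs)
      exact this

noncomputable def gg (p lam : ℝ) (K f : ℝ → ℝ) (s t : ℝ) : ℝ := (max t 0) ^ p + lam * K s * f t

lemma f_small {f : ℝ → ℝ} (h0 : ∀ t ≤ 0, f t = 0)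
    (h2a : Tendsto (fun t => f t / t) (nhdsWithin 0 (Ioi 0)) (nhds 0)) {ε : ℝ} (hε : 0 < ε) :
    ∃ d > 0, ∀ t ≤ d, f t ≤ ε * |t| := by
  have h1 : ∀ᶠ t in nhdsWithin (0:ℝ) (Ioi 0), f t / t < ε := h2a.eventually_lt_const hε
  rw [eventually_nhdsWithin_iff, Metric.eventually_nhds_iff] at h1
  obtain ⟨d, hd, h1⟩ := h1
  refine ⟨d / 2, by positivity, fun t ht => ?_⟩
  rcases le_or_gt t 0 with h | h
  · rw [h0 t h]; positivity
  · have := h1 (y := t) (by rw [Real.dist_eq, sub_zero, abs_of_pos h]; linarith) h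
    rw [div_lt_iff₀ h] at this
    rw [abs_of_pos h]; exact this.le

lemma f_growth {f : ℝ → ℝ} (hc : Continuous f) (hnn : ∀ t, 0 ≤ f t) (h0 : ∀ t ≤ 0, f t = 0)
    (h2a : Tendsto (fun t => f t / t) (nhdsWithin 0 (Ioi 0)) (nhds 0)) {q : ℝ}
    (h2b : Tendsto (fun t => f t / t ^ q) atTop (nhds 0)) {ε : ℝ} (hε : 0 < ε) :
    ∃ C, 0 ≤ C ∧ ∀ t, 0 ≤ t → f t ≤ ε * t ^ q + C * t := by
  obtain ⟨d, hd, h1⟩ := f_small h0 h2a one_pos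
  have h2 : ∀ᶠ t in atTop, f t / t ^ q < ε := h2b.eventually_lt_const hε
  obtain ⟨R, hR⟩ := eventually_atTop.1 h2
  obtain ⟨M, hM⟩ := (isCompact_Icc (a := d) (b := R)).bddAbove_image hc.continuousOn
  refine ⟨1 + |M| / d, by positivity, fun t ht => ?_⟩
  have hq : 0 ≤ t ^ q := Real.rpow_nonneg ht q
  rcases le_or_gt t d with h | h
  · have := h1 t h
    rw [abs_of_nonneg ht] at this
    have : 0 ≤ |M| / d * t := by positivity
    nlinarith [mul_nonneg hε.le hq]
  · rcases le_or_gt R t with h' | h'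
    · have := hR t h'
      have htp : 0 < t ^ q := Real.rpow_pos_of_pos (hd.trans h) q
      rw [div_lt_iff₀ htp] at this
      have : 0 ≤ (1 + |M| / d) * t := by positivity
      linarith
    · have := hM (mem_image_of_mem f ⟨h.le, h'.le⟩)
      have h3 : |M| ≤ |M| / d * t := by
        rw [div_mul_eq_mul_div, le_div_iff₀ hd]
        nlinarith [abs_nonneg M]
      have := le_abs_self M
      nlinarith [mul_nonneg hε.le hq]

section
variable {m : ℕ} {β : ℝ} {K f : ℝ → ℝ} {C0 : ℝ}

lemma rpow_help (hm : 1 ≤ m) {r t η a : ℝ} (hr : 0 < r) (ht : 0 ≤ t) (hη : 0 ≤ η) (ha : 0 ≤ a)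
    (h : t ^ 2 ≤ η * (r ^ m)⁻¹) : t ^ (2 * a / m) ≤ η ^ (a / m) * r ^ (-a) := by
  have hm' : (0:ℝ) < m := by exact_mod_cast hm
  calc t ^ (2 * a / m) = (t ^ 2) ^ (a / m) := by
        rw [← Real.rpow_natCast t 2, ← Real.rpow_mul ht]; push_cast; ring_nf
    _ ≤ (η * (r ^ m)⁻¹) ^ (a / m) := Real.rpow_le_rpow (by positivity) h (by positivity)
    _ = η ^ (a / m) * r ^ (-a) := by
        rw [Real.mul_rpow hη (by positivity), Real.inv_rpow (by positivity), Real.rpow_neg hr.le,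
          ← Real.rpow_natCast r m, ← Real.rpow_mul hr.le]
        congr 3; field_simp

lemma rpow_split {t a : ℝ} (ht : 0 ≤ t) (ha : 0 ≤ a) : t ^ (1 + a) = t * t ^ a := by
  rw [Real.rpow_add' ht (by linarith), Real.rpow_one]

lemma g_est (hm : 1 ≤ m) (hβ : 0 < β) (hC0 : 0 < C0)
    (hK0 : ∀ r, 0 ≤ K r) (hK : ∀ r, 0 < r → r ≤ 1 → K r ≤ C0 * r ^ β)
    (hc : Continuous f) (hnn : ∀ t, 0 ≤ f t) (h0 : ∀ t ≤ 0, f t = 0)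
    (h2a : Tendsto (fun t => f t / t) (nhdsWithin 0 (Ioi 0)) (nhds 0))
    (h2b : Tendsto (fun t => f t / t ^ (1 + 2 * (2 + β) / m)) atTop (nhds 0))
    {lam : ℝ} (hlam : 0 < lam) {ε η : ℝ} (hε : 0 < ε) (hη : 0 < η) (hη1 : η ≤ 1)
    (hηε : η ^ (2 / (m:ℝ)) ≤ ε / 4) :
    ∃ C, 0 ≤ C ∧ ∀ r t, 0 < r → r ≤ 1 → 0 ≤ t → t ^ 2 ≤ η * (r ^ m)⁻¹ →
      gg (1 + 2 * 2 / m) lam K f r t ≤ ε * (r ^ 2)⁻¹ * t + C := by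
  have hm' : (0:ℝ) < m := by exact_mod_cast hm
  obtain ⟨Ce, hCe, hf⟩ := f_growth hc hnn h0 h2a h2b (ε := ε / (4 * lam * C0)) (by positivity)
  set B := lam * C0 * Ce + 1 with hB
  have hBp : 0 < B := by positivity
  set r0 := Real.sqrt (ε / (2 * B)) with hr0
  have hr0p : 0 < r0 := Real.sqrt_pos.2 (by positivity)
  have hr02 : r0 ^ 2 = ε / (2 * B) := Real.sq_sqrt (by positivity)
  refine ⟨B * (1 + (r0 ^ m)⁻¹), by positivity, fun r t hr hr1 ht h => ?_⟩
  have e1 : (max t 0) ^ (1 + 2 * 2 / (m:ℝ)) ≤ ε / 4 * (r ^ 2)⁻¹ * t := by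
    rw [max_eq_left ht, rpow_split ht (by positivity)]
    have := rpow_help hm (a := 2) hr ht hη.le (by norm_num) h
    have h2 : r ^ (-2:ℝ) = (r ^ 2)⁻¹ := by rw [Real.rpow_neg hr.le]; norm_cast
    rw [h2] at this
    calc _ ≤ t * (η ^ (2 / (m:ℝ)) * (r^2)⁻¹) := by gcongr
      _ ≤ t * (ε / 4 * (r^2)⁻¹) := by gcongr
      _ = _ := by ring
  have e2 : t ^ (1 + 2 * (2 + β) / m) ≤ t * r ^ (-(2 + β)) := by
    rw [rpow_split ht (by positivity)]
    have h3 := rpow_help hm (a := 2 + β) hr ht hη.le (by positivity) h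
    have h4 : η ^ ((2 + β) / m) ≤ 1 := Real.rpow_le_one hη.le hη1 (by positivity)
    have h5 : 0 ≤ r ^ (-(2 + β)) := Real.rpow_nonneg hr.le _
    gcongr
    nlinarith
  have hrb : r ^ β * r ^ (-(2+β)) = (r^2)⁻¹ := by
    rw [← Real.rpow_add hr, show β + -(2 + β) = -2 by ring, Real.rpow_neg hr.le]; norm_cast
  have hrb1 : r ^ β ≤ 1 := Real.rpow_le_one hr.le hr1 hβ.le
  have hrb0 : 0 ≤ r ^ β := Real.rpow_nonneg hr.le _
  have e3 : lam * K r * f t ≤ ε / 4 * (r ^ 2)⁻¹ * t + (B - 1) * t := by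
    calc lam * K r * f t ≤ lam * (C0 * r ^ β) * (ε / (4 * lam * C0) * (t * r ^ (-(2 + β))) + Ce * t) := by
          have := hK r hr hr1
          have := hnn t
          have h6 : f t ≤ ε / (4 * lam * C0) * (t * r ^ (-(2 + β))) + Ce * t := by
            refine (hf t ht).trans ?_
            gcongr
          gcongr
      _ = ε / 4 * (r ^ β * r ^ (-(2+β))) * t + (B - 1) * t * r ^ β := by
          rw [hB]; field_simp; ring
      _ ≤ _ := by
          rw [hrb]
          have : 0 ≤ (B - 1) * t := by rw [hB]; simp only [add_sub_cancel_right]; positivity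
          nlinarith
  have e4 : B * t ≤ ε / 2 * (r^2)⁻¹ * t + B * (1 + (r0 ^ m)⁻¹) := by
    rcases le_or_gt r r0 with h7 | h7
    · have : B ≤ ε / 2 * (r^2)⁻¹ := by
        rw [← div_eq_mul_inv, le_div_iff₀ (by positivity)]
        calc B * r ^ 2 ≤ B * r0 ^ 2 := by gcongr
          _ = ε / 2 := by rw [hr02]; field_simp
      have h8 : 0 ≤ B * (1 + (r0 ^ m)⁻¹) := by positivity
      nlinarith
    · have h9 : (r ^ m)⁻¹ ≤ (r0 ^ m)⁻¹ := by gcongr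
      have h10 : η * (r ^ m)⁻¹ ≤ (r ^ m)⁻¹ := by
        have : 0 ≤ (r ^ m)⁻¹ := by positivity
        nlinarith
      have h11 : t ≤ 1 + (r0 ^ m)⁻¹ := by nlinarith [sq_nonneg (t - 1/2)]
      have h12 : 0 ≤ ε / 2 * (r^2)⁻¹ * t := by positivity
      nlinarith
  unfold gg
  nlinarith

lemma g_est2 (hm : 1 ≤ m) (hβ : 0 < β) (hC0 : 0 < C0)
    (hK0 : ∀ r, 0 ≤ K r) (hK : ∀ r, 0 < r → r ≤ 1 → K r ≤ C0 * r ^ β)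
    (hc : Continuous f) (hnn : ∀ t, 0 ≤ f t) (h0 : ∀ t ≤ 0, f t = 0)
    (h2a : Tendsto (fun t => f t / t) (nhdsWithin 0 (Ioi 0)) (nhds 0)) {p q : ℝ} (hp : 0 ≤ p)
    (hq : 0 ≤ q)
    (h2b : Tendsto (fun t => f t / t ^ q) atTop (nhds 0))
    {lam : ℝ} (hlam : 0 < lam) {D γ : ℝ} (hD : 0 < D) (hγ1 : γ ≤ 1) (hγp : γ * p ≤ 1)
    (hγq : γ * q ≤ 1) :
    ∃ C, 0 ≤ C ∧ ∀ r t, 0 < r → r ≤ 1 → 0 ≤ t → t ≤ D * r ^ (-γ) →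
      gg p lam K f r t ≤ C / r := by
  obtain ⟨Ce, hCe, hf⟩ := f_growth hc hnn h0 h2a h2b (ε := 1) one_pos
  have key : ∀ r t a : ℝ, 0 < r → r ≤ 1 → 0 ≤ t → t ≤ D * r ^ (-γ) → 0 ≤ a → γ * a ≤ 1 →
      t ^ a ≤ D ^ a / r := fun r t a hr hr1 ht h ha hγa => by
    calc t ^ a ≤ (D * r ^ (-γ)) ^ a := Real.rpow_le_rpow ht h ha
      _ = D ^ a * r ^ (-(γ * a)) := by
          rw [Real.mul_rpow hD.le (Real.rpow_nonneg hr.le _), ← Real.rpow_mul hr.le, neg_mul]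
      _ ≤ D ^ a * r ^ (-1:ℝ) := by
          gcongr ?_ * ?_
          exact Real.rpow_le_rpow_of_exponent_ge hr hr1 (by linarith)
      _ = D ^ a / r := by rw [Real.rpow_neg_one]; rfl
  refine ⟨D ^ p + lam * C0 * (D ^ q + Ce * D), by positivity, fun r t hr hr1 ht h => ?_⟩
  have k1 := key r t p hr hr1 ht h hp hγp
  have k2 := key r t q hr hr1 ht h hq hγq
  have k3 := key r t 1 hr hr1 ht h zero_le_one (by linarith)
  rw [Real.rpow_one, Real.rpow_one] at k3
  have hKb : K r ≤ C0 := (hK r hr hr1).trans (by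
    have := Real.rpow_le_one hr.le hr1 hβ.le
    nlinarith)
  unfold gg
  rw [max_eq_left ht]
  calc _ ≤ D ^ p / r + lam * C0 * (D ^ q / r + Ce * (D / r)) := by
        have := hnn t
        have : f t ≤ D ^ q / r + Ce * (D / r) := by
          refine (hf t ht).trans ?_
          rw [one_mul]
          gcongr
        gcongr
    _ = _ := by ring
end

lemma count_nodes {n : ℕ} {s1 s2 : ℝ} (h1 : 0 ≤ s1) (h12 : s1 < s2) (h2 : s2 ≤ 1)
    (hn : 4 ≤ n * (s2 - s1)) :
    (s2 - s1) / 2 ≤ ∑ i : Fin n, if s1 ≤ pt n i ∧ pt n i ≤ s2 then 1 / (n:ℝ) else 0 := by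
  have hn' : (0:ℝ) < n := by
    by_contra h
    nlinarith
  have e : (∑ i : Fin n, if s1 ≤ pt n i ∧ pt n i ≤ s2 then 1 / (n:ℝ) else 0) =
      ∑ i ∈ Finset.range n, if s1 ≤ (i:ℝ) / n + 1 / n ∧ (i:ℝ)/n + 1/n ≤ s2 then 1 / (n:ℝ) else 0 :=
    Fin.sum_univ_eq_sum_range
      (fun i => if s1 ≤ (i:ℝ) / n + 1 / n ∧ (i:ℝ)/n + 1/n ≤ s2 then 1 / (n:ℝ) else 0) n
  rw [e]
  set a := ⌈(n:ℝ) * s1⌉₊ with ha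
  set b := ⌊(n:ℝ) * s2⌋₊ with hb
  have hbn : b ≤ n := by
    rw [hb]
    refine (Nat.floor_le_floor (b := (n:ℝ)) (by nlinarith)).trans (by simp)
  have ha1 : (a:ℝ) < n * s1 + 1 := Nat.ceil_lt_add_one (by positivity)
  have ha2 : n * s1 ≤ (a:ℝ) := Nat.le_ceil _
  have hb1 : n * s2 - 1 < (b:ℝ) := Nat.sub_one_lt_floor _
  have hb2 : (b:ℝ) ≤ n * s2 := Nat.floor_le (by nlinarith)
  have hsub : Finset.Ico a b ⊆ Finset.range n := fun i hi => by
    rw [Finset.mem_Ico] at hi; rw [Finset.mem_range]; omega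
  refine le_trans ?_ (Finset.sum_le_sum_of_subset_of_nonneg hsub fun i _ _ => by
    split_ifs <;> positivity)
  have hc : ∑ i ∈ Finset.Ico a b, (1 / (n:ℝ)) ≤ ∑ i ∈ Finset.Ico a b,
      if s1 ≤ (i:ℝ) / n + 1 / n ∧ (i:ℝ)/n + 1/n ≤ s2 then 1 / (n:ℝ) else 0 := by
    refine Finset.sum_le_sum fun i hi => ?_
    rw [Finset.mem_Ico] at hi
    have hi1 : (a:ℝ) ≤ i := by exact_mod_cast hi.1
    have hi2 : (i:ℝ) + 1 ≤ b := by exact_mod_cast hi.2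
    rw [if_pos]
    rw [← add_div, le_div_iff₀ hn', div_le_iff₀ hn']
    constructor <;> nlinarith
  refine le_trans ?_ hc
  have hab : a ≤ b := by
    have : (a:ℝ) ≤ b := by nlinarith
    exact_mod_cast this
  rw [Finset.sum_const, Nat.card_Ico, nsmul_eq_mul, Nat.cast_sub hab, mul_one_div,
    le_div_iff₀ hn']
  nlinarith

section
variable {m : ℕ} {β : ℝ} {K f : ℝ → ℝ} {C0 : ℝ}

lemma gg_cont {p lam : ℝ} (hp : 0 ≤ p) (hK : Continuous K) (hf : Continuous f) :
    Continuous (Function.uncurry (gg p lam K f)) := by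
  have : Function.uncurry (gg p lam K f) = fun z : ℝ × ℝ => (max z.2 0) ^ p + lam * K z.1 * f z.2 := by
    ext z; rfl
  rw [this]
  refine Continuous.add ?_ (by fun_prop)
  exact (continuous_snd.max continuous_const).rpow_const fun _ => Or.inr hp

lemma gg_nonneg {p lam : ℝ} (hlam : 0 ≤ lam) (hK0 : ∀ r, 0 ≤ K r) (hnn : ∀ t, 0 ≤ f t) (s t : ℝ) :
    0 ≤ gg p lam K f s t := by
  unfold gg
  have := hK0 s
  have := hnn t
  positivity

lemma gg_zero {p lam : ℝ} (hp : 0 < p) (h0 : ∀ t ≤ 0, f t = 0) (s t : ℝ) (ht : t ≤ 0) :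
    gg p lam K f s t = 0 := by
  unfold gg
  rw [max_eq_right ht, Real.zero_rpow hp.ne', h0 t ht]; ring

lemma gg_small {a lam : ℝ} (ha : 0 < a) (hlam : 0 < lam) (hC0 : 0 < C0)
    (hK0 : ∀ r, 0 ≤ K r) (hK : ∀ r, 0 < r → r ≤ 1 → K r ≤ C0)
    (hnn : ∀ t, 0 ≤ f t) (h0 : ∀ t ≤ 0, f t = 0)
    (h2a : Tendsto (fun t => f t / t) (nhdsWithin 0 (Ioi 0)) (nhds 0)) {ε : ℝ} (hε : 0 < ε) :
    ∃ d > 0, ∀ r t, 0 < r → r ≤ 1 → t ≤ d → gg (1 + a) lam K f r t ≤ ε * |t| := by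
  obtain ⟨d, hd, h⟩ := f_small h0 h2a (ε := ε / (2 * lam * C0)) (by positivity)
  refine ⟨min d ((ε/2) ^ (1/a)), by positivity, fun r t hr hr1 ht => ?_⟩
  rcases le_or_gt t 0 with h' | h'
  · rw [gg_zero (by linarith) h0 r t h']; positivity
  · have e1 := h t (ht.trans (min_le_left _ _))
    unfold gg
    rw [max_eq_left h'.le, rpow_split h'.le ha.le]
    rw [abs_of_pos h'] at e1 ⊢
    have e2 : t ^ a ≤ ε / 2 := by
      calc t ^ a ≤ ((ε/2) ^ (1/a)) ^ a :=
            Real.rpow_le_rpow h'.le (ht.trans (min_le_right _ _)) ha.le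
        _ = ε / 2 := by rw [← Real.rpow_mul (by positivity), one_div_mul_cancel ha.ne', Real.rpow_one]
    have e3 : lam * K r * f t ≤ lam * C0 * (ε / (2 * lam * C0) * t) := by
      have := hK r hr hr1
      have := hnn t
      gcongr
    have e4 : lam * C0 * (ε / (2 * lam * C0) * t) = ε / 2 * t := by field_simp
    nlinarith

lemma gg_int {p lam : ℝ} (hp : 0 ≤ p) (hf : Continuous f) (s t : ℝ) (ht : 0 ≤ t) :
    ∫ τ in (0:ℝ)..t, gg p lam K f s τ = t ^ (p + 1) / (p + 1) + lam * K s * ∫ τ in (0:ℝ)..t, f τ := by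
  unfold gg
  have hc : Continuous fun τ : ℝ => (max τ 0) ^ p :=
    (continuous_id.max continuous_const).rpow_const fun _ => Or.inr hp
  rw [intervalIntegral.integral_add (hc.intervalIntegrable _ _)
    ((hf.const_mul _).intervalIntegrable _ _), intervalIntegral.integral_const_mul]
  congr 1
  have : ∫ τ in (0:ℝ)..t, (max τ 0) ^ p = ∫ τ in (0:ℝ)..t, τ ^ p := by
    refine intervalIntegral.integral_congr fun τ hτ => ?_
    rw [uIcc_of_le ht] at hτ
    simp only [max_eq_left hτ.1]
  rw [this, integral_rpow (Or.inl (by linarith)), Real.zero_rpow (by linarith), sub_zero]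

lemma gg_AR {p lam θ θ' : ℝ} (hp : 0 ≤ p) (hlam : 0 ≤ lam) (hK0 : ∀ r, 0 ≤ K r)
    (hf : Continuous f) (hnn : ∀ t, 0 ≤ f t) (hθ0 : 0 ≤ θ') (hθ : θ' ≤ θ) (hθp : θ' ≤ p + 1)
    (h3 : ∀ t : ℝ, 0 ≤ t → θ * (∫ s in (0:ℝ)..t, f s) ≤ t * f t) (s t : ℝ) (ht : 0 ≤ t) :
    θ' * (∫ τ in (0:ℝ)..t, gg p lam K f s τ) ≤ t * gg p lam K f s t := by
  rw [gg_int hp hf s t ht]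
  unfold gg
  rw [max_eq_left ht]
  have hF : 0 ≤ ∫ τ in (0:ℝ)..t, f τ := intervalIntegral.integral_nonneg ht fun _ _ => hnn _
  have e1 : t ^ (p+1) = t * t ^ p := by rw [add_comm, rpow_split ht hp]
  have e2 : θ' * (t ^ (p+1) / (p+1)) ≤ t * t ^ p := by
    rw [e1, mul_div_assoc', div_le_iff₀ (by linarith)]
    have : 0 ≤ t * t ^ p := by positivity
    nlinarith
  have e3 : θ' * ∫ τ in (0:ℝ)..t, f τ ≤ t * f t := (mul_le_mul_of_nonneg_right hθ hF).trans (h3 t ht)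
  have e4 : 0 ≤ lam * K s := mul_nonneg hlam (hK0 s)
  nlinarith [mul_le_mul_of_nonneg_left e3 e4]

lemma path_ok {p c1 s1 s2 κ : ℝ} (hm : 1 ≤ m) (hp : 0 ≤ p) (hc1 : 0 < c1)
    (hs1 : 0 < s1) (hs12 : s1 < s2) (hs2 : s2 < 1) (hκ : 0 < κ) (hK0 : ∀ r, 0 ≤ K r)
    (hKκ : ∀ r, s1 ≤ r → r ≤ s2 → κ ≤ K r)
    (hf : Continuous f) (hnn : ∀ t, 0 ≤ f t)
    (h5 : ∃ c : ℝ, 0 < c ∧ ∀ t ∈ Ioo (0:ℝ) c, 0 < f t) :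
    ∃ t > 0, ∃ lamstar > 0, ∃ n0 : ℕ, ∀ lam > lamstar, ∀ n ≥ n0, ∃ b : Fin n,
      0 < hh m (pt n b) ∧ t ^ 2 / (2 * hh m (pt n b)) ≤ c1 ∧
      t ^ 2 / (2 * hh m (pt n b)) ≤ ∑ i : Fin n,
        ∫ s in (0:ℝ)..(t / hh m (pt n b) * min (hh m (pt n i)) (hh m (pt n b))),
          pt n i ^ (m+1) / n * gg p lam K f (pt n i) s := by
  have hH := hh_pos hm (hs1.trans hs12) hs2
  obtain ⟨c, hc, h5⟩ := h5
  set t := Real.sqrt (c1 * hh m s2) with ht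
  have htp : 0 < t := Real.sqrt_pos.2 (by positivity)
  have ht2 : t ^ 2 = c1 * hh m s2 := Real.sq_sqrt (by positivity)
  set Ft := ∫ τ in (0:ℝ)..t, f τ with hFt
  have hFp : 0 < Ft := by
    refine intervalIntegral.integral_pos htp hf.continuousOn (fun _ _ => hnn _)
      ⟨min t c / 2, ⟨by positivity, ?_⟩, h5 _ ⟨by positivity, ?_⟩⟩
    · have := min_le_left t c; linarith
    · have := min_le_right t c; linarith
  set W := κ * s1 ^ (m+1) * Ft * ((s2 - s1) / 2) with hW
  have hs : 0 < s2 - s1 := by linarith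
  have hWp : 0 < W := by positivity
  obtain ⟨n0, hn0⟩ := exists_nat_ge (4 / (s2 - s1))
  refine ⟨t, htp, c1 / W, by positivity, n0, fun lam hlam n hn => ?_⟩
  have hlp : 0 < lam := lt_trans (by positivity) hlam
  have hn4 : 4 ≤ n * (s2 - s1) := by
    rw [div_le_iff₀ hs] at hn0
    have : (n0:ℝ) ≤ n := by exact_mod_cast hn
    nlinarith
  have hcount := count_nodes hs1.le hs12 hs2.le hn4
  have hne : (Finset.univ.filter fun i : Fin n => s1 ≤ pt n i ∧ pt n i ≤ s2).Nonempty := by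
    by_contra h
    rw [Finset.not_nonempty_iff_eq_empty, Finset.filter_eq_empty_iff] at h
    have : (∑ i : Fin n, if s1 ≤ pt n i ∧ pt n i ≤ s2 then 1 / (n:ℝ) else 0) = 0 :=
      Finset.sum_eq_zero fun i hi => if_neg (h hi)
    linarith
  obtain ⟨b, hb, hmax⟩ := Finset.exists_max_image _ (fun i => pt n i) hne
  simp only [Finset.mem_filter, Finset.mem_univ, true_and] at hb hmax
  have hHb : hh m s2 ≤ hh m (pt n b) := hh_anti (pt_pos b) hb.2
  have hHbp : 0 < hh m (pt n b) := hH.trans_le hHb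
  have hle : t ^ 2 / (2 * hh m (pt n b)) ≤ c1 := by
    rw [div_le_iff₀ (by positivity), ht2]
    nlinarith [mul_pos hc1 hHbp]
  refine ⟨b, hHbp, hle, hle.trans ?_⟩
  have h1 : c1 ≤ lam * W := by
    have := (div_lt_iff₀ hWp).1 hlam; linarith
  refine h1.trans ?_
  calc lam * W = (lam * κ * s1 ^ (m+1) * Ft) * ((s2 - s1)/2) := by rw [hW]; ring
    _ ≤ (lam * κ * s1 ^ (m+1) * Ft) * ∑ i : Fin n, if s1 ≤ pt n i ∧ pt n i ≤ s2 then 1 / (n:ℝ) else 0 := by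
        gcongr
    _ ≤ _ := by
        rw [Finset.mul_sum]
        refine Finset.sum_le_sum fun i _ => ?_
        have hpi := pt_pos i
        have hn' : (0:ℝ) < n := by exact_mod_cast (Nat.zero_lt_of_lt i.2)
        have hHi : 0 ≤ hh m (pt n i) := hh_nonneg hpi (pt_le i)
        split_ifs with h
        · have hmin : min (hh m (pt n i)) (hh m (pt n b)) = hh m (pt n b) :=
            min_eq_right (hh_anti hpi (hmax i h))
          rw [hmin, div_mul_cancel₀ _ hHbp.ne', intervalIntegral.integral_const_mul,
            gg_int hp hf _ _ htp.le]
          have hk := hKκ _ h.1 h.2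
          have hpp : s1 ^ (m+1) ≤ pt n i ^ (m+1) := by
            have := h.1; gcongr
          calc lam * κ * s1 ^ (m+1) * Ft * (1 / n) = s1 ^ (m+1) / n * (lam * κ * Ft) := by ring
            _ ≤ pt n i ^ (m+1) / n * (lam * K (pt n i) * Ft) := by
                gcongr
            _ ≤ _ := by
                gcongr
                have : 0 ≤ t ^ (p + 1) / (p + 1) := by positivity
                linarith
        · rw [mul_zero]
          refine intervalIntegral.integral_nonneg ?_ fun s _ => ?_
          · exact mul_nonneg (by positivity) (le_min hHi hHbp.le)
          · exact mul_nonneg (by positivity) (gg_nonneg hlp.le hK0 hnn _ _)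
end

lemma radial_exists {m : ℕ} {β : ℝ} {K f : ℝ → ℝ} {C0 s1 s2 κ : ℝ} (hm : 1 ≤ m) (hβ : 0 < β)
    (hC0 : 0 < C0) (hKc : Continuous K)
    (hK0 : ∀ r, 0 ≤ K r) (hK : ∀ r, 0 < r → r ≤ 1 → K r ≤ C0 * r ^ β)
    (hs1 : 0 < s1) (hs12 : s1 < s2) (hs2 : s2 < 1) (hκ : 0 < κ)
    (hKκ : ∀ r, s1 ≤ r → r ≤ s2 → κ ≤ K r)
    (hc : Continuous f) (hnn : ∀ t, 0 ≤ f t) (h0 : ∀ t ≤ 0, f t = 0)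
    (h2a : Tendsto (fun t => f t / t) (nhdsWithin 0 (Ioi 0)) (nhds 0))
    (h2b : Tendsto (fun t => f t / t ^ (1 + 2 * (2 + β) / m)) atTop (nhds 0))
    (h3 : ∃ θ : ℝ, 2 < θ ∧ ∀ t : ℝ, 0 ≤ t → θ * (∫ s in (0:ℝ)..t, f s) ≤ t * f t)
    (h5 : ∃ c : ℝ, 0 < c ∧ ∀ t ∈ Ioo (0:ℝ) c, 0 < f t) :
    ∃ lamstar > 0, ∀ lam > lamstar, ∃ m0 > 0, ∃ u : ℝ → ℝ, Continuous u ∧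
      (∀ r ∈ Icc (0:ℝ) 1, 0 ≤ u r) ∧ (∃ r ∈ Icc (0:ℝ) 1, m0 ≤ u r) ∧
      ∀ r ∈ Icc (0:ℝ) 1, u r = ∫ s in (0:ℝ)..1, hh m (max r s) * s ^ (m + 1) *
        gg (1 + 2 * 2 / m) lam K f s (u s) := by
  have hm' : (0:ℝ) < m := by exact_mod_cast hm
  obtain ⟨θ, hθ, h3⟩ := h3
  set p : ℝ := 1 + 2 * 2 / m with hp
  set q : ℝ := 1 + 2 * (2 + β) / m with hq
  have ha : (0:ℝ) < 2 * 2 / m := by positivity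
  have hp0 : 0 < p := by positivity
  have hq0 : 0 < q := by positivity
  have hp1 : 1 < p := by rw [hp]; linarith
  set θ' := min θ (p + 1) with hθ'
  have hθ2 : 2 < θ' := lt_min hθ (by linarith)
  set γ : ℝ := 1 / (p + q + 2) with hγ
  have hγ0 : 0 < γ := by positivity
  have hγe : γ * (p + q + 2) = 1 := by rw [hγ]; field_simp
  have hγ1 : γ < 1 := by nlinarith [mul_pos hγ0 hp0, mul_pos hγ0 hq0]
  have hγp : γ * p ≤ 1 := by nlinarith [mul_pos hγ0 hp0, mul_pos hγ0 hq0]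
  have hγq : γ * q ≤ 1 := by nlinarith [mul_pos hγ0 hp0, mul_pos hγ0 hq0]
  have hγs : 0 < 1 / (1 - γ) + 1 / γ := by
    have : 0 < 1 - γ := by linarith
    positivity
  set ε : ℝ := 1 / (2 * (1 / (1 - γ) + 1 / γ)) with hε
  have hε0 : 0 < ε := by positivity
  have hεγ : ε * (1 / (1 - γ) + 1 / γ) ≤ 1 / 2 := by
    rw [hε]; generalize 1 / (1 - γ) + 1 / γ = z at hγs; apply le_of_eq; field_simp
  set η : ℝ := min 1 ((ε / 4) ^ ((m:ℝ) / 2)) with hη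
  have hη0 : 0 < η := by positivity
  have hη1 : η ≤ 1 := min_le_left _ _
  have hηε : η ^ (2 / (m:ℝ)) ≤ ε / 4 := by
    calc η ^ (2 / (m:ℝ)) ≤ ((ε / 4) ^ ((m:ℝ) / 2)) ^ (2 / (m:ℝ)) :=
          Real.rpow_le_rpow hη0.le (min_le_right _ _) (by positivity)
      _ = ε / 4 := by
          rw [← Real.rpow_mul (by positivity), show (m:ℝ) / 2 * (2 / m) = 1 by field_simp,
            Real.rpow_one]
  have hθd : 0 < 1 / 2 - 1 / θ' := by
    have : 1 / θ' < 1 / 2 := one_div_lt_one_div_of_lt (by norm_num) hθ2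
    linarith
  obtain ⟨t, ht, lamstar, hls, n0, hpath⟩ := path_ok (p := p) (c1 := η * (1/2 - 1/θ')) hm hp0.le
    (by positivity) hs1 hs12 hs2 hκ hK0 hKκ hc hnn h5
  refine ⟨lamstar, hls, fun lam hlam => ?_⟩
  have hlp : 0 < lam := hls.trans hlam
  have hKC : ∀ r, 0 < r → r ≤ 1 → K r ≤ C0 := fun r hr hr1 => (hK r hr hr1).trans (by
    have := Real.rpow_le_one hr.le hr1 hβ.le
    nlinarith)
  obtain ⟨C, hC, hgest⟩ := g_est hm hβ hC0 hK0 hK hc hnn h0 h2a h2b hlp hε0 hη0 hη1 hηε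
  obtain ⟨C3, hC3, hgest2⟩ := g_est2 hm hβ hC0 hK0 hK hc hnn h0 h2a hp0.le hq0.le h2b hlp
    (D := 2 * C + 1) (γ := γ) (by positivity) hγ1.le hγp hγq
  have hgc : Continuous (Function.uncurry (gg p lam K f)) := gg_cont hp0.le hKc hc
  have hgnn := gg_nonneg (p := p) hlp.le hK0 hnn
  obtain ⟨M, hM⟩ := ((isCompact_Icc (a := (0:ℝ)) (b := 1)).prod
    (isCompact_Icc (a := (0:ℝ)) (b := C3))).bddAbove_image hgc.continuousOn
  obtain ⟨m0, hm0, hsm⟩ := gg_small (lam := lam) ha hlp hC0 hK0 hKC hnn h0 h2a (ε := 1/2) (by norm_num)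
  refine ⟨m0, hm0, limit_lemma hm (gg p lam K f) hgc (fun s _ t => hgnn s t) |M| m0
    (abs_nonneg _) (n0 + 1) fun n hn => ?_⟩
  have hn1 : 1 ≤ n := by omega
  have hn' : (0:ℝ) < n := by exact_mod_cast hn1
  obtain ⟨b, hb, hb1, hb2⟩ := hpath lam hlam n (by omega)
  obtain ⟨x, hxne, hxe, hxb⟩ := disc_sol (fun i : Fin n => hh m (pt n i))
    (fun i => hh_nonneg (pt_pos i) (pt_le i))
    (fun i s => pt n i ^ (m+1) / n * gg p lam K f (pt n i) s)
    (fun i => by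
      have : Continuous fun s => gg p lam K f (pt n i) s :=
        hgc.comp (continuous_const.prodMk continuous_id)
      exact this.const_mul _)
    (fun i s hs => by simp only [gg_zero hp0 h0 _ s hs, mul_zero])
    (fun i s => by
      have := hgnn (pt n i) s
      have := pt_pos i
      positivity)
    (fun i e he => by
      have hpi := pt_pos i
      obtain ⟨d, hd, hd'⟩ := gg_small (lam := lam) ha hlp hC0 hK0 hKC hnn h0 h2a
        (ε := e / (pt n i ^ (m+1) / n)) (by positivity)
      filter_upwards [Iic_mem_nhds hd] with s hs
      have := hd' (pt n i) s hpi (pt_le i) hs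
      calc _ ≤ pt n i ^ (m+1) / n * (e / (pt n i ^ (m+1) / n) * |s|) := by gcongr
        _ = e * |s| := by field_simp)
    θ' hθ2
    (fun i s hs => by
      rw [intervalIntegral.integral_const_mul]
      have := gg_AR (lam := lam) hp0.le hlp.le hK0 hc hnn (by linarith) (min_le_left θ (p+1))
        (min_le_right θ (p+1)) h3 (pt n i) s hs
      have h4 : 0 ≤ pt n i ^ (m+1) / n := by
        have := pt_pos i
        positivity
      have := mul_le_mul_of_nonneg_left this h4
      linarith)
    (η * (1/2 - 1/θ')) b hb t ht hb1 hb2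
  have hx1 : ∀ k, x k = ∑ i, hh m (max (pt n k) (pt n i)) * pt n i ^ (m + 1) *
      gg p lam K f (pt n i) (x i) / n := fun k => by
    rw [hxe k]
    refine Finset.sum_congr rfl fun i _ => ?_
    rw [hh_max (pt_pos k) (pt_pos i)]
    ring
  have hx0 : ∀ k, 0 ≤ x k := fun k => by
    rw [hx1 k]
    exact ud_nonneg _ (fun i => hgnn _ _) (pt_le k)
  have hxη : ∀ k, x k ^ 2 ≤ η * (pt n k ^ m)⁻¹ := fun k => by
    have h6 := hxb k
    have h7 : x k ^ 2 ≤ η * hh m (pt n k) := by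
      have : (1/2 - 1/θ') * x k ^ 2 ≤ (1/2 - 1/θ') * (η * hh m (pt n k)) := by linarith
      exact le_of_mul_le_mul_left this hθd
    exact h7.trans (mul_le_mul_of_nonneg_left (hh_le hm (pt_pos k)) hη0.le)
  have hap := apriori hm hn1 γ hγ0 hγ1 ε C hε0.le hεγ hC x
    (fun i => gg p lam K f (pt n i) (x i)) hx1 hx0
    (fun i => hgest _ _ (pt_pos i) (pt_le i) (hx0 i) (hxη i))
  have hgC3 : ∀ i, gg p lam K f (pt n i) (x i) ≤ C3 / pt n i := fun i => by
    refine hgest2 _ _ (pt_pos i) (pt_le i) (hx0 i) ((hap i).trans ?_)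
    have : 0 ≤ pt n i ^ (-γ) := Real.rpow_nonneg (pt_pos i).le _
    nlinarith
  have hxC3 : ∀ k, x k ≤ C3 := fun k => by
    rw [hx1 k]
    exact sum_ker_le hm hn1 _ C3 _ (pt_le k) hgC3 hC3
  refine ⟨x, hx1, fun i => ?_, ?_⟩
  · refine le_trans (hM ⟨(pt n i, x i), ⟨⟨(pt_pos i).le, pt_le i⟩, ⟨hx0 i, hxC3 i⟩⟩, rfl⟩) (le_abs_self M)
  · by_contra hlt
    push Not at hlt
    obtain ⟨k0, hk0⟩ := hxne
    haveI : Nonempty (Fin n) := ⟨k0⟩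
    obtain ⟨k1, hk1⟩ := Finite.exists_max x
    have h8 : x k1 ≤ x k1 / 2 := by
      conv_lhs => rw [hx1 k1]
      refine ud_le hm hn1 _ (by have := hx0 k1; positivity) (fun i => ?_) (pt_le k1)
      have := hsm (pt n i) (x i) (pt_pos i) (pt_le i) (hlt i).le
      rw [abs_of_nonneg (hx0 i), ← hp] at this
      have := hk1 i
      linarith
    have := hx0 k0
    have := hk1 k0
    exact hk0 (by linarith)

section
variable {E : Type*} [NormedAddCommGroup E] [InnerProductSpace ℝ E]

lemma norm_hasFDerivAt {x : E} (hx : x ≠ 0) :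
    HasFDerivAt (fun y : E => ‖y‖) (‖x‖⁻¹ • innerSL ℝ x) x := by
  have h1 := (hasStrictFDerivAt_norm_sq x).hasFDerivAt.sqrt (by simpa using hx)
  have e : (fun y : E => √(‖y‖ ^ 2)) = fun y => ‖y‖ := by
    ext y; exact Real.sqrt_sq (norm_nonneg y)
  rw [e] at h1
  refine h1.congr_fderiv ?_
  have hn : ‖x‖ ≠ 0 := norm_ne_zero_iff.2 hx
  rw [Real.sqrt_sq (norm_nonneg x)]
  ext v
  simp only [ContinuousLinearMap.smul_apply, smul_eq_mul, nsmul_eq_mul]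
  push_cast
  field_simp

lemma rad_fderiv {A w : ℝ → ℝ} (hw : ∀ r, HasDerivAt w (-(r * A r)) r) (x : E) :
    HasFDerivAt (fun y : E => w ‖y‖) (-(A ‖x‖ • innerSL ℝ x)) x := by
  by_cases hx : x = 0
  · subst hx
    have h0 := hw 0
    rw [hasFDerivAt_iff_isLittleO_nhds_zero]
    rw [hasDerivAt_iff_isLittleO_nhds_zero] at h0
    have h1 : Tendsto (fun h : E => ‖h‖) (nhds 0) (nhds 0) := by
      simpa using (continuous_norm (E := E)).tendsto 0
    have h2 := h0.comp_tendsto h1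
    have h3 : (fun h : E => w ‖(0:E) + h‖ - w ‖(0:E)‖ - (-(A ‖(0:E)‖ • innerSL ℝ (0:E))) h) =o[nhds 0]
        fun h : E => ‖h‖ := by
      refine h2.congr_left fun h => ?_
      simp
    exact h3.of_norm_right
  · have hn : ‖x‖ ≠ 0 := norm_ne_zero_iff.2 hx
    refine ((hw ‖x‖).comp_hasFDerivAt x (norm_hasFDerivAt hx)).congr_fderiv ?_
    rw [smul_smul, ← neg_smul]
    congr 1
    field_simp

noncomputable def LL (A G : ℝ → ℝ) (d : ℝ) (x : E) : E →L[ℝ] E :=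
  A ‖x‖ • ContinuousLinearMap.id ℝ E +
    ((G ‖x‖ - d * A ‖x‖) / ‖x‖ ^ 2) • (innerSL ℝ x).smulRight x

lemma LL_hasFDerivAt {A G : ℝ → ℝ} {d : ℝ} (hA : Continuous A)
    (hA' : ∀ r, 0 < r → HasDerivAt A ((G r - d * A r) / r) r) (x : E) :
    HasFDerivAt (fun y : E => A ‖y‖ • y) (LL A G d x) x := by
  by_cases hx : x = 0
  · subst hx
    rw [hasFDerivAt_iff_isLittleO_nhds_zero]
    have h1 : Tendsto (fun h : E => A ‖h‖ - A 0) (nhds 0) (nhds 0) := by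
      have : Continuous fun h : E => A ‖h‖ - A 0 := by fun_prop
      simpa using this.tendsto 0
    have h2 := ((Asymptotics.isLittleO_one_iff ℝ).2 h1).smul_isBigO
      (Asymptotics.isBigO_refl (fun h : E => h) (nhds 0))
    refine (h2.congr (fun h => ?_) (fun h => ?_))
    · simp [LL, sub_smul]
    · simp
  · have hn : ‖x‖ ≠ 0 := norm_ne_zero_iff.2 hx
    have h1 := ((hA' ‖x‖ (norm_pos_iff.2 hx)).comp_hasFDerivAt x (norm_hasFDerivAt hx)).smul
      (hasFDerivAt_id x)
    refine h1.congr_fderiv ?_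
    ext v
    simp [LL, smul_smul]
    congr 1
    field_simp

lemma LL_cont {A G : ℝ → ℝ} {d : ℝ} (hA : Continuous A) (hG : Continuous G)
    (hd : G 0 = d * A 0) : Continuous (LL A G d : E → E →L[ℝ] E) := by
  have hsm : Continuous fun x : E => (innerSL ℝ x).smulRight x := by
    have h := (ContinuousLinearMap.smulRightL ℝ E E).continuous₂
    exact h.comp ((innerSL ℝ (E := E)).continuous.prodMk continuous_id)
  rw [continuous_iff_continuousAt]
  intro x
  by_cases hx : x = 0
  · subst hx
    unfold LL
    refine ContinuousAt.add (by fun_prop) ?_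
    have h1 : Tendsto (fun h : E => |G ‖h‖ - d * A ‖h‖|) (nhds 0) (nhds 0) := by
      have : Continuous fun h : E => |G ‖h‖ - d * A ‖h‖| := by fun_prop
      simpa [hd] using this.tendsto 0
    have h0 : ((G ‖(0:E)‖ - d * A ‖(0:E)‖) / ‖(0:E)‖ ^ 2) • (innerSL ℝ (0:E)).smulRight (0:E) = 0 := by
      simp
    unfold ContinuousAt
    beta_reduce
    rw [h0]
    refine squeeze_zero_norm (fun h => ?_) h1
    rw [norm_smul, ContinuousLinearMap.norm_smulRight_apply, innerSL_apply_norm, norm_div,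
      Real.norm_eq_abs, norm_pow, norm_norm]
    by_cases hh : h = 0
    · subst hh; simp
    · have : ‖h‖ ≠ 0 := norm_ne_zero_iff.2 hh
      apply le_of_eq; field_simp
  · have hn : ‖x‖ ≠ 0 := norm_ne_zero_iff.2 hx
    unfold LL
    refine ContinuousAt.add (by fun_prop) ?_
    have hq : ContinuousAt (fun x : E => (G ‖x‖ - d * A ‖x‖) / ‖x‖ ^ 2) x := ?_
    · exact hq.smul hsm.continuousAt
    refine ContinuousAt.div (by fun_prop) (by fun_prop) (by positivity)

lemma rad_contDiff {A G w : ℝ → ℝ} {d : ℝ} (hA : Continuous A) (hG : Continuous G)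
    (hd : G 0 = d * A 0) (hA' : ∀ r, 0 < r → HasDerivAt A ((G r - d * A r) / r) r)
    (hw : ∀ r, HasDerivAt w (-(r * A r)) r) : ContDiff ℝ 2 fun y : E => w ‖y‖ := by
  have h1 : ContDiff ℝ 1 fun y : E => A ‖y‖ • y :=
    contDiff_one_iff_hasFDerivAt.2 ⟨_, LL_cont hA hG hd, fun x => LL_hasFDerivAt hA hA' x⟩
  have h2 : ContDiff ℝ ((1:ℕ) + 1) fun y : E => w ‖y‖ := by
    rw [contDiff_succ_iff_hasFDerivAt]
    refine ⟨fun x => -(innerSL ℝ (A ‖x‖ • x)), ?_, fun x => ?_⟩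
    · have := ((innerSL ℝ (E := E)).contDiff (n := 1)).comp h1
      exact this.neg
    · have := rad_fderiv hw x
      refine this.congr_fderiv ?_
      beta_reduce
      rw [map_smul]
  exact_mod_cast h2
end

noncomputable def AA (m : ℕ) (G : ℝ → ℝ) (r : ℝ) : ℝ := ∫ t in (0:ℝ)..1, t ^ (m+1) * G (r * t)
noncomputable def ww (m : ℕ) (G : ℝ → ℝ) (r : ℝ) : ℝ := ∫ t in r..1, t * AA m G t

lemma AA_cont {m : ℕ} {G : ℝ → ℝ} (hG : Continuous G) : Continuous (AA m G) := by
  unfold AA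
  refine intervalIntegral.continuous_parametric_intervalIntegral_of_continuous' ?_ 0 1
  simp only [Function.uncurry_def]
  fun_prop

lemma AA_zero {m : ℕ} {G : ℝ → ℝ} : G 0 = ((m:ℝ) + 2) * AA m G 0 := by
  unfold AA
  simp only [zero_mul, intervalIntegral.integral_mul_const, integral_pow]
  push_cast
  have : (0:ℝ) < m + 2 := by positivity
  simp
  field_simp
  ring

lemma AA_eq {m : ℕ} {G : ℝ → ℝ} {r : ℝ} (hr : 0 < r) :
    AA m G r = (r ^ (m+2))⁻¹ * ∫ s in (0:ℝ)..r, s ^ (m+1) * G s := by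
  unfold AA
  have h := intervalIntegral.integral_comp_mul_left (a := 0) (b := 1)
    (fun s => s ^ (m+1) * G s) hr.ne'
  rw [mul_zero, mul_one, smul_eq_mul] at h
  have h2 : ∫ x in (0:ℝ)..1, (r * x) ^ (m+1) * G (r * x) =
      r ^ (m+1) * ∫ t in (0:ℝ)..1, t ^ (m+1) * G (r * t) := by
    rw [← intervalIntegral.integral_const_mul]
    congr 1; ext x; rw [mul_pow]; ring
  rw [h2] at h
  have : ∫ s in (0:ℝ)..r, s ^ (m+1) * G s =
      r * (r ^ (m+1) * ∫ t in (0:ℝ)..1, t ^ (m+1) * G (r * t)) := by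
    rw [h]; field_simp
  rw [this]
  field_simp
  ring

lemma II_deriv {m : ℕ} {G : ℝ → ℝ} (hG : Continuous G) (r : ℝ) :
    HasDerivAt (fun r => ∫ s in (0:ℝ)..r, s ^ (m+1) * G s) (r ^ (m+1) * G r) r := by
  have hc : Continuous fun s : ℝ => s ^ (m+1) * G s := by fun_prop
  exact intervalIntegral.integral_hasDerivAt_right (hc.intervalIntegrable _ _)
    (hc.stronglyMeasurableAtFilter _ _) hc.continuousAt

lemma AA_deriv {m : ℕ} {G : ℝ → ℝ} (hG : Continuous G) (r : ℝ) (hr : 0 < r) :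
    HasDerivAt (AA m G) ((G r - ((m:ℝ) + 2) * AA m G r) / r) r := by
  have h1 := ((hasDerivAt_pow (m+2) r).inv (by positivity)).mul (II_deriv (m := m) hG r)
  have h2 : HasDerivAt (AA m G) _ r := h1.congr_of_eventuallyEq (by
    filter_upwards [Ioi_mem_nhds hr] with s hs
    rw [AA_eq hs]; rfl)
  refine h2.congr_deriv ?_
  rw [AA_eq hr]
  generalize (∫ s in (0:ℝ)..r, s ^ (m+1) * G s) = z
  simp only [Pi.inv_apply]
  push_cast
  field_simp
  ring

lemma ww_deriv {m : ℕ} {G : ℝ → ℝ} (hG : Continuous G) (r : ℝ) :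
    HasDerivAt (ww m G) (-(r * AA m G r)) r := by
  have hc : Continuous fun s : ℝ => s * AA m G s := continuous_id.mul (AA_cont hG)
  exact intervalIntegral.integral_hasDerivAt_left (hc.intervalIntegrable _ _)
    (hc.stronglyMeasurableAtFilter _ _) hc.continuousAt

lemma hh_mul {m : ℕ} (hm : 1 ≤ m) {s : ℝ} (hs : 0 < s) :
    hh m s * s ^ (m+1) = (s - s ^ (m+1)) / m := by
  have hm' : (0:ℝ) < m := by exact_mod_cast hm
  unfold hh
  field_simp
  ring

lemma u_split {m : ℕ} (hm : 1 ≤ m) {G : ℝ → ℝ} (hG : Continuous G) {r : ℝ} (hr : 0 < r)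
    (hr1 : r ≤ 1) : ∫ s in (0:ℝ)..1, hh m (max r s) * s ^ (m+1) * G s =
      hh m r * (∫ s in (0:ℝ)..r, s ^ (m+1) * G s) + ∫ s in r..1, (s - s ^ (m+1)) / m * G s := by
  have e1 : EqOn (fun s => hh m r * (s ^ (m+1) * G s)) (fun s => hh m (max r s) * s ^ (m+1) * G s)
      (Icc 0 r) := fun s hs => by
    simp only [max_eq_left hs.2]; ring
  have e2 : EqOn (fun s => (s - s ^ (m+1)) / m * G s) (fun s => hh m (max r s) * s ^ (m+1) * G s)
      (Icc r 1) := fun s hs => by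
    simp only [max_eq_right hs.1, hh_mul hm (hr.trans_le hs.1)]
  have c1 : Continuous fun s => hh m r * (s ^ (m+1) * G s) := by fun_prop
  have c2 : Continuous fun s : ℝ => (s - s ^ (m+1)) / m * G s := by fun_prop
  have i1 : IntervalIntegrable (fun s => hh m (max r s) * s ^ (m+1) * G s) volume 0 r :=
    (c1.intervalIntegrable 0 r).congr (e1.mono (by rw [uIoc_of_le hr.le]; exact Ioc_subset_Icc_self))
  have i2 : IntervalIntegrable (fun s => hh m (max r s) * s ^ (m+1) * G s) volume r 1 :=
    (c2.intervalIntegrable r 1).congr (e2.mono (by rw [uIoc_of_le hr1]; exact Ioc_subset_Icc_self))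
  rw [← intervalIntegral.integral_add_adjacent_intervals i1 i2]
  congr 1
  · rw [← intervalIntegral.integral_const_mul]
    refine (intervalIntegral.integral_congr ?_).symm
    rw [uIcc_of_le hr.le]; exact e1
  · refine (intervalIntegral.integral_congr ?_).symm
    rw [uIcc_of_le hr1]; exact e2

lemma u_eq_ww {m : ℕ} (hm : 1 ≤ m) {G u : ℝ → ℝ} (hG : Continuous G) (hu : Continuous u)
    (h : ∀ r ∈ Icc (0:ℝ) 1, u r = ∫ s in (0:ℝ)..1, hh m (max r s) * s ^ (m + 1) * G s) :
    ∀ r ∈ Icc (0:ℝ) 1, u r = ww m G r := by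
  have hm' : (0:ℝ) < m := by exact_mod_cast hm
  have c2 : Continuous fun s : ℝ => (s - s ^ (m+1)) / m * G s := by fun_prop
  let v : ℝ → ℝ := fun r => hh m r * (∫ s in (0:ℝ)..r, s ^ (m+1) * G s) +
    ∫ s in r..1, (s - s ^ (m+1)) / m * G s
  have hv : ∀ r, 0 < r → HasDerivAt v (-(r * AA m G r)) r := fun r hr => by
    have h1 := ((hh_hasDerivAt hm hr).mul (II_deriv (m := m) hG r)).add
      (intervalIntegral.integral_hasDerivAt_left (c2.intervalIntegrable r 1)
        (c2.stronglyMeasurableAtFilter _ _) c2.continuousAt)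
    refine h1.congr_deriv ?_
    rw [AA_eq hr, ← hh_mul hm hr]
    field_simp
    ring
  have hww1 : ww m G 1 = 0 := by simp [ww]
  have hv1 : v 1 = 0 := by simp [v, hh_one]
  have key : ∀ r ∈ Ioc (0:ℝ) 1, u r = ww m G r := fun r hr => by
    rw [h r ⟨hr.1.le, hr.2⟩, u_split hm hG hr.1 hr.2]
    have hd : ∀ x ∈ Icc r 1, HasDerivAt (fun x => v x - ww m G x) 0 x := fun x hx =>
      ((hv x (hr.1.trans_le hx.1)).sub (ww_deriv hG x)).congr_deriv (by ring)
    have := constant_of_has_deriv_right_zero (f := fun x => v x - ww m G x) (a := r) (b := 1)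
      (fun x hx => (hd x hx).continuousAt.continuousWithinAt)
      (fun x hx => (hd x ⟨hx.1, hx.2.le⟩).hasDerivWithinAt) 1 ⟨hr.2, le_rfl⟩
    simp only [hww1, hv1] at this
    change v r = _
    linarith
  have hwc : Continuous (ww m G) :=
    continuous_iff_continuousAt.2 fun x => (ww_deriv hG x).continuousAt
  have hcl : closure (Ioc (0:ℝ) 1) = Icc 0 1 := closure_Ioc (by norm_num)
  intro r hr
  rw [← hcl] at hr
  exact (EqOn.closure (fun r hr => key r hr : EqOn u (ww m G) (Ioc 0 1)) hu hwc) hr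

lemma lap_rad {N m : ℕ} (hN : N = m + 2) {G : ℝ → ℝ} (hG : Continuous G)
    (x : EuclideanSpace ℝ (Fin N)) :
    -laplacian (fun y : EuclideanSpace ℝ (Fin N) => ww m G ‖y‖) x = G ‖x‖ := by
  have h1 : ∀ (i : Fin N) (y : EuclideanSpace ℝ (Fin N)),
      fderiv ℝ (fun y : EuclideanSpace ℝ (Fin N) => ww m G ‖y‖) y (EuclideanSpace.single i (1:ℝ)) =
      -(innerSL ℝ (EuclideanSpace.single i (1:ℝ)) (AA m G ‖y‖ • y)) := fun i y => by
    rw [(rad_fderiv (ww_deriv hG) y).fderiv]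
    simp only [ContinuousLinearMap.neg_apply, ContinuousLinearMap.smul_apply, innerSL_apply_apply,
      inner_smul_right, smul_eq_mul]
    rw [real_inner_comm]
  have h2 : ∀ i : Fin N, fderiv ℝ (fun y => fderiv ℝ
      (fun y : EuclideanSpace ℝ (Fin N) => ww m G ‖y‖) y (EuclideanSpace.single i (1:ℝ))) x
      (EuclideanSpace.single i (1:ℝ)) =
      -(AA m G ‖x‖ + (G ‖x‖ - ((m:ℝ) + 2) * AA m G ‖x‖) / ‖x‖ ^ 2 * (x i * x i)) := fun i => by
    simp only [h1]
    have h3 := LL_hasFDerivAt (AA_cont (m := m) hG) (AA_deriv hG) x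
    have h4 : HasFDerivAt (fun y : EuclideanSpace ℝ (Fin N) =>
      -(innerSL ℝ (EuclideanSpace.single i (1:ℝ)) (AA m G ‖y‖ • y))) _ x :=
      ((innerSL ℝ (EuclideanSpace.single i (1:ℝ))).hasFDerivAt.comp x h3).neg
    rw [h4.fderiv]
    simp [LL, EuclideanSpace.inner_single_left, EuclideanSpace.inner_single_right]
  unfold laplacian
  simp only [h2]
  rw [Finset.sum_neg_distrib, neg_neg, Finset.sum_add_distrib, ← Finset.mul_sum]
  have h5 : ∑ i, x i * x i = ‖x‖ ^ 2 := by
    rw [EuclideanSpace.norm_sq_eq]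
    refine Finset.sum_congr rfl fun i _ => ?_
    rw [Real.norm_eq_abs, sq_abs, sq]
  rw [h5, Finset.sum_const, Finset.card_univ, Fintype.card_fin, nsmul_eq_mul,
    show (N:ℝ) = m + 2 by rw [hN]; push_cast; ring]
  by_cases hx : x = 0
  · subst hx
    have := AA_zero (m := m) (G := G)
    simp only [norm_zero]
    rw [this]; simp
  · have : ‖x‖ ≠ 0 := norm_ne_zero_iff.2 hx
    field_simp
    ring

lemma ww_pos {m : ℕ} (hm : 1 ≤ m) {G u : ℝ → ℝ} (hG : Continuous G) (hu : Continuous u)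
    (h : ∀ r ∈ Icc (0:ℝ) 1, u r = ∫ s in (0:ℝ)..1, hh m (max r s) * s ^ (m + 1) * G s)
    (hG0 : ∀ s ∈ Icc (0:ℝ) 1, 0 ≤ G s) (hne : ∃ r ∈ Icc (0:ℝ) 1, 0 < u r) :
    ∀ r, 0 ≤ r → r < 1 → 0 < ww m G r := by
  obtain ⟨s0, hs0, hGs⟩ : ∃ s ∈ Ioo (0:ℝ) 1, 0 < G s := by
    by_contra hcon
    push Not at hcon
    obtain ⟨r, hr, hur⟩ := hne
    have hz : EqOn G 0 (Icc 0 1) := by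
      have : EqOn G 0 (Ioo 0 1) := fun s hs =>
        le_antisymm (hcon s hs) (hG0 s ⟨hs.1.le, hs.2.le⟩)
      have := this.closure hG continuous_const
      rwa [closure_Ioo (by norm_num)] at this
    have : u r = 0 := by
      rw [h r hr]
      have e : ∫ s in (0:ℝ)..1, hh m (max r s) * s ^ (m + 1) * G s = ∫ s in (0:ℝ)..1, (0:ℝ) := by
        refine intervalIntegral.integral_congr fun s hs => ?_
        rw [uIcc_of_le zero_le_one] at hs
        simp [hz hs]
      rw [e]; simp
    linarith
  have key : ∀ r, 0 < r → r < 1 → 0 < ww m G r := fun r hr hr1 => by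
    rw [← u_eq_ww hm hG hu h r ⟨hr.le, hr1.le⟩, h r ⟨hr.le, hr1.le⟩]
    refine intervalIntegral.integral_pos one_pos ?_ ?_ ⟨s0, ⟨hs0.1.le, hs0.2.le⟩, ?_⟩
    · have hc : Continuous fun s => hh m (max r s) :=
        continuous_iff_continuousAt.2 fun s =>
          ContinuousAt.comp (f := fun s => max r s) (g := hh m)
            (hh_continuousAt hm (lt_max_of_lt_left hr))
            (continuous_const.max continuous_id).continuousAt
      exact ((hc.mul (continuous_pow _)).mul hG).continuousOn
    · intro s hs
      exact mul_nonneg (ker_nonneg hr1.le hs.1 hs.2) (hG0 s ⟨hs.1.le, hs.2⟩)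
    · have := hh_pos hm (lt_max_of_lt_left hr) (max_lt hr1 hs0.2)
      have := hs0.1
      positivity
  intro r hr hr1
  rcases hr.lt_or_eq with h' | h'
  · exact key r h' hr1
  · subst h'
    have hc : Continuous fun s : ℝ => s * AA m G s := continuous_id.mul (AA_cont hG)
    have e : ww m G 0 = (∫ t in (0:ℝ)..(1/2), t * AA m G t) + ww m G (1/2) :=
      (intervalIntegral.integral_add_adjacent_intervals (hc.intervalIntegrable _ _)
        (hc.intervalIntegrable _ _)).symm
    rw [e]
    have h1 := key (1/2) (by norm_num) (by norm_num)
    have h2 : 0 ≤ ∫ t in (0:ℝ)..(1/2), t * AA m G t := by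
      refine intervalIntegral.integral_nonneg (by norm_num) fun t ht => mul_nonneg ht.1 ?_
      refine intervalIntegral.integral_nonneg zero_le_one fun s hs => ?_
      have : 0 ≤ G (t * s) := hG0 _ ⟨mul_nonneg ht.1 hs.1, by nlinarith [ht.1, ht.2, hs.1, hs.2]⟩
      have := hs.1
      positivity
    linarith

theorem stmt_1 (N : ℕ) (hN : 3 ≤ N)
    (k : EuclideanSpace ℝ (Fin N) → ℝ) (f : ℝ → ℝ) (β : ℝ)
    -- (k1)
    (hk_nonneg : ∀ x, 0 ≤ k x)
    (hk_ne : ∃ x ∈ closedBall (0 : EuclideanSpace ℝ (Fin N)) 1, k x ≠ 0)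
    (hk_radial : ∀ x y : EuclideanSpace ℝ (Fin N), ‖x‖ = ‖y‖ → k x = k y)
    (hk_holder : ∃ C α : ℝ≥0, 0 < α ∧ α ≤ 1 ∧
      HolderOnWith C α k (closedBall (0 : EuclideanSpace ℝ (Fin N)) 1))
    -- (k2)
    (hβ : 0 < β)
    (hk2 : ∃ C₀ δ₀ : ℝ, 0 < C₀ ∧ 0 < δ₀ ∧
      ∀ x : EuclideanSpace ℝ (Fin N), ‖x‖ ≤ δ₀ → k x ≤ C₀ * ‖x‖ ^ β)
    -- (k4)
    (hk4 : ∃ x₀ ∈ closedBall (0 : EuclideanSpace ℝ (Fin N)) 1, 0 < k x₀)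
    -- (f1)
    (hf_holder : ∀ a b : ℝ, ∃ C α : ℝ≥0, 0 < α ∧ α ≤ 1 ∧ HolderOnWith C α f (Icc a b))
    (hf_pos : ∀ t : ℝ, 0 < t → 0 ≤ f t)
    (hf_zero : ∀ t : ℝ, t ≤ 0 → f t = 0)
    -- (f2)
    (hf2a : Tendsto (fun t => f t / t) (nhdsWithin 0 (Ioi 0)) (nhds 0))
    (hf2b : Tendsto (fun t => f t / t ^ (((N : ℝ) + 2 + 2 * β) / ((N : ℝ) - 2)))
      atTop (nhds 0))
    -- (f3)
    (hf3 : ∃ θ : ℝ, 2 < θ ∧ ∀ t : ℝ, 0 ≤ t → θ * (∫ s in (0:ℝ)..t, f s) ≤ t * f t)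
    -- (f5)
    (hf5 : ∃ c : ℝ, 0 < c ∧ ∀ t ∈ Ioo (0:ℝ) c, 0 < f t) :
    ∃ lamstar : ℝ, 0 < lamstar ∧ ∀ lam : ℝ, lamstar < lam →
      ∃ u : EuclideanSpace ℝ (Fin N) → ℝ,
        (∀ x y : EuclideanSpace ℝ (Fin N), ‖x‖ = ‖y‖ → u x = u y) ∧
        ContinuousOn u (closedBall 0 1) ∧
        ContDiffOn ℝ 2 u (ball 0 1) ∧
        (∀ x ∈ ball (0 : EuclideanSpace ℝ (Fin N)) 1, 0 < u x) ∧
        (∀ x ∈ sphere (0 : EuclideanSpace ℝ (Fin N)) 1, u x = 0) ∧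
        (∀ x ∈ ball (0 : EuclideanSpace ℝ (Fin N)) 1,
          -laplacian u x = u x ^ (((N : ℝ) + 2) / ((N : ℝ) - 2)) + lam * k x * f (u x)) := by
  obtain ⟨m, hNm⟩ : ∃ m, N = m + 2 := ⟨N - 2, by omega⟩
  have hm : 1 ≤ m := by omega
  have hm' : (0:ℝ) < m := by exact_mod_cast hm
  have hNr : (N:ℝ) = m + 2 := by rw [hNm]; push_cast; ring
  have ep : ((N:ℝ) + 2) / ((N:ℝ) - 2) = 1 + 2 * 2 / m := by
    rw [hNr, add_sub_cancel_right]; field_simp; ring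
  have eq : ((N:ℝ) + 2 + 2 * β) / ((N:ℝ) - 2) = 1 + 2 * (2 + β) / m := by
    rw [hNr, add_sub_cancel_right]; field_simp; ring
  rw [eq] at hf2b
  rw [ep]
  have hp0 : (0:ℝ) < 1 + 2 * 2 / m := by positivity
  -- f
  have hfc : Continuous f := continuous_iff_continuousAt.2 fun t => by
    obtain ⟨C, α, hα, -, h⟩ := hf_holder (t - 1) (t + 1)
    exact (h.continuousOn hα).continuousAt (Icc_mem_nhds (by linarith) (by linarith))
  have hfn : ∀ t, 0 ≤ f t := fun t => by
    rcases le_or_gt t 0 with h | h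
    · rw [hf_zero t h]
    · exact hf_pos t h
  -- K
  have i0 : Fin N := ⟨0, by omega⟩
  let P : ℝ → ℝ := fun r => (projIcc (0:ℝ) 1 zero_le_one r : ℝ)
  have hP : ∀ r, P r ∈ Icc (0:ℝ) 1 := fun r => (projIcc (0:ℝ) 1 zero_le_one r).2
  have hPc : Continuous P := continuous_subtype_val.comp continuous_projIcc
  have hPe : ∀ r ∈ Icc (0:ℝ) 1, P r = r := fun r hr => by
    simp only [P, projIcc_of_mem zero_le_one hr]
  let K : ℝ → ℝ := fun r => k (EuclideanSpace.single i0 (P r))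
  have hnorm : ∀ r, ‖(EuclideanSpace.single i0 (P r) : EuclideanSpace ℝ (Fin N))‖ = P r := fun r => by
    rw [EuclideanSpace.norm_single, Real.norm_of_nonneg (hP r).1]
  have hKk : ∀ x : EuclideanSpace ℝ (Fin N), ‖x‖ ≤ 1 → K ‖x‖ = k x := fun x hx =>
    hk_radial _ _ (by rw [hnorm, hPe _ ⟨norm_nonneg x, hx⟩])
  have hKc : Continuous K := by
    obtain ⟨C, α, hα, -, h⟩ := hk_holder
    refine (h.continuousOn hα).comp_continuous ?_ fun r => ?_
    · have : Continuous fun t : ℝ => (EuclideanSpace.single i0 t : EuclideanSpace ℝ (Fin N)) := by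
        refine (PiLp.continuous_toLp 2 _).comp ?_
        exact continuous_single (A := fun _ : Fin N => ℝ) i0
      exact this.comp hPc
    · rw [mem_closedBall_zero_iff, hnorm]; exact (hP r).2
  have hK0 : ∀ r, 0 ≤ K r := fun r => hk_nonneg _
  obtain ⟨C1, hC1, hK⟩ : ∃ C1 > 0, ∀ r, 0 < r → r ≤ 1 → K r ≤ C1 * r ^ β := by
    obtain ⟨C₀, δ, hC₀, hδ, h⟩ := hk2
    obtain ⟨M, hM⟩ := (isCompact_Icc (a := (0:ℝ)) (b := 1)).bddAbove_image hKc.continuousOn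
    have hδβ : 0 < δ ^ β := Real.rpow_pos_of_pos hδ β
    refine ⟨C₀ + |M| / δ ^ β, by positivity, fun r hr hr1 => ?_⟩
    have hrβ : 0 < r ^ β := Real.rpow_pos_of_pos hr β
    have hPr := hPe r ⟨hr.le, hr1⟩
    have h0 : 0 ≤ |M| / δ ^ β * r ^ β := by positivity
    rcases le_or_gt r δ with h' | h'
    · have := h (EuclideanSpace.single i0 (P r)) (by rw [hnorm, hPr]; exact h')
      rw [hnorm, hPr] at this
      have e : K r = k (EuclideanSpace.single i0 r) := by simp only [K, hPr]
      rw [e]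
      linarith
    · have h1 := hM (mem_image_of_mem K ⟨hr.le, hr1⟩)
      have h2 : |M| ≤ |M| / δ ^ β * r ^ β := by
        rw [div_mul_eq_mul_div, le_div_iff₀ hδβ]
        have : δ ^ β ≤ r ^ β := Real.rpow_le_rpow hδ.le h'.le hβ.le
        gcongr
      have := le_abs_self M
      nlinarith [mul_pos hC₀ hrβ]
  obtain ⟨s1, s2, κ, hs1, hs12, hs2, hκ, hKκ⟩ : ∃ s1 s2 κ : ℝ, 0 < s1 ∧ s1 < s2 ∧ s2 < 1 ∧ 0 < κ ∧
      ∀ r, s1 ≤ r → r ≤ s2 → κ ≤ K r := by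
    obtain ⟨x0, hx0, hk0⟩ := hk4
    rw [mem_closedBall_zero_iff] at hx0
    have hKx : 0 < K ‖x0‖ := by rw [hKk x0 hx0]; exact hk0
    have hmem : ‖x0‖ ∈ closure (Ioo (0:ℝ) 1) := by
      rw [closure_Ioo (by norm_num)]; exact ⟨norm_nonneg _, hx0⟩
    have hopen : IsOpen {r | 0 < K r} := isOpen_lt continuous_const hKc
    obtain ⟨ρ, hρK, hρ⟩ := mem_closure_iff.1 hmem _ hopen hKx
    simp only [mem_setOf_eq] at hρK
    have hev : ∀ᶠ r in nhds ρ, K ρ / 2 < K r ∧ r ∈ Ioo (0:ℝ) 1 :=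
      ((hKc.tendsto ρ).eventually_const_lt (by linarith)).and (Ioo_mem_nhds hρ.1 hρ.2)
    obtain ⟨e, he, hball⟩ := Metric.eventually_nhds_iff.1 hev
    have hin : ∀ r, |r - ρ| < e → K ρ / 2 < K r ∧ r ∈ Ioo (0:ℝ) 1 := fun r hr =>
      hball (by rw [Real.dist_eq]; exact hr)
    refine ⟨ρ, ρ + e / 2, K ρ / 2, hρ.1, by linarith, ?_, by linarith, fun r h1 h2 => ?_⟩
    · exact (hin (ρ + e/2) (by rw [abs_lt]; constructor <;> linarith)).2.2
    · exact (hin r (by rw [abs_lt]; constructor <;> linarith)).1.le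
  obtain ⟨ls, hls, hmain⟩ := radial_exists hm hβ hC1 hKc hK0 hK hs1 hs12 hs2 hκ hKκ hfc hfn
    hf_zero hf2a hf2b hf3 hf5
  refine ⟨ls, hls, fun lam hlam => ?_⟩
  obtain ⟨m0, hm0, u, huc, hu0, ⟨rm, hrm, hurm⟩, hu⟩ := hmain lam hlam
  have hlp : 0 < lam := hls.trans hlam
  set G : ℝ → ℝ := fun s => gg (1 + 2 * 2 / m) lam K f s (u s) with hGdef
  have hGc : Continuous G := (gg_cont hp0.le hKc hfc).comp (continuous_id.prodMk huc)
  have hG0 : ∀ s ∈ Icc (0:ℝ) 1, 0 ≤ G s := fun s _ => gg_nonneg hlp.le hK0 hfn _ _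
  have huw := u_eq_ww hm hGc huc hu
  have hpos := ww_pos hm hGc huc hu hG0 ⟨rm, hrm, hm0.trans_le hurm⟩
  have hC2 : ContDiff ℝ 2 fun y : EuclideanSpace ℝ (Fin N) => ww m G ‖y‖ :=
    rad_contDiff (AA_cont (m := m) hGc) hGc AA_zero (AA_deriv hGc) (ww_deriv hGc)
  refine ⟨fun y => ww m G ‖y‖, fun x y h => by simp only [h], hC2.continuous.continuousOn,
    hC2.contDiffOn, fun x hx => ?_, fun x hx => ?_, fun x hx => ?_⟩
  · rw [mem_ball_zero_iff] at hx
    exact hpos _ (norm_nonneg x) hx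
  · rw [mem_sphere_zero_iff_norm] at hx
    simp [hx, ww]
  · rw [mem_ball_zero_iff] at hx
    have hxI : ‖x‖ ∈ Icc (0:ℝ) 1 := ⟨norm_nonneg x, hx.le⟩
    rw [lap_rad hNm hGc x]
    beta_reduce
    rw [← huw _ hxI]
    simp only [hGdef, gg]
    rw [max_eq_left (hu0 _ hxI), hKk x hx.le]
end

section
/- Let N ≥ 3, let B be the open unit ball in ℝ^N, let β ≥ 0, let q be a real number with 1 ≤ q ≤ (2β+N+2)/(N−2), and let λ ≤ 0. Then there is no function u that is continuously differentiable on the closed unit ball and twice continuously differentiable on B, with u > 0 in B and u = 0 on the unit sphere, satisfying −Δu(x) = u(x)^((N+2)/(N−2)) + λ·|x|^β·u(x)^q for all x ∈ B. -/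
open scoped NNReal
open MeasureTheory Filter Set Metric

lemma second_deriv_nonneg (f f' : ℝ → ℝ) (f'' : ℝ) (h1 : ∀ᶠ t in nhds (0:ℝ), HasDerivAt f (f' t) t)
    (h2 : HasDerivAt f' f'' 0) (hm : IsLocalMin f 0) : 0 ≤ f'' := by
  by_contra hneg
  push Not at hneg
  have e1 : deriv f =ᶠ[nhds 0] f' := h1.mono fun t ht => ht.deriv
  have hd2 : deriv (deriv f) 0 = f'' := by
    rw [e1.deriv_eq]; exact h2.deriv
  have hd1 : deriv f 0 = 0 := hm.deriv_eq_zero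
  have hmax := isLocalMax_of_deriv_deriv_neg (by rw [hd2]; exact hneg) hd1
    h1.self_of_nhds.continuousAt
  have hc : f =ᶠ[nhds 0] fun _ => f 0 := by
    filter_upwards [hm, hmax] with t a b
    exact le_antisymm b a
  have : deriv (deriv f) 0 = 0 := by
    rw [hc.deriv.deriv_eq]; simp
  linarith

lemma int_zero {E : Type*} [NormedAddCommGroup E] [NormedSpace ℝ E] [FiniteDimensional ℝ E]
    [MeasurableSpace E] [BorelSpace E] (μ : Measure E) [μ.IsAddHaarMeasure]
    (g : E → ℝ) (hg : ContDiff ℝ 1 g) (hc : HasCompactSupport g) (v : E) :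
    ∫ x, fderiv ℝ g x v ∂μ = 0 := by
  have h := integral_mul_fderiv_eq_neg_fderiv_mul_of_integrable (μ := μ) (𝕜 := ℝ)
    (f := fun _ : E => (1:ℝ)) (g := g) (v := v) (by simp) ?_ ?_ (by simp) ?_
  · simpa using h
  · simp only [one_mul]
    exact ((hg.continuous_fderiv one_ne_zero).clm_apply continuous_const).integrable_of_hasCompactSupport
      (hc.fderiv_apply (𝕜 := ℝ) v)
  · simp only [one_mul]
    exact hg.continuous.integrable_of_hasCompactSupport hc
  · intro x _; exact hg.differentiable one_ne_zero x

lemma k_contDiff {N : ℕ} (β : ℝ) (hβ : 0 ≤ β) (i : Fin N) :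
    ContDiff ℝ 1 (fun x : EuclideanSpace ℝ (Fin N) => ‖x‖ ^ β * x i) ∧
    ∀ x : EuclideanSpace ℝ (Fin N), fderiv ℝ (fun x : EuclideanSpace ℝ (Fin N) => ‖x‖ ^ β * x i) x
      (EuclideanSpace.single i 1) = ‖x‖ ^ β + β * ‖x‖ ^ (β - 2) * x i ^ 2 := by
  have key : ∀ x : EuclideanSpace ℝ (Fin N),
      HasFDerivAt (fun x : EuclideanSpace ℝ (Fin N) => ‖x‖ ^ β * x i)
      (‖x‖ ^ β • (EuclideanSpace.proj i : EuclideanSpace ℝ (Fin N) →L[ℝ] ℝ)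
        + (β * ‖x‖ ^ (β - 2) * x i) • innerSL ℝ x) x := by
    intro x
    have hp : HasFDerivAt (fun x : EuclideanSpace ℝ (Fin N) => x i)
      (EuclideanSpace.proj i : EuclideanSpace ℝ (Fin N) →L[ℝ] ℝ) x :=
      (EuclideanSpace.proj i : EuclideanSpace ℝ (Fin N) →L[ℝ] ℝ).hasFDerivAt
    rcases hβ.eq_or_lt with rfl | hβ
    · simpa using hp
    by_cases hx : x = 0
    · subst hx
      simp only [norm_zero, Real.zero_rpow hβ.ne', zero_smul, map_zero, smul_zero, add_zero]
      refine .of_isLittleO ?_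
      simp only [sub_zero, norm_zero, Real.zero_rpow hβ.ne', zero_mul, zero_apply]
      have h1 : (fun x : EuclideanSpace ℝ (Fin N) => ‖x‖ ^ β) =o[nhds 0] fun _ => (1:ℝ) := by
        rw [Asymptotics.isLittleO_one_iff]
        have : Continuous (fun x : EuclideanSpace ℝ (Fin N) => ‖x‖ ^ β) :=
          continuous_norm.rpow_const (fun _ => Or.inr hβ.le)
        have h := this.tendsto 0
        simpa [Real.zero_rpow hβ.ne'] using h
      have h2 : (fun x : EuclideanSpace ℝ (Fin N) => x i) =O[nhds 0] fun x => x := by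
        exact ((EuclideanSpace.proj i : EuclideanSpace ℝ (Fin N) →L[ℝ] ℝ).isBigO_id _)
      have h3 := h1.mul_isBigO h2.norm_right
      simp only [one_mul] at h3
      exact h3.norm_right.of_norm_right.congr_right (fun x => by simp) |>.of_norm_right
    · have hn : HasFDerivAt (fun x : EuclideanSpace ℝ (Fin N) => ‖x‖ ^ β)
          ((β * ‖x‖ ^ (β - 2)) • innerSL ℝ x) x := by
        apply HasStrictFDerivAt.hasFDerivAt
        convert! (hasStrictFDerivAt_norm_sq x).rpow_const (p := β / 2) (by simp [hx]) using 0
        simp_rw [← Real.rpow_natCast_mul (norm_nonneg _), ← Nat.cast_smul_eq_nsmul ℝ, smul_smul]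
        ring_nf
      refine (hn.mul hp).congr_fderiv ?_
      rw [smul_smul, mul_comm (x i)]
  constructor
  · rw [contDiff_one_iff_hasFDerivAt]
    refine ⟨_, ?_, key⟩
    rcases hβ.eq_or_lt with rfl | hβ
    · simpa using continuous_const
    refine Continuous.add ?_ ?_
    · exact (continuous_norm.rpow_const (fun _ => Or.inr hβ.le)).smul continuous_const
    · rw [continuous_iff_continuousAt]
      intro x
      by_cases hx : x = 0
      · subst hx
        have h0 : Tendsto (fun x : EuclideanSpace ℝ (Fin N) => β * ‖x‖ ^ β) (nhds 0) (nhds 0) := by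
          have : Continuous (fun x : EuclideanSpace ℝ (Fin N) => β * ‖x‖ ^ β) :=
            continuous_const.mul (continuous_norm.rpow_const (fun _ => Or.inr hβ.le))
          have h := this.tendsto 0
          simpa [Real.zero_rpow hβ.ne'] using h
        unfold ContinuousAt
        simp only [map_zero, smul_zero]
        refine squeeze_zero_norm (fun y => ?_) h0
        by_cases hy : y = 0
        · subst hy; simp [Real.zero_rpow hβ.ne']
        have hy' : 0 < ‖y‖ := norm_pos_iff.2 hy
        rw [norm_smul, innerSL_apply_norm, norm_mul, norm_mul, Real.norm_of_nonneg hβ.le,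
          Real.norm_of_nonneg (by positivity)]
        have h1 : ‖y i‖ ≤ ‖y‖ := PiLp.norm_apply_le y i
        have h2 : ‖y‖ ^ β = ‖y‖ ^ (β - 2) * ‖y‖ * ‖y‖ := by
          rw [Real.rpow_sub hy']; simp; field_simp
        rw [h2]
        have : 0 ≤ β * ‖y‖ ^ (β - 2) * ‖y‖ := by positivity
        nlinarith [mul_le_mul_of_nonneg_left h1 this]
      · refine ContinuousAt.fun_smul (ContinuousAt.fun_mul (ContinuousAt.fun_mul continuousAt_const ?_) ?_) ?_
        · exact continuousAt_id.norm.rpow_const (Or.inl (by simpa using hx))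
        · exact (EuclideanSpace.proj i : EuclideanSpace ℝ (Fin N) →L[ℝ] ℝ).continuous.continuousAt
        · exact (innerSL ℝ).continuous.continuousAt
  · intro x
    rw [(key x).fderiv]
    simp [EuclideanSpace.inner_single_right]
    ring

lemma line_hasDerivAt {N : ℕ} (f : EuclideanSpace ℝ (Fin N) → ℝ) (x v : EuclideanSpace ℝ (Fin N))
    (t : ℝ) (h : DifferentiableAt ℝ f (x + t • v)) :
    HasDerivAt (fun s : ℝ => f (x + s • v)) (fderiv ℝ f (x + t • v) v) t := by
  have h1 : HasDerivAt (fun s : ℝ => x + s • v) v t := by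
    simpa using ((hasDerivAt_id t).smul_const v).const_add x
  exact h.hasFDerivAt.comp_hasDerivAt t h1

lemma norm_sq_line {N : ℕ} (x : EuclideanSpace ℝ (Fin N)) (i : Fin N) (t : ℝ) :
    ‖x + t • EuclideanSpace.single i (1:ℝ)‖ ^ 2 = ‖x‖ ^ 2 + 2 * x i * t + t ^ 2 := by
  rw [norm_add_sq_real, norm_smul, inner_smul_right]
  simp [EuclideanSpace.inner_single_right]
  ring

lemma coord_line {N : ℕ} (x : EuclideanSpace ℝ (Fin N)) (i j : Fin N) (t : ℝ) :
    (x + t • EuclideanSpace.single i (1:ℝ)) j = x j + t * (if j = i then 1 else 0) := by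
  simp

/-- local facts about u in the ball -/
lemma grad_contDiffOn {N : ℕ} (u : EuclideanSpace ℝ (Fin N) → ℝ)
    (h2 : ContDiffOn ℝ 2 u (ball 0 1)) (v : EuclideanSpace ℝ (Fin N)) :
    ContDiffOn ℝ 1 (fun y => fderiv ℝ u y v) (ball 0 1) := by
  have : ContDiffOn ℝ 1 (fderiv ℝ u) (ball 0 1) :=
    h2.fderiv_of_isOpen isOpen_ball (by norm_num)
  exact this.clm_apply contDiffOn_const

lemma hopf_arith (N C K s s₀ : ℝ) (hN : 3 ≤ N) (hC0 : 0 ≤ C) (hK : K = N + C + 1)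
    (hsp : 0 < s) (hss : s < s₀) (hsN : s₀ * (N + 2) ≤ 1) (hsC : s₀ * (C + 1) ≤ 1) (hs1 : s₀ < 1)
    (hb5 : -2 * N * (1 + 2 * K * s) + 8 * K * (1 - s) < C * (s + K * s ^ 2)) : False := by
  have hK0 : 0 < K := by linarith
  have c1 : s * (N + 2) ≤ 1 := le_trans (mul_le_mul_of_nonneg_right hss.le (by linarith)) hsN
  have c2 : s * (C + 1) ≤ 1 := le_trans (mul_le_mul_of_nonneg_right hss.le (by linarith)) hsC
  have c2' : s * C ≤ 1 := by linarith
  have c3 : K * (s * (N + 2)) ≤ K * 1 := mul_le_mul_of_nonneg_left c1 hK0.le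
  have c4 : (s * C) * (K * s) ≤ 1 * (K * s) := mul_le_mul_of_nonneg_right c2' (by positivity)
  have c5 : K * s ≤ K * 1 := mul_le_mul_of_nonneg_left (by linarith) hK0.le
  have e1 : -2 * N * (1 + 2 * K * s) + 8 * K * (1 - s) = -2 * N + 8 * K - 4 * (K * (s * (N + 2))) := by
    ring
  have e2 : C * (s + K * s ^ 2) = s * C + (s * C) * (K * s) := by ring
  rw [e1, e2] at hb5
  linarith

set_option maxHeartbeats 1000000 in
lemma hopf_bound {N : ℕ} (hN : 3 ≤ N) (β q lam : ℝ) (hβ : 0 ≤ β)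
    (hq1 : 1 ≤ q) (hlam : lam ≤ 0) (u : EuclideanSpace ℝ (Fin N) → ℝ) (p : ℝ)
    (h1 : ContDiffOn ℝ 1 u (closedBall 0 1))
    (h2 : ContDiffOn ℝ 2 u (ball 0 1))
    (hpos : ∀ x ∈ ball (0 : EuclideanSpace ℝ (Fin N)) 1, 0 < u x)
    (hbd : ∀ x ∈ sphere (0 : EuclideanSpace ℝ (Fin N)) 1, u x = 0)
    (heq : ∀ x ∈ ball (0 : EuclideanSpace ℝ (Fin N)) 1,
        -laplacian u x = u x ^ p + lam * ‖x‖ ^ β * u x ^ q) :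
    ∃ ε > 0, ∃ s₀ > 0, s₀ < 1 ∧ ∀ x : EuclideanSpace ℝ (Fin N), ‖x‖ ≤ 1 → 1 - s₀ ≤ ‖x‖ ^ 2 →
      ε * (1 - ‖x‖ ^ 2) ≤ u x := by
  have hcont : ContinuousOn u (closedBall 0 1) := h1.continuousOn
  have hNpos : (3:ℝ) ≤ N := by exact_mod_cast hN
  obtain ⟨M, hM⟩ := (isCompact_closedBall (0:EuclideanSpace ℝ (Fin N)) 1).bddAbove_image hcont
  have hM' : ∀ x : EuclideanSpace ℝ (Fin N), ‖x‖ ≤ 1 → u x ≤ M := fun x hx =>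
    hM ⟨x, by simpa using hx, rfl⟩
  set C : ℝ := -lam * M ^ (q - 1) with hC
  have hM0 : 0 < M := lt_of_lt_of_le (hpos 0 (by simp)) (hM' 0 (by simp))
  have hC0 : 0 ≤ C := mul_nonneg (by linarith) (by positivity)
  set K : ℝ := N + C + 1 with hK
  set s₀ : ℝ := min (1 / ((N:ℝ) + 2)) (1 / (C + 1)) with hs
  have hs0 : 0 < s₀ := by positivity
  have hsN : s₀ * (N + 2) ≤ 1 := by
    have := min_le_left (1 / ((N:ℝ) + 2)) (1 / (C + 1))
    rw [← hs, le_div_iff₀ (by positivity)] at this; exact this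
  have hsC : s₀ * (C + 1) ≤ 1 := by
    have := min_le_right (1 / ((N:ℝ) + 2)) (1 / (C + 1))
    rw [← hs, le_div_iff₀ (by positivity)] at this; exact this
  have hs1 : s₀ < 1 := by nlinarith
  -- minimum on the inner sphere
  have hin : ∃ m > 0, ∀ x : EuclideanSpace ℝ (Fin N), ‖x‖ ^ 2 = 1 - s₀ → m ≤ u x := by
    set r := Real.sqrt (1 - s₀) with hr
    have hr1 : r < 1 := by
      rw [hr, Real.sqrt_lt' one_pos]; linarith
    have hsub : closedBall (0:EuclideanSpace ℝ (Fin N)) r ⊆ ball 0 1 := closedBall_subset_ball hr1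
    obtain ⟨y, hy, hmin⟩ := (isCompact_closedBall (0:EuclideanSpace ℝ (Fin N)) r).exists_isMinOn
      ⟨0, by simp [hr]⟩ (hcont.mono (hsub.trans ball_subset_closedBall))
    refine ⟨u y, hpos y (hsub hy), fun x hx => hmin ?_⟩
    simp only [mem_closedBall, dist_zero_right]
    rw [hr, ← hx]; simp
  obtain ⟨m, hm, hmle⟩ := hin
  set ε : ℝ := m / (s₀ + K * s₀ ^ 2) with hε
  have hK0 : 0 < K := by positivity
  have hden : 0 < s₀ + K * s₀ ^ 2 := by positivity
  have hε0 : 0 < ε := by positivity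
  refine ⟨ε, hε0, s₀, hs0, hs1, ?_⟩
  set w : EuclideanSpace ℝ (Fin N) → ℝ := fun x =>
    u x - ε * ((1 - ‖x‖ ^ 2) + K * (1 - ‖x‖ ^ 2) ^ 2) with hw
  set A : Set (EuclideanSpace ℝ (Fin N)) := closedBall 0 1 ∩ {x | 1 - s₀ ≤ ‖x‖ ^ 2} with hA
  have hAc : IsCompact A := (isCompact_closedBall _ _).inter_right
    (isClosed_le continuous_const (by fun_prop))
  suffices hmain : ∀ x ∈ A, 0 ≤ w x by
    intro x hx hx2
    have := hmain x ⟨by simpa using hx, hx2⟩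
    simp only [hw] at this
    have h3 : 0 ≤ ε * (K * (1 - ‖x‖ ^ 2) ^ 2) := by positivity
    nlinarith
  by_contra hcon
  push Not at hcon
  obtain ⟨x₁, hx₁, hw₁⟩ := hcon
  have hwc : ContinuousOn w A := by
    refine (hcont.mono inter_subset_left).sub ?_
    exact Continuous.continuousOn (by fun_prop)
  obtain ⟨x, hxA, hmin⟩ := hAc.exists_isMinOn ⟨x₁, hx₁⟩ hwc
  have hwx : w x < 0 := lt_of_le_of_lt (hmin hx₁) hw₁
  have hxn : ‖x‖ ≤ 1 := by simpa using hxA.1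
  have hx2 : 1 - s₀ ≤ ‖x‖ ^ 2 := hxA.2
  have hxlt : ‖x‖ < 1 := by
    rcases hxn.eq_or_lt with h | h
    · exfalso
      have := hbd x (by simpa using h)
      simp [hw, h, this] at hwx
    · exact h
  have hx2lt : 1 - s₀ < ‖x‖ ^ 2 := by
    rcases hx2.eq_or_lt with h | h
    · exfalso
      have h3 := hmle x h.symm
      have h4 : ε * (s₀ + K * s₀ ^ 2) = m := by rw [hε]; field_simp
      have h5 : 1 - ‖x‖ ^ 2 = s₀ := by linarith
      simp only [hw, h5] at hwx
      linarith
    · exact h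
  have hxb : x ∈ ball (0:EuclideanSpace ℝ (Fin N)) 1 := by simpa using hxlt
  have hopen : IsOpen (ball (0:EuclideanSpace ℝ (Fin N)) 1 ∩ {x | 1 - s₀ < ‖x‖ ^ 2}) :=
    isOpen_ball.inter (isOpen_lt continuous_const (by fun_prop))
  have hloc : IsLocalMin w x := by
    filter_upwards [hopen.mem_nhds ⟨hxb, hx2lt⟩] with y hy
    exact hmin ⟨ball_subset_closedBall hy.1, (show 1 - s₀ < ‖y‖ ^ 2 from hy.2).le⟩
  set s : ℝ := 1 - ‖x‖ ^ 2 with hsdef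
  have hsec : ∀ i, ε * (-2 * (1 + 2 * K * s) + 8 * K * x i ^ 2) ≤
      fderiv ℝ (fun y => fderiv ℝ u y (EuclideanSpace.single i (1:ℝ))) x
      (EuclideanSpace.single i (1:ℝ)) := by
    intro i
    set e : EuclideanSpace ℝ (Fin N) := EuclideanSpace.single i (1:ℝ) with he
    have hlin : Continuous (fun t : ℝ => x + t • e) := by fun_prop
    have hev : ∀ᶠ t in nhds (0:ℝ), x + t • e ∈ ball (0:EuclideanSpace ℝ (Fin N)) 1 := by
      apply hlin.continuousAt.eventually_mem
      simpa using isOpen_ball.mem_nhds hxb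
    have hsl : ∀ t : ℝ, HasDerivAt (fun t : ℝ => 1 - (‖x‖ ^ 2 + 2 * x i * t + t ^ 2))
        (-(2 * x i + 2 * t)) t := by
      intro t
      have := ((((hasDerivAt_id t).const_mul (2 * x i)).const_add (‖x‖ ^ 2)).add
        ((hasDerivAt_id t).pow 2)).const_sub 1
      convert! this using 1
      simp
    have := second_deriv_nonneg (fun t => w (x + t • e))
      (fun t => fderiv ℝ u (x + t • e) e - ε * (-(2 * x i + 2 * t) +
        K * (2 * (1 - (‖x‖ ^ 2 + 2 * x i * t + t ^ 2)) * (-(2 * x i + 2 * t)))))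
      (fderiv ℝ (fun y => fderiv ℝ u y e) x e - ε * (-2 * (1 + 2 * K * s) + 8 * K * x i ^ 2))
      ?_ ?_ ?_
    · linarith
    · filter_upwards [hev] with t ht
      have hd := line_hasDerivAt u x e t ((h2.differentiableOn (by norm_num)).differentiableAt
        (isOpen_ball.mem_nhds ht))
      have h3 := hd.sub (((hsl t).add (((hsl t).pow 2).const_mul K)).const_mul ε)
      convert! h3 using 1
      · ext t
        simp only [hw, he, norm_sq_line]
        rfl
      · simp
    · have hd := line_hasDerivAt (fun y => fderiv ℝ u y e) x e 0 (by
        simpa using ((grad_contDiffOn u h2 e).differentiableOn (by norm_num)).differentiableAt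
          (isOpen_ball.mem_nhds hxb))
      have hl : HasDerivAt (fun t : ℝ => -(2 * x i + 2 * t)) (-2) 0 := by
        have := (((hasDerivAt_id (0:ℝ)).const_mul 2).const_add (2 * x i)).neg
        convert! this using 1
        simp
      have h3 := hd.sub ((hl.add ((((hsl 0).const_mul 2).mul hl).const_mul K)).const_mul ε)
      convert! h3 using 1
      simp only [zero_smul, add_zero, hsdef]
      ring
    · have hloc' : IsLocalMin w (x + (0:ℝ) • e) := by simpa using hloc
      exact IsLocalMin.comp_continuous (g := fun t : ℝ => x + t • e) hloc' hlin.continuousAt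
  have hlap : ε * (-2 * N * (1 + 2 * K * s) + 8 * K * ‖x‖ ^ 2) ≤ laplacian u x := by
    unfold laplacian
    refine le_trans (le_of_eq ?_) (Finset.sum_le_sum fun i _ => hsec i)
    rw [← Finset.mul_sum, Finset.sum_add_distrib, ← Finset.mul_sum, EuclideanSpace.norm_sq_eq]
    simp only [Real.norm_eq_abs, sq_abs, Finset.sum_const, Finset.card_univ, Fintype.card_fin,
      nsmul_eq_mul, Finset.mul_sum]
    ring
  have hu := hpos x hxb
  have hq : u x ^ q = u x ^ (q - 1) * u x := by
    rw [← Real.rpow_add_one hu.ne']; ring_nf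
  have hup : 0 < u x ^ p := by positivity
  have hPDE := heq x hxb
  have hrβ : ‖x‖ ^ β ≤ 1 := Real.rpow_le_one (norm_nonneg _) hxn hβ
  have huq : u x ^ (q - 1) ≤ M ^ (q - 1) :=
    Real.rpow_le_rpow hu.le (hM' x hxn) (by linarith)
  have hb : -lam * (‖x‖ ^ β * u x ^ (q-1)) ≤ C := by
    rw [hC]
    apply mul_le_mul_of_nonneg_left _ (by linarith)
    calc ‖x‖ ^ β * u x ^ (q-1) ≤ 1 * M ^ (q-1) := by gcongr
      _ = _ := one_mul _
  have hb2 : laplacian u x < C * u x := by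
    have := mul_le_mul_of_nonneg_right hb hu.le
    rw [hq] at hPDE
    nlinarith
  have hss : s < s₀ := by rw [hsdef]; linarith
  have hsp : 0 < s := by rw [hsdef]; nlinarith [norm_nonneg x]
  have hb3 : u x < ε * (s + K * s ^ 2) := by
    simp only [hw] at hwx; linarith
  have hb4 : ε * (-2 * N * (1 + 2 * K * s) + 8 * K * ‖x‖ ^ 2) < ε * (C * (s + K * s ^ 2)) := by
    have := mul_le_mul_of_nonneg_left hb3.le hC0
    have e : ε * (C * (s + K * s ^ 2)) = C * (ε * (s + K * s ^ 2)) := by ring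
    rw [e]
    linarith
  have hb5 := lt_of_mul_lt_mul_left hb4 hε0.le
  have hx2' : ‖x‖ ^ 2 = 1 - s := by rw [hsdef]; ring
  rw [hx2'] at hb5
  exact hopf_arith N C K s s₀ hNpos hC0 hK hsp hss hsN hsC hs1 hb5

lemma tang_zero {N : ℕ} (u : EuclideanSpace ℝ (Fin N) → ℝ)
    (h1 : ContDiffOn ℝ 1 u (closedBall 0 1))
    (hbd : ∀ x ∈ sphere (0 : EuclideanSpace ℝ (Fin N)) 1, u x = 0)
    (x y : EuclideanSpace ℝ (Fin N)) (hx : ‖x‖ = 1) (hxy : inner ℝ x y = 0) :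
    fderivWithin ℝ u (closedBall 0 1) x y = 0 := by
  by_cases hy : y = 0
  · simp [hy]
  have hy0 : ‖y‖ ≠ 0 := by simpa using hy
  set z : EuclideanSpace ℝ (Fin N) := ‖y‖⁻¹ • y with hz
  have hzn : ‖z‖ = 1 := by simp [hz, norm_smul, hy0]
  have hxz : inner ℝ x z = 0 := by simp [hz, inner_smul_right, hxy]
  have hyz : y = ‖y‖ • z := by simp [hz, smul_smul, hy0]
  suffices h : fderivWithin ℝ u (closedBall 0 1) x z = 0 by rw [hyz, map_smul, h, smul_zero]
  set c : ℝ → EuclideanSpace ℝ (Fin N) := fun t => Real.cos t • x + Real.sin t • z with hc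
  have hcn : ∀ t, ‖c t‖ = 1 := by
    intro t
    have : ‖c t‖ ^ 2 = 1 := by
      simp only [hc]
      rw [norm_add_sq_real, norm_smul, norm_smul, inner_smul_left, inner_smul_right, hxz, hx, hzn]
      simp
    exact (pow_eq_one_iff_of_nonneg (norm_nonneg _) two_ne_zero).1 this
  have hc0 : c 0 = x := by simp [hc]
  have hcd : HasDerivAt c z 0 := by
    have := ((Real.hasDerivAt_cos 0).smul_const x).add ((Real.hasDerivAt_sin 0).smul_const z)
    convert! this using 1
    simp
  have hf : HasFDerivWithinAt u (fderivWithin ℝ u (closedBall 0 1) x) (closedBall 0 1) (c 0) := by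
    rw [hc0]
    exact ((h1.differentiableOn one_ne_zero) x (by simp [hx])).hasFDerivWithinAt
  have hcomp := hf.comp_hasDerivAt (0:ℝ) hcd (Eventually.of_forall fun t => by simp [hcn t])
  have hz0 : u ∘ c = fun _ => 0 := by
    ext t; exact hbd _ (by simp [hcn t])
  rw [hz0] at hcomp
  exact hcomp.unique (hasDerivAt_const _ _)

lemma radial_neg {N : ℕ} (u : EuclideanSpace ℝ (Fin N) → ℝ)
    (h1 : ContDiffOn ℝ 1 u (closedBall 0 1))
    (hbd : ∀ x ∈ sphere (0 : EuclideanSpace ℝ (Fin N)) 1, u x = 0)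
    (ε s₀ : ℝ) (hε : 0 < ε) (hs0 : 0 < s₀) 
    (hu : ∀ x : EuclideanSpace ℝ (Fin N), ‖x‖ ≤ 1 → 1 - s₀ ≤ ‖x‖ ^ 2 → ε * (1 - ‖x‖ ^ 2) ≤ u x)
    (x : EuclideanSpace ℝ (Fin N)) (hx : ‖x‖ = 1) :
    fderivWithin ℝ u (closedBall 0 1) x x ≠ 0 := by
  intro h0
  set c : ℝ → EuclideanSpace ℝ (Fin N) := fun t => (1 - t) • x with hc
  have hc0 : c 0 = x := by simp [hc]
  have hcn : ∀ t ∈ Icc (0:ℝ) 1, ‖c t‖ = 1 - t := by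
    intro t ht
    simp [hc, norm_smul, hx, abs_of_nonneg (sub_nonneg.2 ht.2)]
  have hcd : HasDerivWithinAt c (-x) (Icc 0 1) 0 := by
    have := (((hasDerivAt_id (0:ℝ)).const_sub 1).smul_const x).hasDerivWithinAt (s := Icc 0 1)
    convert! this using 1
    simp
  have hf : HasFDerivWithinAt u (fderivWithin ℝ u (closedBall 0 1) x) (closedBall 0 1) (c 0) := by
    rw [hc0]
    exact ((h1.differentiableOn one_ne_zero) x (by simp [hx])).hasFDerivWithinAt
  have hcomp := hf.comp_hasDerivWithinAt (0:ℝ) hcd (fun t ht => by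
    simp only [mem_closedBall, dist_zero_right, hcn t ht]; linarith [ht.1])
  rw [map_neg, h0, neg_zero] at hcomp
  have hsl := (hasDerivWithinAt_iff_tendsto_slope' (s := Ioc (0:ℝ) 1) (by simp)).1
    (hcomp.mono Ioc_subset_Icc_self)
  have hne : (nhdsWithin (0:ℝ) (Ioc 0 1)).NeBot := by
    rw [nhdsWithin_Ioc_eq_nhdsGT one_pos]; infer_instance
  have : ε ≤ 0 := by
    refine ge_of_tendsto hsl ?_
    have hm : Ioc (0:ℝ) 1 ∩ Iio (s₀ / 2) ∈ nhdsWithin (0:ℝ) (Ioc 0 1) :=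
      inter_mem self_mem_nhdsWithin (mem_nhdsWithin_of_mem_nhds (Iio_mem_nhds (by positivity)))
    filter_upwards [hm] with t ht
    have ht0 : 0 < t := ht.1.1
    have ht1 : t ≤ 1 := ht.1.2
    have hts : t < s₀ / 2 := ht.2
    have hn := hcn t ⟨ht0.le, ht1⟩
    have := hu (c t) (by rw [hn]; linarith) (by rw [hn]; nlinarith)
    rw [hn] at this
    rw [slope_def_field]
    simp only [Function.comp, hc0, sub_zero]
    rw [hbd x (by simp [hx]), sub_zero, le_div_iff₀ ht0]
    nlinarith [mul_pos hε ht0]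
  linarith

/-- the flux `x · W` -/
noncomputable def flux {N : ℕ} (β q lam p : ℝ) (u : EuclideanSpace ℝ (Fin N) → ℝ)
    (L : EuclideanSpace ℝ (Fin N) →L[ℝ] ℝ) (x : EuclideanSpace ℝ (Fin N)) : ℝ :=
  (L x) ^ 2 - ‖x‖ ^ 2 * (∑ j, L (EuclideanSpace.single j (1:ℝ)) ^ 2) / 2
    + ‖x‖ ^ 2 * u x ^ (p + 1) / (p + 1)
    + lam / (q + 1) * (‖x‖ ^ β * ‖x‖ ^ 2) * u x ^ (q + 1) + ((N:ℝ) - 2) / 2 * u x * L x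

lemma flux_pos {N : ℕ} (β q lam p : ℝ) (hβ : 0 ≤ β) (hq1 : 1 ≤ q) (hp : 0 < p)
    (u : EuclideanSpace ℝ (Fin N) → ℝ)
    (h1 : ContDiffOn ℝ 1 u (closedBall 0 1))
    (hbd : ∀ x ∈ sphere (0 : EuclideanSpace ℝ (Fin N)) 1, u x = 0)
    (ε s₀ : ℝ) (hε : 0 < ε) (hs0 : 0 < s₀) 
    (hu : ∀ x : EuclideanSpace ℝ (Fin N), ‖x‖ ≤ 1 → 1 - s₀ ≤ ‖x‖ ^ 2 → ε * (1 - ‖x‖ ^ 2) ≤ u x) :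
    ∃ ρ, 0 ≤ ρ ∧ ρ < 1 ∧ ∀ x : EuclideanSpace ℝ (Fin N), ρ < ‖x‖ → ‖x‖ < 1 →
      0 < flux β q lam p u (fderiv ℝ u x) x := by
  have hcu : ContinuousOn u (closedBall 0 1) := h1.continuousOn
  have hG : ContinuousOn (fderivWithin ℝ u (closedBall 0 1)) (closedBall 0 1) := by
    refine h1.continuousOn_fderivWithin ?_ le_rfl
    exact uniqueDiffOn_convex (convex_closedBall _ _) (by
      rw [interior_closedBall _ one_ne_zero]; exact ⟨0, by simp⟩)
  have hcont : ContinuousOn (fun x => flux β q lam p u (fderivWithin ℝ u (closedBall 0 1) x) x)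
      (closedBall 0 1) := by
    unfold flux
    have hx : ContinuousOn (fun x : EuclideanSpace ℝ (Fin N) => ‖x‖) (closedBall 0 1) :=
      continuous_norm.continuousOn
    have hL : ContinuousOn (fun x => fderivWithin ℝ u (closedBall 0 1) x x) (closedBall 0 1) :=
      hG.clm_apply continuousOn_id
    have hQ : ContinuousOn (fun x => ∑ j, (fderivWithin ℝ u (closedBall 0 1) x
        (EuclideanSpace.single j (1:ℝ))) ^ 2) (closedBall 0 1) :=
      continuousOn_finsetSum _ fun j _ => (hG.clm_apply continuousOn_const).pow 2
    have h4 : ContinuousOn (fun x => u x ^ (p + 1)) (closedBall 0 1) :=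
      hcu.rpow_const fun x _ => Or.inr (by linarith)
    have h5 : ContinuousOn (fun x => u x ^ (q + 1)) (closedBall 0 1) :=
      hcu.rpow_const fun x _ => Or.inr (by linarith)
    have h6 : ContinuousOn (fun x : EuclideanSpace ℝ (Fin N) => ‖x‖ ^ β) (closedBall 0 1) :=
      hx.rpow_const fun x _ => Or.inr hβ
    fun_prop
  have hsph : ∀ x : EuclideanSpace ℝ (Fin N), ‖x‖ = 1 →
      0 < flux β q lam p u (fderivWithin ℝ u (closedBall 0 1) x) x := by
    intro x hx
    set L := fderivWithin ℝ u (closedBall 0 1) x with hL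
    have hLj : ∀ j, L (EuclideanSpace.single j (1:ℝ)) = L x * x j := by
      intro j
      have := tang_zero u h1 hbd x (EuclideanSpace.single j (1:ℝ) - x j • x) hx (by
        rw [inner_sub_right, inner_smul_right, real_inner_self_eq_norm_sq, hx]
        simp [EuclideanSpace.inner_single_right])
      rw [← hL, map_sub, map_smul, smul_eq_mul] at this
      linarith
    have hsum : ∑ j, x j ^ 2 = 1 := by
      have := EuclideanSpace.norm_sq_eq x
      rw [hx] at this
      simpa using this.symm
    have hu0 := hbd x (by simp [hx])
    have hne : L x ≠ 0 := radial_neg u h1 hbd ε s₀ hε hs0 hu x hx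
    unfold flux
    simp only [hLj, mul_pow]
    rw [← Finset.mul_sum, hsum, hu0, hx, Real.zero_rpow (by linarith), Real.zero_rpow (by linarith)]
    have : 0 < L x ^ 2 := by positivity
    simp only [mul_zero, zero_div, zero_mul, add_zero, one_pow, one_mul, mul_one]
    linarith
  set S : Set (EuclideanSpace ℝ (Fin N)) := closedBall 0 1 ∩
    (fun x => flux β q lam p u (fderivWithin ℝ u (closedBall 0 1) x) x) ⁻¹' Iic 0 with hS
  have hSc : IsCompact S := by
    refine (isCompact_closedBall _ _).of_isClosed_subset ?_ inter_subset_left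
    exact hcont.preimage_isClosed_of_isClosed isClosed_closedBall isClosed_Iic
  have hfin : ∃ ρ, 0 ≤ ρ ∧ ρ < 1 ∧ ∀ x ∈ S, ‖x‖ ≤ ρ := by
    rcases S.eq_empty_or_nonempty with h | h
    · exact ⟨0, le_rfl, one_pos, by simp [h]⟩
    · obtain ⟨y, hy, hmax⟩ := hSc.exists_isMaxOn h continuous_norm.continuousOn
      refine ⟨‖y‖, norm_nonneg _, ?_, fun x hx => hmax hx⟩
      have hy1 : ‖y‖ ≤ 1 := by simpa using hy.1
      refine lt_of_le_of_ne hy1 fun h => ?_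
      exact absurd (hsph y h) (not_lt.2 hy.2)
  obtain ⟨ρ, h0, hρ, hall⟩ := hfin
  refine ⟨ρ, h0, hρ, fun x hx1 hx2 => ?_⟩
  have hfd : fderivWithin ℝ u (closedBall 0 1) x = fderiv ℝ u x :=
    fderivWithin_of_mem_nhds (mem_of_superset (isOpen_ball.mem_nhds (by simpa using hx2))
      ball_subset_closedBall)
  by_contra hcon
  have : x ∈ S := ⟨by simpa using hx2.le, by
    simp only [mem_preimage, mem_Iic, hfd]; exact not_lt.1 hcon⟩
  linarith [hall x this]

lemma sum_algebra {N : ℕ} (x a : Fin N → ℝ) (H : Fin N → Fin N → ℝ) (hH : ∀ i j, H i j = H j i)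
    (β q lam Up Uq up uq uu R R2 p : ℝ) (hp : p + 1 ≠ 0) (hq : q + 1 ≠ 0)
    (hpN : (N:ℝ) / (p + 1) = ((N:ℝ) - 2) / 2)
    (hUp : Up = up * uu) (hUq : Uq = uq * uu)
    (hR : β * R2 * (∑ i, x i ^ 2) = β * R)
    (hL : -(∑ i, H i i) = up + lam * R * uq) :
    ∑ i, (((∑ j, ((if j = i then 1 else 0) * a j + x j * H j i)) * a i + (∑ j, x j * a j) * H i i)
      - ((∑ j, a j ^ 2) / 2 + x i * (∑ j, a j * H j i))
      + (Up / (p + 1) + x i * (up * a i))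
      + lam / (q + 1) * ((R + β * R2 * x i ^ 2) * Uq + R * x i * ((q + 1) * uq * a i))
      + ((N:ℝ) - 2) / 2 * (a i * a i + uu * H i i))
    = lam * (((N:ℝ) + β) / (q + 1) - ((N:ℝ) - 2) / 2) * R * Uq := by
  set P := ∑ j, x j * a j with hP
  set Q := ∑ j, a j ^ 2 with hQ
  set D := ∑ i, H i i with hD
  set X := ∑ i, x i ^ 2 with hX
  set S := ∑ i, (∑ j, x j * H j i) * a i with hS
  have e1 : ∑ i, (∑ j, ((if j = i then 1 else 0) * a j + x j * H j i)) * a i = Q + S := by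
    rw [hQ, hS, ← Finset.sum_add_distrib]
    refine Finset.sum_congr rfl fun i _ => ?_
    rw [Finset.sum_add_distrib]
    simp
    ring
  have e2 : ∑ i, x i * (∑ j, a j * H j i) = S := by
    rw [hS]
    simp only [Finset.mul_sum, Finset.sum_mul]
    rw [Finset.sum_comm]
    refine Finset.sum_congr rfl fun i _ => Finset.sum_congr rfl fun j _ => ?_
    rw [hH i j]; ring
  have e3 : ∑ i, (lam / (q + 1) * ((R + β * R2 * x i ^ 2) * Uq + R * x i * ((q + 1) * uq * a i)))
      = lam / (q + 1) * ((N * R + β * R2 * X) * Uq + R * (q + 1) * uq * P) := by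
    rw [← Finset.mul_sum, Finset.sum_add_distrib, ← Finset.sum_mul, Finset.sum_add_distrib,
      ← Finset.mul_sum, hP, Finset.mul_sum _ _ (R * (q+1) * uq)]
    simp only [Finset.sum_const, Finset.card_univ, Fintype.card_fin, nsmul_eq_mul]
    congr 2
    refine Finset.sum_congr rfl fun i _ => ?_
    ring
  have e4 : ∑ i, (Up / (p + 1) + x i * (up * a i)) = N * (Up / (p + 1)) + up * P := by
    rw [Finset.sum_add_distrib, hP, Finset.mul_sum]
    simp only [Finset.sum_const, Finset.card_univ, Fintype.card_fin, nsmul_eq_mul]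
    congr 1
    refine Finset.sum_congr rfl fun i _ => ?_
    ring
  have e5 : ∑ i, (((N:ℝ) - 2) / 2 * (a i * a i + uu * H i i)) = ((N:ℝ) - 2) / 2 * (Q + uu * D) := by
    rw [← Finset.mul_sum, Finset.sum_add_distrib, ← Finset.mul_sum, hQ]
    simp only [sq, hD]
  rw [Finset.sum_add_distrib, Finset.sum_add_distrib, Finset.sum_add_distrib,
    Finset.sum_sub_distrib, Finset.sum_add_distrib, Finset.sum_add_distrib, e1, e2, e3, e4, e5, ← Finset.mul_sum, ← hD, hR]
  simp only [Finset.sum_const, Finset.card_univ, Fintype.card_fin, nsmul_eq_mul]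
  have e6 : (N:ℝ) * (Up / (p + 1)) = ((N:ℝ) - 2) / 2 * Up := by rw [← hpN]; ring
  have hD' : D = -(up + lam * R * uq) := by linarith
  rw [e6, hD', hUp, hUq]
  field_simp
  ring

noncomputable def Wf {N : ℕ} (β q lam p : ℝ) (u : EuclideanSpace ℝ (Fin N) → ℝ) (i : Fin N)
    (x : EuclideanSpace ℝ (Fin N)) : ℝ :=
  (∑ j, x j * fderiv ℝ u x (EuclideanSpace.single j 1)) * fderiv ℝ u x (EuclideanSpace.single i 1)
  - x i * ((∑ j, (fderiv ℝ u x (EuclideanSpace.single j 1)) ^ 2) / 2)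
  + x i * (u x ^ (p + 1) / (p + 1))
  + lam / (q + 1) * ((‖x‖ ^ β * x i) * u x ^ (q + 1))
  + ((N:ℝ) - 2) / 2 * (u x * fderiv ℝ u x (EuclideanSpace.single i 1))

lemma coord_contDiff {N : ℕ} (i : Fin N) : ContDiff ℝ 1 (fun x : EuclideanSpace ℝ (Fin N) => x i) :=
  (EuclideanSpace.proj i : EuclideanSpace ℝ (Fin N) →L[ℝ] ℝ).contDiff

lemma Wf_contDiffOn {N : ℕ} (β q lam p : ℝ) (hβ : 0 ≤ β) (u : EuclideanSpace ℝ (Fin N) → ℝ)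
    (h2 : ContDiffOn ℝ 2 u (ball 0 1))
    (hpos : ∀ x ∈ ball (0 : EuclideanSpace ℝ (Fin N)) 1, 0 < u x) (i : Fin N) :
    ContDiffOn ℝ 1 (Wf β q lam p u i) (ball 0 1) := by
  have hg := grad_contDiffOn u h2
  have hu1 : ContDiffOn ℝ 1 u (ball 0 1) := h2.of_le (by norm_num)
  have hx : ∀ j, ContDiffOn ℝ 1 (fun x : EuclideanSpace ℝ (Fin N) => x j) (ball 0 1) :=
    fun j => (coord_contDiff j).contDiffOn
  have hk := ((k_contDiff β hβ i).1).contDiffOn (s := ball 0 1)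
  have hr : ∀ r : ℝ, ContDiffOn ℝ 1 (fun x => u x ^ r) (ball 0 1) := fun r =>
    hu1.rpow_const_of_ne fun x hx => (hpos x hx).ne'
  unfold Wf
  refine ((((ContDiffOn.mul (ContDiffOn.sum fun j _ => (hx j).mul (hg _)) (hg _)).sub
    ((hx i).mul ((ContDiffOn.sum fun j _ => (hg _).pow 2).div_const 2))).add
    ((hx i).mul ((hr _).div_const _))).add (contDiffOn_const.mul (hk.mul (hr _)))).add
    (contDiffOn_const.mul (hu1.mul (hg _)))

lemma Wf_deriv {N : ℕ} (β q lam p : ℝ) (hβ : 0 ≤ β) (hp : 0 < p) (hq : 1 ≤ q)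
    (u : EuclideanSpace ℝ (Fin N) → ℝ)
    (h2 : ContDiffOn ℝ 2 u (ball 0 1))
    (hpos : ∀ x ∈ ball (0 : EuclideanSpace ℝ (Fin N)) 1, 0 < u x) (i : Fin N)
    (x : EuclideanSpace ℝ (Fin N)) (hx : x ∈ ball (0 : EuclideanSpace ℝ (Fin N)) 1)
    (a : Fin N → ℝ) (ha : ∀ j, a j = fderiv ℝ u x (EuclideanSpace.single j 1))
    (H : Fin N → Fin N → ℝ) (hH : ∀ i j, H i j = fderiv ℝ (fun y => fderiv ℝ u y
      (EuclideanSpace.single i (1:ℝ))) x (EuclideanSpace.single j (1:ℝ))) :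
    HasDerivAt (fun t : ℝ => Wf β q lam p u i (x + t • EuclideanSpace.single i (1:ℝ)))
     (((∑ j, ((if j = i then 1 else 0) * a j + x j * H j i)) * a i + (∑ j, x j * a j) * H i i)
      - ((∑ j, a j ^ 2) / 2 + x i * (∑ j, a j * H j i))
      + (u x ^ (p + 1) / (p + 1) + x i * (u x ^ p * a i))
      + lam / (q + 1) * ((‖x‖ ^ β + β * ‖x‖ ^ (β - 2) * x i ^ 2) * u x ^ (q + 1)
         + ‖x‖ ^ β * x i * ((q + 1) * u x ^ q * a i))
      + ((N:ℝ) - 2) / 2 * (a i * a i + u x * H i i)) 0 := by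
  set e : EuclideanSpace ℝ (Fin N) := EuclideanSpace.single i (1:ℝ) with he
  have hx0 : x + (0:ℝ) • e = x := by simp
  have hnb := isOpen_ball.mem_nhds hx
  have du : HasDerivAt (fun t : ℝ => u (x + t • e)) (a i) 0 := by
    have := line_hasDerivAt u x e 0 (by
      rw [hx0]; exact (h2.differentiableOn (by norm_num)).differentiableAt hnb)
    rw [hx0] at this; rw [ha]; exact this
  have dg : ∀ j, HasDerivAt (fun t : ℝ => fderiv ℝ u (x + t • e) (EuclideanSpace.single j 1))
      (H j i) 0 := by
    intro j
    have := line_hasDerivAt (fun y => fderiv ℝ u y (EuclideanSpace.single j (1:ℝ))) x e 0 (by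
      rw [hx0]
      exact ((grad_contDiffOn u h2 _).differentiableOn (by norm_num)).differentiableAt hnb)
    rw [hx0] at this; rw [hH]; exact this
  have dx : ∀ j, HasDerivAt (fun t : ℝ => (x + t • e) j) (if j = i then 1 else 0) 0 := by
    intro j
    simp only [he, coord_line]
    simpa using ((hasDerivAt_id (0:ℝ)).mul_const (if j = i then (1:ℝ) else 0)).const_add (x j)
  have dxi : HasDerivAt (fun t : ℝ => (x + t • e) i) 1 0 := by simpa using dx i
  have dk : HasDerivAt (fun t : ℝ => ‖x + t • e‖ ^ β * (x + t • e) i)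
      (‖x‖ ^ β + β * ‖x‖ ^ (β - 2) * x i ^ 2) 0 := by
    have hk := k_contDiff β hβ i
    have := line_hasDerivAt _ x e 0 ((hk.1.differentiable one_ne_zero) (x + (0:ℝ) • e))
    rw [hx0, he, hk.2 x] at this
    exact this
  have hux : u (x + (0:ℝ) • e) ≠ 0 := by rw [hx0]; exact (hpos x hx).ne'
  have dp := du.rpow_const (p := p + 1) (Or.inl hux)
  have dq := du.rpow_const (p := q + 1) (Or.inl hux)
  have dP := HasDerivAt.fun_sum (u := Finset.univ) fun j _ => (dx j).fun_mul (dg j)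
  have dQ := HasDerivAt.fun_sum (u := Finset.univ) fun j _ => (dg j).fun_pow 2
  have := ((((dP.fun_mul (dg i)).fun_sub (dxi.fun_mul (dQ.div_const 2))).fun_add
    (dxi.fun_mul (dp.div_const (p + 1)))).fun_add
    ((dk.fun_mul dq).const_mul (lam / (q + 1)))).fun_add
    ((du.fun_mul (dg i)).const_mul (((N:ℝ) - 2) / 2))
  unfold Wf
  refine this.congr_deriv ?_
  have hp1 : p + 1 ≠ 0 := by linarith
  have hs : (∑ j, ((2:ℕ):ℝ) * a j ^ (2 - 1) * H j i) / 2 = ∑ j, a j * H j i := by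
    rw [Finset.sum_div]
    refine Finset.sum_congr rfl fun j _ => ?_
    norm_num
    ring
  simp only [hx0, ← ha]
  rw [hs]
  simp only [add_sub_cancel_right]
  field_simp

lemma cutoff (a b : ℝ) (hab : a < b) : ∃ φ : ℝ → ℝ, ContDiff ℝ 1 φ ∧ (∀ t, 0 ≤ φ t) ∧
    (∀ t, b ≤ t → φ t = 0) ∧ (∀ t, deriv φ t ≤ 0) ∧ (∀ t, t ≤ a → deriv φ t = 0) ∧
    (∀ t, b ≤ t → deriv φ t = 0) ∧ ∃ t ∈ Ioo a b, deriv φ t < 0 := by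
  have hba : 0 < b - a := sub_pos.2 hab
  set φ : ℝ → ℝ := fun t => Real.smoothTransition ((b - t) / (b - a)) with hφ
  have hcd : ContDiff ℝ 1 φ :=
    (Real.smoothTransition.contDiff (n := 1)).comp ((contDiff_const.sub contDiff_id).div_const _)
  have h0 : ∀ t, b ≤ t → φ t = 0 := fun t ht =>
    Real.smoothTransition.zero_of_nonpos (div_nonpos_of_nonpos_of_nonneg (by linarith) hba.le)
  have h1 : ∀ t, t ≤ a → φ t = 1 := fun t ht =>
    Real.smoothTransition.one_of_one_le (by rw [le_div_iff₀ hba]; linarith)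
  refine ⟨φ, hcd, fun t => Real.smoothTransition.nonneg _, h0, ?_, ?_, ?_, ?_⟩
  · intro t
    have hanti : Antitone φ := fun s t hst => Real.smoothTransition.monotone (by
      gcongr)
    exact hanti.deriv_nonpos
  · intro t ht
    apply IsLocalMax.deriv_eq_zero
    refine Eventually.of_forall fun s => ?_
    simp only [h1 t ht]
    exact Real.smoothTransition.le_one _
  · intro t ht
    apply IsLocalMin.deriv_eq_zero
    refine Eventually.of_forall fun s => ?_
    simp only [h0 t ht]
    exact Real.smoothTransition.nonneg _
  · obtain ⟨c, hc, hd⟩ := exists_deriv_eq_slope φ hab hcd.continuous.continuousOn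
      (hcd.differentiable one_ne_zero).differentiableOn
    refine ⟨c, hc, ?_⟩
    rw [hd, h0 b le_rfl, h1 a le_rfl]
    exact div_neg_of_neg_of_pos (by norm_num) hba

lemma sum_xW {N : ℕ} (β q lam p : ℝ) (u : EuclideanSpace ℝ (Fin N) → ℝ)
    (x : EuclideanSpace ℝ (Fin N)) :
    ∑ i, x i * Wf β q lam p u i x = flux β q lam p u (fderiv ℝ u x) x := by
  have hLx : fderiv ℝ u x x = ∑ j, x j * fderiv ℝ u x (EuclideanSpace.single j 1) := by
    have hdec : x = ∑ j, x j • EuclideanSpace.single j (1:ℝ) := by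
      ext k
      simp [Finset.sum_apply, Pi.single_apply]
    have := congrArg (fderiv ℝ u x) hdec
    rw [map_sum] at this
    simpa using this
  have hn : ‖x‖ ^ 2 = ∑ j, x j ^ 2 := by simpa using EuclideanSpace.norm_sq_eq x
  unfold flux Wf
  rw [hLx, hn]
  set P := ∑ j, x j * fderiv ℝ u x (EuclideanSpace.single j 1) with hP
  set Q := ∑ j, (fderiv ℝ u x (EuclideanSpace.single j 1)) ^ 2 with hQ
  have : ∀ i, x i * (P * fderiv ℝ u x (EuclideanSpace.single i 1) - x i * (Q / 2)
      + x i * (u x ^ (p + 1) / (p + 1)) + lam / (q + 1) * ((‖x‖ ^ β * x i) * u x ^ (q + 1))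
      + ((N:ℝ) - 2) / 2 * (u x * fderiv ℝ u x (EuclideanSpace.single i 1)))
    = (P + ((N:ℝ) - 2) / 2 * u x) * (x i * fderiv ℝ u x (EuclideanSpace.single i 1))
      + (- (Q / 2) + u x ^ (p + 1) / (p + 1) + lam / (q + 1) * ‖x‖ ^ β * u x ^ (q + 1)) * x i ^ 2 := by
    intro i; ring
  simp only [this]
  rw [Finset.sum_add_distrib, ← Finset.mul_sum, ← Finset.mul_sum, ← hP]
  ring

lemma hess_symm {N : ℕ} (u : EuclideanSpace ℝ (Fin N) → ℝ)
    (h2 : ContDiffOn ℝ 2 u (ball 0 1)) (x : EuclideanSpace ℝ (Fin N))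
    (hx : x ∈ ball (0 : EuclideanSpace ℝ (Fin N)) 1) (v w : EuclideanSpace ℝ (Fin N)) :
    fderiv ℝ (fun y => fderiv ℝ u y v) x w = fderiv ℝ (fun y => fderiv ℝ u y w) x v := by
  have hat : ContDiffAt ℝ 2 u x := h2.contDiffAt (isOpen_ball.mem_nhds hx)
  have hd : DifferentiableAt ℝ (fderiv ℝ u) x :=
    (hat.fderiv_right (m := 1) (by norm_num)).differentiableAt one_ne_zero
  have hs : IsSymmSndFDerivAt ℝ u x := hat.isSymmSndFDerivAt (by simp)
  have key : ∀ v w, fderiv ℝ (fun y => fderiv ℝ u y v) x w = fderiv ℝ (fderiv ℝ u) x w v := by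
    intro v w
    have := hd.hasFDerivAt.clm_apply (hasFDerivAt_const v x)
    rw [this.fderiv]
    simp
  rw [key, key]
  exact hs.eq w v

set_option maxHeartbeats 1000000 in
theorem stmt_2 (N : ℕ) (hN : 3 ≤ N) (β q lam : ℝ) (hβ : 0 ≤ β)
    (hq1 : 1 ≤ q) (hq2 : q ≤ (2 * β + (N : ℝ) + 2) / ((N : ℝ) - 2)) (hlam : lam ≤ 0) :
    ¬ ∃ u : EuclideanSpace ℝ (Fin N) → ℝ,
      ContDiffOn ℝ 1 u (closedBall 0 1) ∧
      ContDiffOn ℝ 2 u (ball 0 1) ∧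
      (∀ x ∈ ball (0 : EuclideanSpace ℝ (Fin N)) 1, 0 < u x) ∧
      (∀ x ∈ sphere (0 : EuclideanSpace ℝ (Fin N)) 1, u x = 0) ∧
      (∀ x ∈ ball (0 : EuclideanSpace ℝ (Fin N)) 1,
        -laplacian u x = u x ^ (((N : ℝ) + 2) / ((N : ℝ) - 2)) + lam * ‖x‖ ^ β * u x ^ q) := by
  rintro ⟨u, h1, h2, hpos, hbd, heq⟩
  have hNr : (3:ℝ) ≤ N := by exact_mod_cast hN
  have hN2 : 0 < (N:ℝ) - 2 := by linarith
  set p : ℝ := ((N : ℝ) + 2) / ((N : ℝ) - 2) with hp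
  have hp0 : 0 < p := by positivity
  have hpN : (N:ℝ) / (p + 1) = ((N:ℝ) - 2) / 2 := by
    have : p + 1 = 2 * N / ((N:ℝ) - 2) := by rw [hp]; field_simp; ring
    rw [this]; field_simp
  have hc : 0 ≤ ((N:ℝ) + β) / (q + 1) - ((N:ℝ) - 2) / 2 := by
    rw [le_div_iff₀ hN2] at hq2
    rw [sub_nonneg, le_div_iff₀ (by linarith)]
    nlinarith
  obtain ⟨ε, hε, s₀, hs0, hs1, hu⟩ := hopf_bound hN β q lam hβ hq1 hlam u p h1 h2 hpos hbd heq
  obtain ⟨ρ, hρ0, hρ1, hflux⟩ := flux_pos β q lam p hβ hq1 hp0 u h1 hbd ε s₀ hε hs0 hu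
  have hρ2 : ρ ^ 2 < 1 := by nlinarith
  set b : ℝ := (ρ ^ 2 + 1) / 2 with hb
  have hb1 : b < 1 := by linarith
  have hab : ρ ^ 2 < b := by linarith
  obtain ⟨φ, hφc, hφ0, hφb, hφn, hφa', hφb', t₀, ht₀, hφt⟩ := cutoff (ρ ^ 2) b hab
  have hfl : ∀ x : EuclideanSpace ℝ (Fin N), ρ ^ 2 < ‖x‖ ^ 2 → ‖x‖ ^ 2 < b →
      0 < flux β q lam p u (fderiv ℝ u x) x := fun x hx1 hx2 =>
    hflux x (lt_of_pow_lt_pow_left₀ 2 (norm_nonneg _) hx1)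
      (lt_of_pow_lt_pow_left₀ 2 zero_le_one (by linarith))
  set V : Fin N → EuclideanSpace ℝ (Fin N) → ℝ := fun i x => φ (‖x‖ ^ 2) * Wf β q lam p u i x with hV
  have hVout : ∀ x : EuclideanSpace ℝ (Fin N), b < ‖x‖ ^ 2 → ∀ i, V i =ᶠ[nhds x] fun _ => 0 := by
    intro x hx i
    have ho : IsOpen {y : EuclideanSpace ℝ (Fin N) | b < ‖y‖ ^ 2} :=
      isOpen_lt continuous_const (by fun_prop)
    filter_upwards [ho.mem_nhds hx] with y hy
    simp [hV, hφb _ (le_of_lt hy)]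
  have hcases : ∀ x : EuclideanSpace ℝ (Fin N), x ∈ ball (0:EuclideanSpace ℝ (Fin N)) 1 ∨
      b < ‖x‖ ^ 2 := by
    intro x
    by_cases h : ‖x‖ < 1
    · left; simpa using h
    · right; nlinarith
  have hVc : ∀ i, ContDiff ℝ 1 (V i) := by
    intro i
    rw [contDiff_iff_contDiffAt]
    intro x
    rcases hcases x with hx | hx
    · have hW := (Wf_contDiffOn β q lam p hβ u h2 hpos i).contDiffAt (isOpen_ball.mem_nhds hx)
      have hφx : ContDiff ℝ 1 (fun x : EuclideanSpace ℝ (Fin N) => φ (‖x‖ ^ 2)) :=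
        hφc.comp (contDiff_norm_sq ℝ)
      exact hφx.contDiffAt.mul hW
    · exact contDiffAt_const.congr_of_eventuallyEq (hVout x hx i)
  have hVs : ∀ i, HasCompactSupport (V i) := by
    intro i
    refine HasCompactSupport.intro (isCompact_closedBall (0:EuclideanSpace ℝ (Fin N)) 1) ?_
    intro x hx
    have : b < ‖x‖ ^ 2 := by
      rcases hcases x with h | h
      · exact absurd (ball_subset_closedBall h) hx
      · exact h
    exact (hVout x this i).self_of_nhds
  have hdiv : ∀ x ∈ ball (0:EuclideanSpace ℝ (Fin N)) 1,
      ∑ i, fderiv ℝ (V i) x (EuclideanSpace.single i 1) =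
      2 * deriv φ (‖x‖ ^ 2) * flux β q lam p u (fderiv ℝ u x) x +
      φ (‖x‖ ^ 2) * (lam * (((N:ℝ) + β) / (q + 1) - ((N:ℝ) - 2) / 2) * ‖x‖ ^ β * u x ^ (q + 1)) := by
    intro x hx
    have hux := hpos x hx
    have hterm := fun i => Wf_deriv β q lam p hβ hp0 hq1 u h2 hpos i x hx
      (fun j => fderiv ℝ u x (EuclideanSpace.single j 1)) (fun _ => rfl)
      (fun i j => fderiv ℝ (fun y => fderiv ℝ u y
      (EuclideanSpace.single i (1:ℝ))) x (EuclideanSpace.single j (1:ℝ))) (fun _ _ => rfl)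
    have hsum := sum_algebra (fun i => x i) (fun j => fderiv ℝ u x (EuclideanSpace.single j 1))
      (fun i j => fderiv ℝ (fun y => fderiv ℝ u y
      (EuclideanSpace.single i (1:ℝ))) x (EuclideanSpace.single j (1:ℝ)))
      (fun i j => hess_symm u h2 x hx _ _) β q lam (u x ^ (p + 1)) (u x ^ (q + 1)) (u x ^ p)
      (u x ^ q) (u x) (‖x‖ ^ β) (‖x‖ ^ (β - 2)) p (by linarith) (by linarith) hpN
      (Real.rpow_add_one hux.ne' p) (Real.rpow_add_one hux.ne' q) (by
        have hn : ∑ j, x j ^ 2 = ‖x‖ ^ 2 := by simpa using (EuclideanSpace.norm_sq_eq x).symm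
        rw [hn]
        by_cases hx0 : x = 0
        · subst hx0
          rcases hβ.eq_or_lt with h | h
          · simp [← h]
          · simp [Real.zero_rpow h.ne']
        · have hxp : 0 < ‖x‖ := norm_pos_iff.2 hx0
          rw [Real.rpow_sub hxp, mul_assoc]
          simp; field_simp; simp) (heq x hx)
    rw [← hsum, ← sum_xW, Finset.mul_sum, Finset.mul_sum, ← Finset.sum_add_distrib]
    refine Finset.sum_congr rfl fun i _ => ?_
    have hx0 : x + (0:ℝ) • EuclideanSpace.single i (1:ℝ) = x := by simp
    have hl := line_hasDerivAt (V i) x (EuclideanSpace.single i 1) 0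
      ((hVc i).differentiable one_ne_zero _)
    rw [hx0] at hl
    have hdn : HasDerivAt (fun t : ℝ => ‖x + t • EuclideanSpace.single i (1:ℝ)‖ ^ 2) (2 * x i) 0 := by
      simp only [norm_sq_line]
      have := (((hasDerivAt_id (0:ℝ)).const_mul (2 * x i)).const_add (‖x‖ ^ 2)).add
        ((hasDerivAt_id (0:ℝ)).pow 2)
      convert! this using 1
      simp
    have hdφ : HasDerivAt (fun t : ℝ => φ (‖x + t • EuclideanSpace.single i (1:ℝ)‖ ^ 2))
        (deriv φ (‖x‖ ^ 2) * (2 * x i)) 0 := by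
      have hφd : HasDerivAt φ (deriv φ (‖x‖ ^ 2))
          (‖x + (0:ℝ) • EuclideanSpace.single i (1:ℝ)‖ ^ 2) := by
        rw [hx0]; exact (hφc.differentiable one_ne_zero _).hasDerivAt
      exact hφd.comp (0:ℝ) hdn
    have hl2 := hdφ.fun_mul (hterm i)
    rw [hl.unique hl2, hx0]
    ring
  set D : EuclideanSpace ℝ (Fin N) → ℝ := fun x =>
    ∑ i, fderiv ℝ (V i) x (EuclideanSpace.single i 1) with hD
  have hDnonpos : ∀ x, D x ≤ 0 := by
    intro x
    rcases hcases x with hx | hx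
    · simp only [hD]
      rw [hdiv x hx]
      have hux := hpos x hx
      have t1 : deriv φ (‖x‖ ^ 2) * flux β q lam p u (fderiv ℝ u x) x ≤ 0 := by
        by_cases ha : ‖x‖ ^ 2 ≤ ρ ^ 2
        · rw [hφa' _ ha, zero_mul]
        by_cases hb' : b ≤ ‖x‖ ^ 2
        · rw [hφb' _ hb', zero_mul]
        exact mul_nonpos_of_nonpos_of_nonneg (hφn _) (hfl x (not_le.1 ha) (not_le.1 hb')).le
      have t2 : φ (‖x‖ ^ 2) * (lam * (((N:ℝ) + β) / (q + 1) - ((N:ℝ) - 2) / 2) * ‖x‖ ^ β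
          * u x ^ (q + 1)) ≤ 0 := by
        refine mul_nonpos_of_nonneg_of_nonpos (hφ0 _) ?_
        refine mul_nonpos_of_nonpos_of_nonneg (mul_nonpos_of_nonpos_of_nonneg
          (mul_nonpos_of_nonpos_of_nonneg hlam hc) (by positivity)) (by positivity)
      linarith
    · simp only [hD]
      refine le_of_eq (Finset.sum_eq_zero fun i _ => ?_)
      rw [(hVout x hx i).fderiv_eq]; simp
  obtain ⟨x₀, hx₀⟩ : ∃ x₀ : EuclideanSpace ℝ (Fin N), ‖x₀‖ ^ 2 = t₀ := by
    refine ⟨EuclideanSpace.single ⟨0, by omega⟩ (Real.sqrt t₀), ?_⟩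
    have : 0 ≤ t₀ := by nlinarith [ht₀.1]
    simp [this]
  have hDneg : D x₀ < 0 := by
    have hx : x₀ ∈ ball (0:EuclideanSpace ℝ (Fin N)) 1 := by
      simp only [mem_ball, dist_zero_right]
      exact lt_of_pow_lt_pow_left₀ 2 zero_le_one (by rw [hx₀]; linarith [ht₀.2])
    simp only [hD]
    rw [hdiv x₀ hx]
    have hux := hpos x₀ hx
    have t1 : deriv φ (‖x₀‖ ^ 2) * flux β q lam p u (fderiv ℝ u x₀) x₀ < 0 :=
      mul_neg_of_neg_of_pos (by rw [hx₀]; exact hφt)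
        (hfl x₀ (by rw [hx₀]; exact ht₀.1) (by rw [hx₀]; exact ht₀.2))
    have t2 : φ (‖x₀‖ ^ 2) * (lam * (((N:ℝ) + β) / (q + 1) - ((N:ℝ) - 2) / 2) * ‖x₀‖ ^ β
        * u x₀ ^ (q + 1)) ≤ 0 := by
      refine mul_nonpos_of_nonneg_of_nonpos (hφ0 _) ?_
      refine mul_nonpos_of_nonpos_of_nonneg (mul_nonpos_of_nonpos_of_nonneg
        (mul_nonpos_of_nonpos_of_nonneg hlam hc) (by positivity)) (by positivity)
    linarith
  have hterm_cont : ∀ i, Continuous fun x => fderiv ℝ (V i) x (EuclideanSpace.single i 1) :=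
    fun i => ((hVc i).continuous_fderiv one_ne_zero).clm_apply continuous_const
  have hterm_supp : ∀ i, HasCompactSupport fun x => fderiv ℝ (V i) x (EuclideanSpace.single i 1) :=
    fun i => (hVs i).fderiv_apply (𝕜 := ℝ) _
  have hDint : ∫ x, D x = 0 := by
    simp only [hD]
    rw [integral_finsetSum _ fun i _ => (hterm_cont i).integrable_of_hasCompactSupport (hterm_supp i)]
    exact Finset.sum_eq_zero fun i _ => int_zero volume (V i) (hVc i) (hVs i) _
  have hDc : Continuous fun x => -D x := (continuous_finsetSum _ fun i _ => hterm_cont i).neg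
  have hDs : HasCompactSupport fun x => -D x := by
    refine HasCompactSupport.intro (isCompact_closedBall (0:EuclideanSpace ℝ (Fin N)) 1) ?_
    intro x hx
    have : b < ‖x‖ ^ 2 := by
      rcases hcases x with h | h
      · exact absurd (ball_subset_closedBall h) hx
      · exact h
    simp only [hD, neg_eq_zero]
    refine Finset.sum_eq_zero fun i _ => ?_
    rw [(hVout x this i).fderiv_eq]; simp
  have hfinal := hDc.integral_pos_of_hasCompactSupport_nonneg_nonzero (μ := volume) hDs
    (fun x => by simpa using hDnonpos x) (x := x₀) (by simpa using hDneg.ne)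
  rw [integral_neg, hDint] at hfinal
  simp at hfinal
end
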